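/- arXiv:0705.2148 — 6 statements merged into one kernel-verified Lean document; each statement's English description precedes it below -/
import Mathlib

section
/- Let (X,𝓑,m,T) be a conservative, ergodic, measure-preserving transformation of a σ-finite measure space. If F ∈ 𝓑 with 0 < m(F) < ∞ is quasi finite, then for every ε > 0 there exists a measurable A ⊆ F with m(F ∖ A) < ε such that every measurable B ⊆ A with m(B) > 0 is quasi finite. -/
open MeasureTheory
open scoped ENNReal

/-- The first return time `φ_A(x) = min {n ≥ 1 : Tⁿ x ∈ A}` (with value `0` if there is no
such `n`). -/
noncomputable def returnTime {X : Type*} (T : X → X) (A : Set X) (x : X) : ℕ :=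
  sInf {n : ℕ | 1 ≤ n ∧ T^[n] x ∈ A}

/-- `A` is quasi finite: the return time partition `ρ_A` has finite entropy, i.e.
`∑_{n≥1} pₙ log (1/pₙ) < ∞` where `pₙ = m(A ∩ {φ_A = n}) / m A`
(with the convention `0 · log (1/0) = 0`). -/
def QuasiFiniteSet {X : Type*} [MeasurableSpace X] (T : X → X) (m : Measure X)
    (A : Set X) : Prop :=
  Summable fun n : ℕ =>
    (m (A ∩ {x | returnTime T A x = n + 1})).toReal / (m A).toReal *
      Real.log (1 / ((m (A ∩ {x | returnTime T A x = n + 1})).toReal / (m A).toReal))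

/-- Running maximum of Birkhoff sums. -/
noncomputable def runMax {X : Type*} (T : X → X) (f : X → ℝ) : ℕ → X → ℝ
  | 0 => fun _ => 0
  | n + 1 => fun x => max 0 (f x + runMax T f n (T x))

lemma runMax_nonneg {X : Type*} (T : X → X) (f : X → ℝ) (n : ℕ) (x : X) :
    0 ≤ runMax T f n x := by
  cases n with
  | zero => simp [runMax]
  | succ n => simp [runMax]

lemma runMax_mono {X : Type*} (T : X → X) (f : X → ℝ) (n : ℕ) :
    ∀ x, runMax T f n x ≤ runMax T f (n + 1) x := by
  induction n with
  | zero => intro x; exact runMax_nonneg T f 1 x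
  | succ n ih =>
    intro x
    have := ih (T x)
    simp only [runMax] at this ⊢
    gcongr

lemma birkhoffSum_le_runMax {X : Type*} (T : X → X) (f : X → ℝ) (n : ℕ) :
    ∀ x, birkhoffSum T f n x ≤ runMax T f n x := by
  induction n with
  | zero => intro x; simp [runMax]
  | succ n ih =>
    intro x
    rw [birkhoffSum_succ']
    simp only [runMax]
    exact le_trans (by linarith [ih (T x)]) (le_max_right _ _)

lemma runMax_measurable {X : Type*} [MeasurableSpace X] {T : X → X} (hT : Measurable T)
    {f : X → ℝ} (hf : Measurable f) (n : ℕ) : Measurable (runMax T f n) := by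
  induction n with
  | zero => exact measurable_const
  | succ n ih => exact measurable_const.max (hf.add (ih.comp hT))

lemma runMax_integrable {X : Type*} [MeasurableSpace X] {m : Measure X} {T : X → X}
    (hT : MeasurePreserving T m m)
    {f : X → ℝ} (hf : Integrable f m) (n : ℕ) : Integrable (runMax T f n) m := by
  induction n with
  | zero => exact integrable_zero _ _ _
  | succ n ih =>
    exact (integrable_zero _ _ _).sup (hf.add (hT.integrable_comp_of_integrable ih))

/-- Hopf's maximal ergodic inequality. -/
lemma hopf_max {X : Type*} [MeasurableSpace X] {m : Measure X} {T : X → X}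
    (hT : MeasurePreserving T m m)
    {f : X → ℝ} (hfm : Measurable f) (hf : Integrable f m) (n : ℕ) :
    0 ≤ ∫ x in {x | 0 < runMax T f n x}, f x ∂m := by
  cases n with
  | zero => simp [runMax]
  | succ n =>
    set E := {x | 0 < runMax T f (n + 1) x} with hE
    have hEm : MeasurableSet E :=
      measurableSet_lt measurable_const (runMax_measurable hT.measurable hfm (n + 1))
    have i1 := runMax_integrable hT hf (n + 1)
    have i0 := runMax_integrable hT hf n
    have i0T : Integrable (fun x => runMax T f n (T x)) m := hT.integrable_comp_of_integrable i0
    have e1 : ∫ x in E, f x ∂m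
        = ∫ x in E, (runMax T f (n + 1) x - runMax T f n (T x)) ∂m := by
      apply setIntegral_congr_fun hEm
      intro x hx
      have hx' : 0 < runMax T f (n + 1) x := hx
      simp only [runMax] at hx' ⊢
      have : 0 < f x + runMax T f n (T x) := by
        rcases lt_max_iff.1 hx' with h | h
        · exact absurd h (lt_irrefl _)
        · exact h
      rw [max_eq_right this.le]; ring
    rw [e1, integral_sub i1.integrableOn i0T.integrableOn]
    have e2 : ∫ x in E, runMax T f (n + 1) x ∂m = ∫ x, runMax T f (n + 1) x ∂m := by
      apply setIntegral_eq_integral_of_forall_compl_eq_zero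
      intro x hx
      exact le_antisymm (not_lt.1 hx) (runMax_nonneg _ _ _ _)
    have e3 : ∫ x in E, runMax T f n (T x) ∂m ≤ ∫ x, runMax T f n (T x) ∂m :=
      setIntegral_le_integral i0T (Filter.Eventually.of_forall fun x => runMax_nonneg _ _ _ _)
    have e4 : ∫ x, runMax T f n (T x) ∂m = ∫ x, runMax T f n x ∂m := by
      have h := integral_map (μ := m) hT.measurable.aemeasurable
        (f := runMax T f n) (by
          exact (runMax_measurable hT.measurable hfm n).aestronglyMeasurable)
      rw [hT.map_eq] at h
      exact h.symm
    have e5 : ∫ x, runMax T f n x ∂m ≤ ∫ x, runMax T f (n + 1) x ∂m :=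
      integral_mono i0 i1 (runMax_mono T f n)
    linarith

/-- For nonnegative integrable `g`, the ratio of Birkhoff sums is bounded off a small set. -/
lemma good_set {X : Type*} [MeasurableSpace X] {m : Measure X} {T : X → X}
    (hT : MeasurePreserving T m m) {F : Set X} (hF : MeasurableSet F) (hF1 : m F < ⊤)
    {g : X → ℝ} (hgm : Measurable g) (hg : Integrable g m) (hg0 : ∀ x, 0 ≤ g x)
    (ε : ℝ≥0∞) (hε : 0 < ε) :
    ∃ C : ℝ, 0 < C ∧ ∃ A : Set X, MeasurableSet A ∧ A ⊆ F ∧ m (F \ A) < ε ∧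
      ∀ x ∈ A, ∀ n, birkhoffSum T g n x ≤ C * birkhoffSum T (F.indicator 1) n x := by
  obtain ⟨δ, hδ0, hδ⟩ : ∃ δ : ℝ, 0 < δ ∧ ENNReal.ofReal δ < ε := by
    obtain ⟨δ, h0, h1⟩ := ENNReal.lt_iff_exists_nnreal_btwn.1 hε
    refine ⟨δ, by exact_mod_cast h0, by simpa using h1⟩
  have hI : 0 ≤ ∫ x, g x ∂m := integral_nonneg hg0
  set C : ℝ := (∫ x, g x ∂m + 1) / δ with hC
  have hC0 : 0 < C := by positivity
  have hind : Integrable (F.indicator (1 : X → ℝ)) m :=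
    (integrable_indicator_iff hF).2 (integrableOn_const hF1.ne)
  have hindm : Measurable (F.indicator (1 : X → ℝ)) := measurable_one.indicator hF
  set f : X → ℝ := fun x => g x - C * F.indicator (1 : X → ℝ) x with hf
  have hfm : Measurable f := hgm.sub (hindm.const_mul C)
  have hfi : Integrable f m := hg.sub (hind.const_mul C)
  set E : ℕ → Set X := fun n => {x | 0 < runMax T f n x} with hE
  have hEm : ∀ n, MeasurableSet (E n) := fun n =>
    measurableSet_lt measurable_const (runMax_measurable hT.measurable hfm n)
  have hEmono : Monotone E := monotone_nat_of_le_succ fun n x hx =>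
    lt_of_lt_of_le hx (runMax_mono T f n x)
  have hbound : ∀ n, m (F ∩ E n) ≤ ENNReal.ofReal δ := by
    intro n
    have h := hopf_max hT hfm hfi n
    have h2 : ∫ x in E n, f x ∂m = ∫ x in E n, g x ∂m - C * m.real (F ∩ E n) := by
      rw [hf, integral_sub hg.integrableOn (hind.const_mul C).integrableOn,
        integral_const_mul, integral_indicator_one hF, measureReal_restrict_apply hF]
    have h3 : ∫ x in E n, g x ∂m ≤ ∫ x, g x ∂m :=
      setIntegral_le_integral hg (Filter.Eventually.of_forall hg0)
    have h4 : C * m.real (F ∩ E n) ≤ ∫ x, g x ∂m := by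
      rw [h2] at h
      linarith
    have h5 : m.real (F ∩ E n) ≤ δ := by
      have : C * m.real (F ∩ E n) ≤ C * δ := by
        have : C * δ = ∫ x, g x ∂m + 1 := by rw [hC]; field_simp
        linarith
      exact le_of_mul_le_mul_left this hC0
    have hfin : m (F ∩ E n) ≠ ⊤ :=
      ((measure_mono Set.inter_subset_left).trans_lt hF1).ne
    rw [← ENNReal.ofReal_toReal hfin]
    exact ENNReal.ofReal_le_ofReal h5
  refine ⟨C, hC0, F \ ⋃ n, E n, hF.diff (MeasurableSet.iUnion hEm), Set.sdiff_subset, ?_, ?_⟩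
  · rw [Set.sdiff_sdiff_right_self, Set.inter_iUnion]
    refine lt_of_le_of_lt ?_ hδ
    rw [Monotone.measure_iUnion]
    · exact iSup_le hbound
    · intro i j hij
      exact Set.inter_subset_inter_right _ (hEmono hij)
  · intro x hx n
    have h1 : ¬ 0 < runMax T f n x := fun h => hx.2 (Set.mem_iUnion.2 ⟨n, h⟩)
    have h2 := birkhoffSum_le_runMax T f n x
    have h3 : birkhoffSum T f n x
        = birkhoffSum T g n x - C * birkhoffSum T (F.indicator 1) n x := by
      simp only [birkhoffSum, hf, Finset.sum_sub_distrib, Finset.mul_sum]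
    linarith

/-- Renewal weights. -/
noncomputable def renew (q : ℕ → ℝ) : ℕ → ℝ
  | 0 => 1
  | n + 1 => 1 / 2 * ∑ i : Fin (n + 1), q i * renew q (n - i)
decreasing_by omega

lemma renew_succ (q : ℕ → ℝ) (n : ℕ) :
    renew q (n + 1) = 1 / 2 * ∑ i ∈ Finset.range (n + 1), q i * renew q (n - i) := by
  rw [renew, Finset.sum_range]

lemma renew_nonneg (q : ℕ → ℝ) (hq : ∀ n, 0 ≤ q n) (n : ℕ) : 0 ≤ renew q n := by
  induction n using Nat.strong_induction_on with
  | _ n ih =>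
    cases n with
    | zero => simp [renew]
    | succ n =>
      rw [renew_succ]
      exact mul_nonneg (by norm_num) (Finset.sum_nonneg fun i _ =>
        mul_nonneg (hq i) (ih _ (by omega)))

lemma renew_sum_le (q : ℕ → ℝ) (hq : ∀ n, 0 ≤ q n)
    (hs : ∀ n, ∑ i ∈ Finset.range n, q i ≤ 1) (K : ℕ) :
    ∑ k ∈ Finset.range K, renew q k ≤ 2 := by
  induction K with
  | zero => simp
  | succ K ih =>
    rw [Finset.sum_range_succ', show renew q 0 = 1 by rw [renew]]
    simp only [renew_succ]
    rw [← Finset.mul_sum]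
    have h : ∑ k ∈ Finset.range K, ∑ i ∈ Finset.range (k + 1), q i * renew q (k - i)
        ≤ 2 := by
      rw [Finset.sum_comm' (t' := Finset.range K) (s' := fun i => Finset.Ico i K)
        (by intro x y; simp only [Finset.mem_range, Finset.mem_Ico]; omega)]
      calc ∑ i ∈ Finset.range K, ∑ k ∈ Finset.Ico i K, q i * renew q (k - i)
          ≤ ∑ i ∈ Finset.range K, q i * 2 := by
            apply Finset.sum_le_sum
            intro i _
            rw [← Finset.mul_sum]
            refine mul_le_mul_of_nonneg_left ?_ (hq i)
            rw [Finset.sum_Ico_eq_sum_range]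
            simp only [Nat.add_sub_cancel_left]
            refine le_trans (Finset.sum_le_sum_of_subset_of_nonneg (t := Finset.range K) ?_ ?_) ih
            · intro j; simp only [Finset.mem_range]; omega
            · intro j _ _; exact renew_nonneg q hq j
        _ ≤ 2 := by rw [← Finset.sum_mul]; linarith [hs K]
    linarith

lemma returnTime_eq_succ {X : Type*} (T : X → X) (A : Set X) (x : X) (n : ℕ) :
    returnTime T A x = n + 1 ↔ T^[n + 1] x ∈ A ∧ ∀ j, 1 ≤ j → j ≤ n → T^[j] x ∉ A := by
  constructor
  · intro h
    have hne : {n : ℕ | 1 ≤ n ∧ T^[n] x ∈ A}.Nonempty := by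
      by_contra hcon
      rw [Set.not_nonempty_iff_eq_empty] at hcon
      rw [returnTime, hcon] at h
      simp at h
    refine ⟨?_, ?_⟩
    · have := (Nat.sInf_mem hne).2
      rw [returnTime] at h
      rwa [h] at this
    · intro j h1 h2 h3
      have : returnTime T A x ≤ j := Nat.sInf_le ⟨h1, h3⟩
      omega
  · rintro ⟨h1, h2⟩
    have hle : returnTime T A x ≤ n + 1 := Nat.sInf_le ⟨by omega, h1⟩
    have hmem : 1 ≤ returnTime T A x ∧ T^[returnTime T A x] x ∈ A :=
      Nat.sInf_mem (s := {n : ℕ | 1 ≤ n ∧ T^[n] x ∈ A}) ⟨n + 1, by omega, h1⟩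
    by_contra hcon
    exact h2 _ hmem.1 (by omega) hmem.2

lemma measurableSet_returnTime_succ {X : Type*} [MeasurableSpace X] {T : X → X}
    (hT : Measurable T) {A : Set X} (hA : MeasurableSet A) (n : ℕ) :
    MeasurableSet {x | returnTime T A x = n + 1} := by
  have h : ∀ j, MeasurableSet (T^[j] ⁻¹' A) := fun j => (hT.iterate j) hA
  have e : {x | returnTime T A x = n + 1}
      = T^[n + 1] ⁻¹' A ∩ ⋂ j ∈ Finset.Icc 1 n, (T^[j] ⁻¹' A)ᶜ := by
    ext x
    have := returnTime_eq_succ T A x n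
    simp only [Set.mem_ofPred_eq, Set.mem_inter_iff, Set.mem_preimage, Set.mem_iInter,
      Finset.mem_Icc, Set.mem_compl_iff, this, and_imp]
  rw [e]
  exact (h (n + 1)).inter (Finset.measurableSet_biInter _ fun j _ => (h j).compl)

lemma measurable_returnTime {X : Type*} [MeasurableSpace X] {T : X → X}
    (hT : Measurable T) {A : Set X} (hA : MeasurableSet A) :
    Measurable (returnTime T A) := by
  have hs := measurableSet_returnTime_succ hT hA
  refine measurable_to_countable' fun n => ?_
  cases n with
  | succ n => exact hs n
  | zero =>
    have : returnTime T A ⁻¹' {0} = (⋃ n : ℕ, {x | returnTime T A x = n + 1})ᶜ := by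
      ext x
      simp only [Set.mem_preimage, Set.mem_singleton_iff, Set.mem_compl_iff, Set.mem_iUnion,
        Set.mem_ofPred_eq, not_exists]
      constructor
      · intro h n; omega
      · intro h
        by_contra h0
        exact h (returnTime T A x - 1) (by omega)
    rw [this]
    exact (MeasurableSet.iUnion hs).compl

/-- The information cost function on `F`. -/
noncomputable def cost {X : Type*} (T : X → X) (F : Set X) (q : ℕ → ℝ) : X → ℝ :=
  F.indicator fun x => if returnTime T F x = 0 then 0 else - Real.log (q (returnTime T F x - 1))

lemma birkhoffSum_return {X : Type*} (T : X → X) (F : Set X) (f : X → ℝ)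
    (hf : ∀ x ∉ F, f x = 0) (x : X) (a : ℕ)
    (ha : ∀ j, 1 ≤ j → j ≤ a → T^[j] x ∉ F) :
    birkhoffSum T f (a + 1) x = f x := by
  rw [birkhoffSum, Finset.sum_range_succ']
  rw [Finset.sum_eq_zero]
  · simp
  · intro i hi
    exact hf _ (ha _ (by omega) (by simp at hi; omega))

lemma renew_ge {X : Type*} (T : X → X) (F : Set X) (q : ℕ → ℝ) (hq : ∀ n, 0 < q n) (n : ℕ) :
    ∀ x ∈ F, T^[n] x ∈ F →
      Real.exp (- (birkhoffSum T (cost T F q) n x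
        + Real.log 2 * birkhoffSum T (F.indicator 1) n x)) ≤ renew q n := by
  induction n using Nat.strong_induction_on with
  | _ n ih =>
    intro x hx hn
    rcases Nat.eq_zero_or_pos n with rfl | hpos
    · simp [renew]
    have hle : returnTime T F x ≤ n := Nat.sInf_le ⟨hpos, hn⟩
    have hmem : 1 ≤ returnTime T F x ∧ T^[returnTime T F x] x ∈ F :=
      Nat.sInf_mem (s := {n : ℕ | 1 ≤ n ∧ T^[n] x ∈ F}) ⟨n, hpos, hn⟩
    obtain ⟨a, ha⟩ : ∃ a, returnTime T F x = a + 1 := ⟨returnTime T F x - 1, by omega⟩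
    obtain ⟨k, rfl⟩ : ∃ k, n = (a + 1) + k := ⟨n - (a + 1), by omega⟩
    have hr := (returnTime_eq_succ T F x a).1 ha
    have hk : T^[k] (T^[a + 1] x) ∈ F := by
      rw [← Function.iterate_add_apply, add_comm k]; exact hn
    have IH := ih k (by omega) _ hr.1 hk
    rw [birkhoffSum_add T (cost T F q) (a + 1) k, birkhoffSum_add T (F.indicator 1) (a + 1) k,
      birkhoffSum_return T F (cost T F q) (fun y hy => by simp [cost, hy]) x a hr.2,
      birkhoffSum_return T F (F.indicator 1) (fun y hy => by simp [hy]) x a hr.2]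
    have hc : cost T F q x = - Real.log (q a) := by
      simp [cost, hx, ha]
    have h1 : (F.indicator 1 x : ℝ) = 1 := by simp [hx]
    rw [hc, h1]
    set S := birkhoffSum T (cost T F q) k (T^[a + 1] x)
    set R : ℝ := birkhoffSum T (F.indicator 1) k (T^[a + 1] x)
    rw [show -(-Real.log (q a) + S + Real.log 2 * (1 + R))
      = Real.log (q a) + (- Real.log 2 + -(S + Real.log 2 * R)) by ring,
      Real.exp_add, Real.exp_add, Real.exp_log (hq a), Real.exp_neg, Real.exp_log (by norm_num)]
    rw [show a + 1 + k = (a + k) + 1 by ring, renew_succ]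
    have hsing : q a * renew q k ≤ ∑ i ∈ Finset.range (a + k + 1), q i * renew q (a + k - i) := by
      have := Finset.single_le_sum (s := Finset.range (a + k + 1))
        (f := fun i => q i * renew q (a + k - i))
        (fun i _ => mul_nonneg (hq i).le (renew_nonneg q (fun n => (hq n).le) _))
        (Finset.mem_range.2 (show a < a + k + 1 by omega))
      simpa using this
    have : q a * Real.exp (-(S + Real.log 2 * R)) ≤ q a * renew q k :=
      mul_le_mul_of_nonneg_left IH (hq a).le
    linarith

/-- Kac-type inequality. -/
lemma kac_le {X : Type*} [MeasurableSpace X] {m : Measure X} {T : X → X}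
    (hT : MeasurePreserving T m m) {F B : Set X} (hF : MeasurableSet F) (hB : MeasurableSet B) :
    ∑' n : ℕ, ∑ i ∈ Finset.range (n + 1),
      m ((B ∩ {x | returnTime T B x = n + 1}) ∩ T^[i] ⁻¹' F) ≤ m F := by
  have hTi : ∀ i, Measurable (T^[i]) := hT.measurable.iterate
  set E : ℕ → Set X := fun i =>
    (B ∩ T^[i] ⁻¹' F) ∩ ⋂ j ∈ Finset.Icc 1 i, (T^[j] ⁻¹' B)ᶜ with hE
  have hEm : ∀ i, MeasurableSet (E i) := fun i =>
    (hB.inter (hTi i hF)).inter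
      (Finset.measurableSet_biInter _ fun j _ => (hTi j hB).compl)
  have hBn : ∀ n, MeasurableSet (B ∩ {x | returnTime T B x = n + 1}) := fun n =>
    hB.inter (measurableSet_returnTime_succ hT.measurable hB n)
  have step1 : ∀ i, ∑' n : ℕ, (if i ≤ n then
      m ((B ∩ {x | returnTime T B x = n + 1}) ∩ T^[i] ⁻¹' F) else 0) ≤ m (E i) := by
    intro i
    have e : ∀ n : ℕ, (if i ≤ n then
      m ((B ∩ {x | returnTime T B x = n + 1}) ∩ T^[i] ⁻¹' F) else 0)
      = m (if i ≤ n then ((B ∩ {x | returnTime T B x = n + 1}) ∩ T^[i] ⁻¹' F) else ∅) := by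
      intro n; split_ifs <;> simp
    simp only [e]
    rw [← measure_iUnion]
    · apply measure_mono
      refine Set.iUnion_subset fun n => ?_
      split_ifs with h
      · rintro x ⟨⟨h1, h2⟩, h3⟩
        refine ⟨⟨h1, h3⟩, ?_⟩
        simp only [Set.mem_iInter, Finset.mem_Icc]
        intro j hj
        exact ((returnTime_eq_succ T B x n).1 h2).2 j hj.1 (by omega)
      · exact Set.empty_subset _
    · intro a b hab
      refine Set.disjoint_left.2 fun x hxa hxb => hab ?_
      dsimp only at hxa hxb
      split_ifs at hxa hxb
      · have h1 : returnTime T B x = a + 1 := hxa.1.2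
        have h2 : returnTime T B x = b + 1 := hxb.1.2
        omega
      all_goals simp_all
    · intro n
      split_ifs
      · exact (hBn n).inter (hTi i hF)
      · exact MeasurableSet.empty
  have step2 : ∑' i, m (E i) ≤ m F := by
    refine ENNReal.tsum_le_of_sum_range_le fun K => ?_
    have e : ∀ i ∈ Finset.range K, m (E i) = m (T^[K - i] ⁻¹' (E i)) := fun i _ =>
      ((hT.iterate (K - i)).measure_preimage (hEm i).nullMeasurableSet).symm
    rw [Finset.sum_congr rfl e, ← measure_biUnion_finset]
    · rw [← (hT.iterate K).measure_preimage hF.nullMeasurableSet]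
      apply measure_mono
      refine Set.iUnion₂_subset fun i hi => ?_
      intro x hx
      have hx2 : T^[i] (T^[K - i] x) ∈ F := hx.1.2
      rw [← Function.iterate_add_apply] at hx2
      have : i + (K - i) = K := by have := Finset.mem_range.1 hi; omega
      rw [this] at hx2
      exact hx2
    · have key : ∀ a b, a < b → b < K →
          Disjoint (T^[K - a] ⁻¹' (E a)) (T^[K - b] ⁻¹' (E b)) := by
        intro a b hab hbK
        refine Set.disjoint_left.2 fun x hxa hxb => ?_
        have h1 : T^[K - a] x ∈ B := hxa.1.1
        have h2 := hxb.2
        simp only [Set.mem_iInter, Finset.mem_Icc] at h2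
        have h3 := h2 (b - a) (by omega)
        apply h3
        show T^[b - a] (T^[K - b] x) ∈ B
        rw [← Function.iterate_add_apply, show b - a + (K - b) = K - a by omega]
        exact h1
      intro a ha b hb hab
      simp only [Finset.coe_range, Set.mem_Iio] at ha hb
      rcases lt_or_gt_of_ne hab with h | h
      · exact key a b h hb
      · exact (key b a h ha).symm
    · intro i _
      exact hTi _ (hEm i)
  calc _ = ∑' n : ℕ, ∑' i : ℕ, (if i ≤ n then
      m ((B ∩ {x | returnTime T B x = n + 1}) ∩ T^[i] ⁻¹' F) else 0) := by
        congr 1; ext n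
        rw [tsum_eq_sum (s := Finset.range (n + 1))]
        · refine Finset.sum_congr rfl fun i hi => ?_
          rw [if_pos (by have := Finset.mem_range.1 hi; omega)]
        · intro i hi
          rw [if_neg (by simp at hi; omega)]
    _ = ∑' i : ℕ, ∑' n : ℕ, (if i ≤ n then
      m ((B ∩ {x | returnTime T B x = n + 1}) ∩ T^[i] ⁻¹' F) else 0) := ENNReal.tsum_comm
    _ ≤ ∑' i, m (E i) := ENNReal.tsum_le_tsum step1
    _ ≤ m F := step2

lemma gibbs {p w : ℝ} (hp : 0 ≤ p) (hw : 0 < w) :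
    p * Real.log (1 / p) ≤ p * (- Real.log w) + w := by
  rcases hp.eq_or_lt with rfl | hp
  · simp [hw.le]
  have h := Real.log_le_sub_one_of_pos (div_pos hw hp)
  rw [Real.log_div hw.ne' hp.ne'] at h
  have h2 := mul_le_mul_of_nonneg_left h hp.le
  have h3 : p * (w / p - 1) = w - p := by field_simp
  rw [one_div, Real.log_inv]
  nlinarith

lemma sum_level_le {X : Type*} [MeasurableSpace X] {m : Measure X} {T : X → X}
    (hT : Measurable T) {A : Set X} (hA : MeasurableSet A) :
    ∑' n : ℕ, m (A ∩ {x | returnTime T A x = n + 1}) ≤ m A := by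
  rw [← measure_iUnion]
  · exact measure_mono (Set.iUnion_subset fun n => Set.inter_subset_left)
  · intro a b hab
    refine Set.disjoint_left.2 fun x hxa hxb => hab ?_
    have h1 : returnTime T A x = a + 1 := hxa.2
    have h2 : returnTime T A x = b + 1 := hxb.2
    omega
  · exact fun n => hA.inter (measurableSet_returnTime_succ hT hA n)


lemma renew_pos (q : ℕ → ℝ) (hq : ∀ n, 0 < q n) (n : ℕ) : 0 < renew q n := by
  cases n with
  | zero => simp [renew]
  | succ n =>
    rw [renew_succ, Finset.sum_range_succ]
    have h1 : 0 ≤ ∑ i ∈ Finset.range n, q i * renew q (n - i) :=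
      Finset.sum_nonneg fun i _ => mul_nonneg (hq i).le (renew_nonneg q (fun n => (hq n).le) _)
    have h2 : renew q (n - n) = 1 := by simp [renew]
    rw [h2]
    have := hq n
    linarith

lemma level_prob {X : Type*} [MeasurableSpace X] {m : Measure X} {T : X → X}
    (hT : Measurable T) {A : Set X} (hA : MeasurableSet A) (h0 : 0 < m A) (h1 : m A < ⊤) (n : ℕ) :
    ∑ i ∈ Finset.range n,
      (m (A ∩ {x | returnTime T A x = (i : ℕ) + 1})).toReal / (m A).toReal ≤ 1 := by
  have hpos : 0 < (m A).toReal := ENNReal.toReal_pos h0.ne' h1.ne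
  rw [← Finset.sum_div, div_le_one hpos, ← ENNReal.toReal_sum]
  · exact ENNReal.toReal_mono h1.ne ((ENNReal.sum_le_tsum _).trans (sum_level_le hT hA))
  · intro i _
    exact ((measure_mono Set.inter_subset_left).trans_lt h1).ne

lemma cost_measurable {X : Type*} [MeasurableSpace X] {T : X → X}
    (hT : Measurable T) {F : Set X} (hF : MeasurableSet F) (q : ℕ → ℝ) :
    Measurable (cost T F q) := by
  refine Measurable.indicator ?_ hF
  exact (measurable_from_nat
    (f := fun n : ℕ => if n = 0 then (0 : ℝ) else - Real.log (q (n - 1)))).comp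
    (measurable_returnTime hT hF)

lemma cost_nonneg {X : Type*} (T : X → X) (F : Set X) (q : ℕ → ℝ) (hq : ∀ n, 0 < q n)
    (hq1 : ∀ n, q n ≤ 1) (x : X) : 0 ≤ cost T F q x := by
  refine Set.indicator_nonneg (fun x _ => ?_) x
  split_ifs
  · exact le_rfl
  · have := Real.log_nonpos (hq (returnTime T F x - 1)).le (hq1 _)
    linarith

lemma cost_integrable {X : Type*} [MeasurableSpace X] {m : Measure X} {T : X → X}
    (hT : Measurable T) {F : Set X} (hF : MeasurableSet F) (hF1 : m F < ⊤) (q : ℕ → ℝ)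
    (hq : ∀ n, 0 < q n) (hq1 : ∀ n, q n ≤ 1)
    (hs : Summable fun n : ℕ =>
      (m (F ∩ {x | returnTime T F x = n + 1})).toReal * (- Real.log (q n))) :
    Integrable (cost T F q) m := by
  have hm := cost_measurable hT hF q
  refine ⟨hm.aestronglyMeasurable, ?_⟩
  rw [hasFiniteIntegral_iff_ofReal (Filter.Eventually.of_forall (cost_nonneg T F q hq hq1))]
  have hFn : ∀ n : ℕ, MeasurableSet (F ∩ {x | returnTime T F x = n + 1}) := fun n =>
    hF.inter (measurableSet_returnTime_succ hT hF n)
  calc ∫⁻ x, ENNReal.ofReal (cost T F q x) ∂m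
      ≤ ∫⁻ x, ∑' n : ℕ, (F ∩ {x | returnTime T F x = n + 1}).indicator
          (fun _ => ENNReal.ofReal (- Real.log (q n))) x ∂m := by
        apply lintegral_mono
        intro x
        by_cases hx : x ∈ F
        · by_cases h0 : returnTime T F x = 0
          · simp [cost, hx, h0]
          · obtain ⟨a, ha⟩ : ∃ a, returnTime T F x = a + 1 := ⟨returnTime T F x - 1, by omega⟩
            refine le_trans ?_ (ENNReal.le_tsum a)
            have hmem : x ∈ F ∩ {x | returnTime T F x = a + 1} := ⟨hx, ha⟩
            rw [Set.indicator_of_mem hmem]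
            simp [cost, hx, ha]
        · simp [cost, hx]
    _ = ∑' n : ℕ, ENNReal.ofReal (- Real.log (q n)) * m (F ∩ {x | returnTime T F x = n + 1}) := by
        rw [lintegral_tsum]
        · congr 1; ext n
          rw [lintegral_indicator_const (hFn n)]
        · intro n
          exact (measurable_const.indicator (hFn n)).aemeasurable
    _ = ∑' n : ℕ, ENNReal.ofReal
          ((m (F ∩ {x | returnTime T F x = n + 1})).toReal * (- Real.log (q n))) := by
        congr 1; ext n
        rw [ENNReal.ofReal_mul ENNReal.toReal_nonneg, ENNReal.ofReal_toReal, mul_comm]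
        exact ((measure_mono Set.inter_subset_left).trans_lt hF1).ne
    _ < ⊤ := hs.tsum_ofReal_lt_top

lemma quasi_of_good {X : Type*} [MeasurableSpace X] {m : Measure X} {T : X → X}
    (hT : MeasurePreserving T m m) {F : Set X} (hF : MeasurableSet F) (hF1 : m F < ⊤)
    (q : ℕ → ℝ) (hq : ∀ n, 0 < q n) (hqs : ∀ n, ∑ i ∈ Finset.range n, q i ≤ 1)
    (C : ℝ) (hC : 0 < C) (B : Set X) (hB : MeasurableSet B) (hBF : B ⊆ F) (hB0 : 0 < m B)
    (hgood : ∀ x ∈ B, ∀ n, birkhoffSum T (cost T F q) n x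
      ≤ C * birkhoffSum T (F.indicator 1) n x) :
    QuasiFiniteSet T m B := by
  have hB1 : m B < ⊤ := (measure_mono hBF).trans_lt hF1
  have hpos : 0 < (m B).toReal := ENNReal.toReal_pos hB0.ne' hB1.ne
  have hTi : ∀ i, Measurable (T^[i]) := hT.measurable.iterate
  set K : ℝ := C + Real.log 2 with hK
  have hK0 : 0 < K := add_pos hC (Real.log_pos (by norm_num))
  have hBn : ∀ n : ℕ, MeasurableSet (B ∩ {x | returnTime T B x = n + 1}) := fun n =>
    hB.inter (measurableSet_returnTime_succ hT.measurable hB n)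
  have hfin : ∀ n : ℕ, m (B ∩ {x | returnTime T B x = n + 1}) ≠ ⊤ := fun n =>
    ((measure_mono Set.inter_subset_left).trans_lt hB1).ne
  have hfin2 : ∀ n i : ℕ, m ((B ∩ {x | returnTime T B x = n + 1}) ∩ T^[i] ⁻¹' F) ≠ ⊤ :=
    fun n i => ((measure_mono Set.inter_subset_left).trans_lt (hfin n).lt_top).ne
  have hpt : ∀ n : ℕ, ∀ x ∈ B ∩ {x | returnTime T B x = n + 1},
      - Real.log (renew q (n + 1)) ≤ K * birkhoffSum T (F.indicator 1) (n + 1) x := by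
    rintro n x ⟨hx, hr⟩
    have hr' := ((returnTime_eq_succ T B x n).1 hr).1
    have h1 := renew_ge T F q hq (n + 1) x (hBF hx) (hBF hr')
    have h2 := (Real.le_log_iff_exp_le (renew_pos q hq (n + 1))).2 h1
    have h3 := hgood x hx (n + 1)
    rw [hK, add_mul]
    linarith
  set c : ℕ → ℝ := fun n => (∑ i ∈ Finset.range (n + 1),
      m ((B ∩ {x | returnTime T B x = n + 1}) ∩ T^[i] ⁻¹' F)).toReal with hc
  have hcs : Summable c :=
    ENNReal.summable_toReal ((kac_le hT hF hB).trans_lt hF1).ne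
  have hint : ∀ n : ℕ, (m (B ∩ {x | returnTime T B x = n + 1})).toReal
      * (- Real.log (renew q (n + 1))) ≤ K * c n := by
    intro n
    set D := B ∩ {x | returnTime T B x = n + 1} with hD
    have hi : ∀ i ∈ Finset.range (n + 1),
        IntegrableOn ((T^[i] ⁻¹' F).indicator (1 : X → ℝ)) D m := fun i _ =>
      (integrableOn_const (hfin n)).indicator (hTi i hF)
    have hS : ∀ x, birkhoffSum T (F.indicator (1 : X → ℝ)) (n + 1) x
        = ∑ i ∈ Finset.range (n + 1), (T^[i] ⁻¹' F).indicator (1 : X → ℝ) x := fun x => rfl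
    have hle : ∫ x in D, (- Real.log (renew q (n + 1))) ∂m
        ≤ ∫ x in D, K * ∑ i ∈ Finset.range (n + 1), (T^[i] ⁻¹' F).indicator (1 : X → ℝ) x ∂m := by
      refine setIntegral_mono_on (integrableOn_const (hfin n)) ?_ (hBn n) ?_
      · exact (integrable_finsetSum _ hi).const_mul K
      · intro x hx
        rw [← hS]
        exact hpt n x hx
    rw [setIntegral_const, integral_const_mul, integral_finsetSum _ hi] at hle
    refine le_trans hle (le_of_eq ?_)
    simp only [hc]
    rw [ENNReal.toReal_sum fun i _ => hfin2 n i]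
    congr 1
    refine Finset.sum_congr rfl fun i _ => ?_
    rw [integral_indicator_one (hTi i hF), measureReal_restrict_apply (hTi i hF), Set.inter_comm]
    rfl
  have hws : Summable fun n => renew q (n + 1) := by
    have : Summable (renew q) := summable_of_sum_range_le
      (renew_nonneg q fun n => (hq n).le) (renew_sum_le q (fun n => (hq n).le) hqs)
    exact (summable_nat_add_iff 1).2 this
  unfold QuasiFiniteSet
  refine Summable.of_nonneg_of_le (fun n => ?_) (fun n => ?_)
    (((hcs.mul_left K).div_const (m B).toReal).add hws)
  · have hp0 : 0 ≤ (m (B ∩ {x | returnTime T B x = n + 1})).toReal / (m B).toReal := by positivity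
    have hp1 : (m (B ∩ {x | returnTime T B x = n + 1})).toReal / (m B).toReal ≤ 1 := by
      rw [div_le_one hpos]
      exact ENNReal.toReal_mono hB1.ne (measure_mono Set.inter_subset_left)
    refine mul_nonneg hp0 ?_
    rw [one_div, Real.log_inv]
    linarith [Real.log_nonpos hp0 hp1]
  · refine le_trans (gibbs (by positivity) (renew_pos q hq (n + 1))) ?_
    refine add_le_add ?_ le_rfl
    rw [div_mul_eq_mul_div]
    exact div_le_div_of_nonneg_right (hint n) hpos.le

/-- if `F` (of finite positive measure) is quasi finite then for every `ε > 0`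
there is a measurable `A ⊆ F` with `m (F \ A) < ε` such that every measurable `B ⊆ A` of
positive measure is quasi finite. -/
theorem stmt_2 {X : Type*} [MeasurableSpace X] (m : Measure X) [SigmaFinite m]
    (T : X → X) (hc : Conservative T m) (he : Ergodic T m)
    (F : Set X) (hF : MeasurableSet F) (hF0 : 0 < m F) (hF1 : m F < ⊤)
    (hqf : QuasiFiniteSet T m F) :
    ∀ ε : ℝ≥0∞, 0 < ε →
      ∃ A : Set X, MeasurableSet A ∧ A ⊆ F ∧ m (F \ A) < ε ∧
        ∀ B : Set X, MeasurableSet B → B ⊆ A → 0 < m B → QuasiFiniteSet T m B := by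
  intro ε hε
  have hT := he.toMeasurePreserving
  have hpos : 0 < (m F).toReal := ENNReal.toReal_pos hF0.ne' hF1.ne
  set p : ℕ → ℝ := fun n =>
    (m (F ∩ {x | returnTime T F x = n + 1})).toReal / (m F).toReal with hp
  have hp0 : ∀ n, 0 ≤ p n := fun n => by positivity
  have hps : ∀ n, ∑ i ∈ Finset.range n, p i ≤ 1 := level_prob hT.measurable hF hF0 hF1
  set q : ℕ → ℝ := fun n => (p n + (1 / 2) ^ (n + 1)) / 2 with hq
  have hq0 : ∀ n, 0 < q n := fun n => by
    have := hp0 n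
    positivity
  have hgeo : ∀ n : ℕ, ∑ i ∈ Finset.range n, (1 / 2 : ℝ) ^ (i + 1) = 1 - (1 / 2) ^ n := by
    intro n
    induction n with
    | zero => simp
    | succ n ih => rw [Finset.sum_range_succ, ih, pow_succ]; ring
  have hqs : ∀ n, ∑ i ∈ Finset.range n, q i ≤ 1 := by
    intro n
    simp only [hq]
    rw [← Finset.sum_div, Finset.sum_add_distrib, hgeo]
    have : (0 : ℝ) < (1 / 2) ^ n := by positivity
    linarith [hps n]
  have hq1 : ∀ n, q n ≤ 1 := fun n =>
    (Finset.single_le_sum (fun i _ => (hq0 i).le)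
      (Finset.mem_range.2 (Nat.lt_succ_self n))).trans (hqs (n + 1))
  have hsum : Summable fun n : ℕ =>
      (m (F ∩ {x | returnTime T F x = n + 1})).toReal * (- Real.log (q n)) := by
    have hpsum : Summable p := summable_of_sum_range_le hp0 hps
    have hqf' : Summable fun n => p n * Real.log (1 / p n) := hqf
    refine Summable.of_nonneg_of_le (fun n => ?_) (fun n => ?_)
      ((hqf'.add (hpsum.mul_right (Real.log 2))).mul_left (m F).toReal)
    · refine mul_nonneg ENNReal.toReal_nonneg ?_
      linarith [Real.log_nonpos (hq0 n).le (hq1 n)]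
    · have e : (m (F ∩ {x | returnTime T F x = n + 1})).toReal = (m F).toReal * p n := by
        simp only [hp]
        field_simp
      rw [e, mul_assoc]
      refine mul_le_mul_of_nonneg_left ?_ hpos.le
      rw [← mul_add]
      rcases (hp0 n).eq_or_lt with h | h
      · rw [← h]; simp
      · refine mul_le_mul_of_nonneg_left ?_ h.le
        have h1 : Real.log (p n / 2) ≤ Real.log (q n) := by
          apply Real.log_le_log (by positivity)
          simp only [hq]
          have : (0 : ℝ) < (1 / 2) ^ (n + 1) := by positivity
          linarith
        rw [Real.log_div h.ne' (by norm_num)] at h1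
        rw [one_div, Real.log_inv]
        linarith
  obtain ⟨C, hC, A, hA, hAF, hAε, hgood⟩ := good_set hT hF hF1
    (cost_measurable hT.measurable hF q)
    (cost_integrable hT.measurable hF hF1 q hq0 hq1 hsum)
    (cost_nonneg T F q hq0 hq1) ε hε
  refine ⟨A, hA, hAF, hAε, fun B hB hBA hB0 => ?_⟩
  exact quasi_of_good hT hF hF1 q hq0 hqs C hC B hB (hBA.trans hAF) hB0
    fun x hx => hgood x (hBA hx)
end

section
/- Let (X,𝓑,m,T) be a conservative, ergodic, quasi finite, measure-preserving transformation of a σ-finite measure space. Then for every F ∈ 𝓑 with 0 < m(F) < ∞ there exists a measurable A ⊆ F with m(A) > 0 such that every measurable B ⊆ A with m(B) > 0 is quasi finite. -/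
open MeasureTheory
open scoped ENNReal

namespace QF

lemma returnTime_eq_iff {X : Type*} (T : X → X) (A : Set X) (x : X) (n : ℕ) :
    returnTime T A x = n + 1 ↔ T^[n + 1] x ∈ A ∧ ∀ i < n, T^[i + 1] x ∉ A := by
  unfold returnTime
  constructor
  · intro h
    have hne : {n : ℕ | 1 ≤ n ∧ T^[n] x ∈ A}.Nonempty := by
      by_contra hc
      rw [Set.not_nonempty_iff_eq_empty] at hc
      rw [hc] at h
      simp at h
    have hm := Nat.sInf_mem hne
    rw [h] at hm
    refine ⟨hm.2, fun i hi hA => ?_⟩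
    have : sInf {n : ℕ | 1 ≤ n ∧ T^[n] x ∈ A} ≤ i + 1 := Nat.sInf_le ⟨by omega, hA⟩
    omega
  · rintro ⟨h1, h2⟩
    apply le_antisymm
    · exact Nat.sInf_le ⟨by omega, h1⟩
    · have hne : {n : ℕ | 1 ≤ n ∧ T^[n] x ∈ A}.Nonempty := ⟨n + 1, by omega, h1⟩
      apply le_csInf hne
      rintro b ⟨hb1, hb2⟩
      by_contra hlt
      obtain ⟨i, rfl⟩ : ∃ i, b = i + 1 := ⟨b - 1, by omega⟩
      exact h2 i (by omega) hb2

/-- Points of `A` whose return time is `n + 1`. -/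
def R {X : Type*} (T : X → X) (A : Set X) (n : ℕ) : Set X :=
  A ∩ {x | returnTime T A x = n + 1}

lemma mem_R {X : Type*} {T : X → X} {A : Set X} {n : ℕ} {x : X} :
    x ∈ R T A n ↔ x ∈ A ∧ T^[n + 1] x ∈ A ∧ ∀ i < n, T^[i + 1] x ∉ A := by
  unfold R
  rw [← returnTime_eq_iff]
  rfl

lemma R_disjoint {X : Type*} {T : X → X} {A : Set X} {n k : ℕ} {x : X}
    (hn : x ∈ R T A n) (hk : x ∈ R T A k) : n = k := by
  have h1 : returnTime T A x = n + 1 := hn.2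
  have h2 : returnTime T A x = k + 1 := hk.2
  omega

lemma measurable_R {X : Type*} [MeasurableSpace X] {T : X → X} (hT : Measurable T)
    {A : Set X} (hA : MeasurableSet A) (n : ℕ) : MeasurableSet (R T A n) := by
  have : R T A n = A ∩ (T^[n + 1] ⁻¹' A ∩ ⋂ i : ℕ, ⋂ _ : i < n, (T^[i + 1] ⁻¹' A)ᶜ) := by
    ext x
    rw [mem_R]
    simp
  rw [this]
  refine hA.inter (((hT.iterate _) hA).inter ?_)
  exact MeasurableSet.iInter fun i => MeasurableSet.iInter fun _ => ((hT.iterate _) hA).compl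

/-- Points of `B` which do not return to `B` up to time `j`. -/
def Bj {X : Type*} (T : X → X) (B : Set X) (j : ℕ) : Set X :=
  {x | x ∈ B ∧ ∀ i < j, T^[i + 1] x ∉ B}

/-- Points not in `B` up to time `j`. -/
def Ej {X : Type*} (T : X → X) (B : Set X) (j : ℕ) : Set X :=
  {x | x ∉ B ∧ ∀ i < j, T^[i + 1] x ∉ B}

lemma measurable_Bj {X : Type*} [MeasurableSpace X] {T : X → X} (hT : Measurable T)
    {A : Set X} (hA : MeasurableSet A) (n : ℕ) : MeasurableSet (Bj T A n) := by
  have : Bj T A n = A ∩ (⋂ i : ℕ, ⋂ _ : i < n, (T^[i + 1] ⁻¹' A)ᶜ) := by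
    ext x
    simp [Bj]
  rw [this]
  refine hA.inter ?_
  exact MeasurableSet.iInter fun i => MeasurableSet.iInter fun _ => ((hT.iterate _) hA).compl

lemma measurable_Ej {X : Type*} [MeasurableSpace X] {T : X → X} (hT : Measurable T)
    {A : Set X} (hA : MeasurableSet A) (n : ℕ) : MeasurableSet (Ej T A n) := by
  have : Ej T A n = Aᶜ ∩ (⋂ i : ℕ, ⋂ _ : i < n, (T^[i + 1] ⁻¹' A)ᶜ) := by
    ext x
    simp [Ej]
  rw [this]
  refine hA.compl.inter ?_
  exact MeasurableSet.iInter fun i => MeasurableSet.iInter fun _ => ((hT.iterate _) hA).compl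

lemma preimage_Ej {X : Type*} (T : X → X) (B : Set X) (j : ℕ) :
    T ⁻¹' (Ej T B j) = Bj T B (j + 1) ∪ Ej T B (j + 1) := by
  ext x
  have key : x ∈ T ⁻¹' (Ej T B j) ↔ ∀ i < j + 1, T^[i + 1] x ∉ B := by
    simp only [Set.mem_preimage, Ej, Set.mem_ofPred_eq]
    constructor
    · rintro ⟨h0, h⟩ i hi
      cases i with
      | zero => simpa using h0
      | succ i =>
        have := h i (by omega)
        rwa [← Function.iterate_succ_apply] at this
    · intro h
      refine ⟨by simpa using h 0 (by omega), fun i hi => ?_⟩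
      rw [← Function.iterate_succ_apply]
      exact h (i + 1) (by omega)
  rw [key]
  simp only [Bj, Ej, Set.mem_union, Set.mem_ofPred_eq]
  tauto

lemma kac_aux {X : Type*} [MeasurableSpace X] {m : Measure X} {T : X → X}
    (hT : MeasurePreserving T m m) {B : Set X} (hB : MeasurableSet B) {f : X → ℝ≥0∞}
    (hf : Measurable f) (n : ℕ) :
    ∑ j ∈ Finset.range (n + 1), ∫⁻ x in Bj T B j, f (T^[j] x) ∂m
      + ∫⁻ x in Ej T B n, f (T^[n] x) ∂m = ∫⁻ x, f x ∂m := by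
  induction n with
  | zero =>
    have h1 : Bj T B 0 = B := by ext x; simp [Bj]
    have h2 : Ej T B 0 = Bᶜ := by ext x; simp [Ej]
    simp only [zero_add, Finset.sum_range_one, h1, h2, Function.iterate_zero, id]
    exact lintegral_add_compl f hB
  | succ n ih =>
    rw [← ih, Finset.sum_range_succ _ (n + 1), add_assoc]
    congr 1
    have hg : Measurable fun x => f (T^[n] x) := hf.comp (hT.measurable.iterate n)
    rw [← hT.setLIntegral_comp_preimage (measurable_Ej hT.measurable hB n) hg, preimage_Ej,
      lintegral_union (measurable_Ej hT.measurable hB _)]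
    · simp only [Function.iterate_succ_apply]
    · rw [Set.disjoint_left]
      intro x hx hx'
      exact hx'.1 hx.1

lemma kac_le {X : Type*} [MeasurableSpace X] {m : Measure X} {T : X → X}
    (hT : MeasurePreserving T m m) {B : Set X} (hB : MeasurableSet B) {f : X → ℝ≥0∞}
    (hf : Measurable f) :
    ∑' n, ∫⁻ x in R T B n, ∑ j ∈ Finset.range (n + 1), f (T^[j] x) ∂m ≤ ∫⁻ x, f x ∂m := by
  have hfj : ∀ j, Measurable fun x => f (T^[j] x) := fun j => hf.comp (hT.measurable.iterate j)
  calc ∑' n, ∫⁻ x in R T B n, ∑ j ∈ Finset.range (n + 1), f (T^[j] x) ∂m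
      = ∫⁻ x, ∑' n, (R T B n).indicator
          (fun x => ∑ j ∈ Finset.range (n + 1), f (T^[j] x)) x ∂m := by
        rw [lintegral_tsum]
        · congr 1
          ext n
          rw [lintegral_indicator (measurable_R hT.measurable hB n)]
        · intro n
          exact ((Finset.measurable_sum _ fun j _ => hfj j).indicator
            (measurable_R hT.measurable hB n)).aemeasurable
    _ ≤ ∫⁻ x, ∑' j, (Bj T B j).indicator (fun x => f (T^[j] x)) x ∂m := by
        apply lintegral_mono
        intro x
        show ∑' n, (R T B n).indicator
          (fun x => ∑ j ∈ Finset.range (n + 1), f (T^[j] x)) x ≤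
          ∑' j, (Bj T B j).indicator (fun x => f (T^[j] x)) x
        by_cases h : ∃ n, x ∈ R T B n
        · obtain ⟨n, hn⟩ := h
          rw [tsum_eq_single n, Set.indicator_of_mem hn]
          · refine le_trans (Finset.sum_le_sum fun j hj => ?_) (ENNReal.sum_le_tsum (Finset.range (n + 1)))
            rw [Set.indicator_of_mem]
            rw [mem_R] at hn
            rw [Finset.mem_range] at hj
            exact ⟨hn.1, fun i hi => hn.2.2 i (by omega)⟩
          · intro k hk
            apply Set.indicator_of_notMem
            exact fun hx => hk (R_disjoint hx hn)
        · push Not at h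
          simp [h]
    _ = ∑' j, ∫⁻ x in Bj T B j, f (T^[j] x) ∂m := by
        rw [lintegral_tsum]
        · congr 1
          ext n
          rw [lintegral_indicator (measurable_Bj hT.measurable hB n)]
        · intro n
          exact ((hfj n).indicator (measurable_Bj hT.measurable hB n)).aemeasurable
    _ ≤ ∫⁻ x, f x ∂m := by
        apply ENNReal.tsum_le_of_sum_range_le
        intro n
        rw [← kac_aux hT hB hf n, Finset.sum_range_succ, add_assoc]
        exact le_self_add

/-- Renewal weights. -/
noncomputable def q (p : ℕ → ℝ) : ℕ → ℝ
  | 0 => 1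
  | n + 1 => ∑ i : Fin (n + 1), (1 / 2) * p i * q p (n - i)
termination_by n => n
decreasing_by omega

lemma q_zero (p : ℕ → ℝ) : q p 0 = 1 := by rw [q]

lemma q_succ (p : ℕ → ℝ) (n : ℕ) :
    q p (n + 1) = ∑ i ∈ Finset.range (n + 1), (1 / 2) * p i * q p (n - i) := by
  rw [q, Finset.sum_range]

lemma q_nonneg {p : ℕ → ℝ} (hp : ∀ n, 0 ≤ p n) (n : ℕ) : 0 ≤ q p n := by
  induction n using Nat.strong_induction_on with
  | _ n ih =>
    cases n with
    | zero => rw [q_zero]; norm_num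
    | succ n =>
      rw [q_succ]
      refine Finset.sum_nonneg fun i hi => ?_
      have := ih (n - i) (by omega)
      have := hp i
      positivity

lemma q_ge {p : ℕ → ℝ} (hp : ∀ n, 0 ≤ p n) {n i : ℕ} (hi : i ≤ n) :
    (1 / 2) * p i * q p (n - i) ≤ q p (n + 1) := by
  rw [q_succ]
  apply Finset.single_le_sum (f := fun i => (1 / 2) * p i * q p (n - i))
  · intro j _
    have := q_nonneg hp (n - j)
    have := hp j
    positivity
  · simp; omega

lemma q_sum {p : ℕ → ℝ} (hp : ∀ n, 0 ≤ p n) (hs : ∀ n, ∑ i ∈ Finset.range n, p i ≤ 1) (n : ℕ) :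
    ∑ k ∈ Finset.range n, q p k ≤ 2 := by
  induction n with
  | zero => simp
  | succ M ih =>
    rw [Finset.sum_range_succ', q_zero]
    have : ∑ k ∈ Finset.range M, q p (k + 1) ≤
        (1 / 2) * (∑ i ∈ Finset.range M, p i) * ∑ k ∈ Finset.range M, q p k := by
      calc ∑ k ∈ Finset.range M, q p (k + 1)
          = ∑ k ∈ Finset.range M, ∑ i ∈ Finset.range (k + 1), (1 / 2) * p i * q p (k - i) := by
            simp only [q_succ]
        _ = ∑ i ∈ Finset.range M, ∑ k ∈ Finset.Ico i M, (1 / 2) * p i * q p (k - i) := by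
            apply Finset.sum_comm'
            intro x y
            simp
            omega
        _ ≤ ∑ i ∈ Finset.range M, (1 / 2) * p i * ∑ k ∈ Finset.range M, q p k := by
            apply Finset.sum_le_sum
            intro i _
            rw [← Finset.mul_sum]
            apply mul_le_mul_of_nonneg_left _ (by have := hp i; positivity)
            rw [Finset.sum_Ico_eq_sum_range]
            simp only [Nat.add_sub_cancel_left]
            apply Finset.sum_le_sum_of_subset_of_nonneg
            · intro a; simp; omega
            · intro a _ _; exact q_nonneg hp a
        _ = _ := by rw [← Finset.sum_mul, ← Finset.mul_sum]
    have h0 : 0 ≤ ∑ k ∈ Finset.range M, q p k := Finset.sum_nonneg fun k _ => q_nonneg hp k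
    have h1 : 0 ≤ ∑ i ∈ Finset.range M, p i := Finset.sum_nonneg fun k _ => hp k
    nlinarith [hs M]

lemma pointwise {X : Type*} {T : X → X} {Q : Set X} {p : ℕ → ℝ} (hp : ∀ n, 0 ≤ p n)
    {f : X → ℝ≥0∞}
    (hf : ∀ k, ∀ x ∈ R T Q k, ENNReal.ofReal (Real.log 2 + Real.log (1 / p k)) ≤ f x) (N : ℕ) :
    ∀ x, x ∈ Q → T^[N] x ∈ Q → (∀ j k, T^[j] x ∈ R T Q k → 0 < p k) →
    0 < q p N ∧ ENNReal.ofReal (Real.log (1 / q p N)) ≤ ∑ j ∈ Finset.range N, f (T^[j] x) := by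
  induction N using Nat.strong_induction_on with
  | _ N ih =>
    intro x hx hN hpos
    cases N with
    | zero => simp [q_zero]
    | succ n =>
      obtain ⟨a, ha, hxa⟩ : ∃ a ≤ n, x ∈ R T Q a := by
        classical
        have hex : ∃ a, T^[a + 1] x ∈ Q := ⟨n, hN⟩
        refine ⟨Nat.find hex, Nat.find_min' hex hN, ?_⟩
        rw [mem_R]
        exact ⟨hx, Nat.find_spec hex, fun i hi => Nat.find_min hex hi⟩
      have hpa := hpos 0 a hxa
      have hret := (mem_R.1 hxa).2.1
      have hc : T^[n - a] (T^[a + 1] x) = T^[n + 1] x := by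
        rw [← Function.iterate_add_apply]
        rw [show n - a + (a + 1) = n + 1 by omega]
      obtain ⟨hq, hle⟩ := ih (n - a) (by omega) (T^[a + 1] x) hret (by rw [hc]; exact hN) (by
        intro j k hj
        rw [← Function.iterate_add_apply] at hj
        exact hpos _ k hj)
      have hge := q_ge hp ha
      have hposq : 0 < (1 / 2) * p a * q p (n - a) := by positivity
      refine ⟨lt_of_lt_of_le hposq hge, ?_⟩
      have hlog : Real.log (1 / q p (n + 1)) ≤
          (Real.log 2 + Real.log (1 / p a)) + Real.log (1 / q p (n - a)) := by
        have h1 := Real.log_le_log hposq hge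
        rw [Real.log_mul (by positivity) (by positivity),
          Real.log_mul (by positivity) (by positivity)] at h1
        simp only [one_div, Real.log_inv] at h1 ⊢
        linarith
      calc ENNReal.ofReal (Real.log (1 / q p (n + 1)))
          ≤ ENNReal.ofReal (Real.log 2 + Real.log (1 / p a)) +
            ENNReal.ofReal (Real.log (1 / q p (n - a))) :=
            (ENNReal.ofReal_le_ofReal hlog).trans ENNReal.ofReal_add_le
        _ ≤ f x + ∑ j ∈ Finset.range (n - a), f (T^[j] (T^[a + 1] x)) :=
            add_le_add (hf a x hxa) hle
        _ ≤ ∑ j ∈ Finset.range (a + 1), f (T^[j] x) +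
            ∑ j ∈ Finset.range (n - a), f (T^[a + 1 + j] x) := by
            apply add_le_add
            · exact Finset.single_le_sum (f := fun j => f (T^[j] x)) (fun _ _ => zero_le)
                (Finset.mem_range.2 (Nat.succ_pos a))
            · apply le_of_eq
              apply Finset.sum_congr rfl
              intro j _
              rw [← Function.iterate_add_apply, add_comm]
        _ = ∑ j ∈ Finset.range (n + 1), f (T^[j] x) := by
            rw [← Finset.sum_range_add (fun j => f (T^[j] x))]
            congr 2
            omega

lemma sum_R_le {X : Type*} [MeasurableSpace X] {m : Measure X} {T : X → X}
    (hT : Measurable T) {A : Set X} (hA : MeasurableSet A) (h0 : 0 < m A) (hfin : m A < ⊤)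
    (n : ℕ) : ∑ i ∈ Finset.range n, (m (R T A i)).toReal / (m A).toReal ≤ 1 := by
  rw [← Finset.sum_div]
  apply div_le_one_of_le₀ _ ENNReal.toReal_nonneg
  have hRf : ∀ i, m (R T A i) ≠ ⊤ := fun i =>
    ((measure_mono Set.inter_subset_left).trans_lt hfin).ne
  rw [← ENNReal.toReal_sum fun i _ => hRf i]
  apply ENNReal.toReal_mono hfin.ne
  rw [← measure_biUnion_finset]
  · apply measure_mono
    exact Set.iUnion₂_subset fun i _ => Set.inter_subset_left
  · intro i _ j _ hij
    show Disjoint _ _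
    rw [Set.disjoint_left]
    exact fun x hi hj => hij (R_disjoint hi hj)
  · exact fun i _ => measurable_R hT hA i

theorem subset_qf {X : Type*} [MeasurableSpace X] {m : Measure X} {T : X → X}
    (hT : MeasurePreserving T m m) {Q B : Set X} (hQ : MeasurableSet Q) (hQ0 : 0 < m Q)
    (hQf : m Q < ⊤) (hqf : QuasiFiniteSet T m Q) (hB : MeasurableSet B) (hBQ : B ⊆ Q)
    (hB0 : 0 < m B) : QuasiFiniteSet T m B := by
  have hBf : m B < ⊤ := (measure_mono hBQ).trans_lt hQf
  set p : ℕ → ℝ := fun n => (m (R T Q n)).toReal / (m Q).toReal with hpdef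
  set r : ℕ → ℝ := fun n => (m (R T B n)).toReal / (m B).toReal with hrdef
  have hqf' : Summable fun n => p n * Real.log (1 / p n) := hqf
  show Summable fun n => r n * Real.log (1 / r n)
  have hp0 : ∀ n, 0 ≤ p n := fun n => by positivity
  have hr0 : ∀ n, 0 ≤ r n := fun n => by positivity
  have hps := sum_R_le hT.measurable hQ hQ0 hQf
  have hrs := sum_R_le hT.measurable hB hB0 hBf
  have hr1 : ∀ n, r n ≤ 1 := fun n =>
    (Finset.single_le_sum (f := r) (fun i _ => hr0 i) (Finset.self_mem_range_succ n)).trans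
      (hrs (n + 1))
  have hp1 : ∀ n, p n ≤ 1 := fun n =>
    (Finset.single_le_sum (f := p) (fun i _ => hp0 i) (Finset.self_mem_range_succ n)).trans
      (hps (n + 1))
  have hpsum : Summable p := summable_of_sum_range_le hp0 hps
  have hqsum : Summable (q p) := summable_of_sum_range_le (q_nonneg hp0) (q_sum hp0 hps)
  have hRQ := measurable_R hT.measurable hQ
  have hRB := measurable_R hT.measurable hB
  -- the information function
  set f : X → ℝ≥0∞ := fun x => ∑' k, (R T Q k).indicator
    (fun _ => ENNReal.ofReal (Real.log 2 + Real.log (1 / p k))) x with hfdef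
  have hfm : Measurable f := Measurable.ennreal_tsum fun k => measurable_const.indicator (hRQ k)
  have hf : ∀ k, ∀ x ∈ R T Q k, ENNReal.ofReal (Real.log 2 + Real.log (1 / p k)) ≤ f x := by
    intro k x hx
    refine le_trans (le_of_eq ?_) (ENNReal.le_tsum k)
    rw [Set.indicator_of_mem hx]
  have hmQ : 0 < (m Q).toReal := ENNReal.toReal_pos hQ0.ne' hQf.ne
  have hmB : 0 < (m B).toReal := ENNReal.toReal_pos hB0.ne' hBf.ne
  have hRQf : ∀ k, m (R T Q k) ≠ ⊤ := fun i =>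
    ((measure_mono Set.inter_subset_left).trans_lt hQf).ne
  have hRBf : ∀ k, m (R T B k) ≠ ⊤ := fun i =>
    ((measure_mono Set.inter_subset_left).trans_lt hBf).ne
  have hfint : ∫⁻ x, f x ∂m ≠ ⊤ := by
    rw [hfdef, lintegral_tsum fun k => (measurable_const.indicator (hRQ k)).aemeasurable]
    have hterm : ∀ k, ∫⁻ x, (R T Q k).indicator
        (fun _ => ENNReal.ofReal (Real.log 2 + Real.log (1 / p k))) x ∂m
        = ENNReal.ofReal ((m Q).toReal * (Real.log 2 * p k + p k * Real.log (1 / p k))) := by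
      intro k
      rw [lintegral_indicator_const (hRQ k), ← ENNReal.ofReal_toReal (hRQf k),
        ← ENNReal.ofReal_mul' ENNReal.toReal_nonneg]
      congr 1
      have : (m (R T Q k)).toReal = (m Q).toReal * p k := by
        rw [hpdef]; field_simp
      rw [this]; ring
    simp only [hterm]
    exact (((hpsum.mul_left _).add hqf').mul_left _).tsum_ofReal_ne_top
  -- generic points
  have hae : ∀ᵐ x ∂m, ∀ j k, T^[j] x ∈ R T Q k → 0 < p k := by
    rw [ae_all_iff]; intro j
    rw [ae_all_iff]; intro k
    by_cases hk : 0 < p k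
    · exact Filter.Eventually.of_forall fun _ _ => hk
    · have hz : m (R T Q k) = 0 := by
        by_contra hne
        exact hk (div_pos (ENNReal.toReal_pos hne (hRQf k)) hmQ)
      have h2 : m (T^[j] ⁻¹' (R T Q k)) = 0 := by
        rw [(hT.iterate j).measure_preimage (hRQ k).nullMeasurableSet, hz]
      filter_upwards [measure_eq_zero_iff_ae_notMem.1 h2] with x hx hx'
      exact absurd hx' hx
  have hpt : ∀ᵐ x ∂m, ∀ n, x ∈ R T B n → 0 < q p (n + 1) ∧
      ENNReal.ofReal (Real.log (1 / q p (n + 1))) ≤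
        ∑ j ∈ Finset.range (n + 1), f (T^[j] x) := by
    filter_upwards [hae] with x hx n hn
    rw [mem_R] at hn
    exact pointwise hp0 hf (n + 1) x (hBQ hn.1) (hBQ hn.2.1) hx
  have hqpos : ∀ n, 0 < r n → 0 < q p (n + 1) := by
    intro n hn
    by_contra hq
    have : m (R T B n) = 0 := by
      rw [measure_eq_zero_iff_ae_notMem]
      filter_upwards [hpt] with x hx hxn
      exact hq (hx n hxn).1
    rw [hrdef] at hn
    simp [this] at hn
  have hq1 : ∀ n, q p (n + 1) ≤ 1 := by
    intro n
    have h := q_sum hp0 hps (n + 2)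
    rw [Finset.sum_range_succ', q_zero] at h
    have := Finset.single_le_sum (f := fun k => q p (k + 1)) (fun i _ => q_nonneg hp0 (i + 1))
      (Finset.self_mem_range_succ n)
    linarith
  have hlogq : ∀ n, 0 ≤ Real.log (1 / q p (n + 1)) := by
    intro n
    rw [one_div, Real.log_inv]
    have := Real.log_nonpos (q_nonneg hp0 (n + 1)) (hq1 n)
    linarith
  have hsum1 : ∑' n, ENNReal.ofReal ((m (R T B n)).toReal * Real.log (1 / q p (n + 1))) ≠ ⊤ := by
    refine ne_top_of_le_ne_top hfint (le_trans (ENNReal.tsum_le_tsum fun n => ?_)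
      (kac_le hT hB hfm))
    rw [ENNReal.ofReal_mul ENNReal.toReal_nonneg, ENNReal.ofReal_toReal (hRBf n), mul_comm,
      ← setLIntegral_const]
    apply setLIntegral_mono_ae' (hRB n)
    filter_upwards [hpt] with x hx hxn
    exact (hx n hxn).2
  have hsum2 : Summable fun n => (m (R T B n)).toReal * Real.log (1 / q p (n + 1)) := by
    have := ENNReal.summable_toReal hsum1
    refine this.congr fun n => ?_
    rw [ENNReal.toReal_ofReal (mul_nonneg ENNReal.toReal_nonneg (hlogq n))]
  have hsum3 : Summable fun n => r n * Real.log (1 / q p (n + 1)) := by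
    refine (hsum2.div_const (m B).toReal).congr fun n => ?_
    rw [hrdef]; ring
  refine Summable.of_nonneg_of_le (fun n => ?_) (fun n => ?_)
    (((summable_nat_add_iff 1).2 hqsum).add hsum3)
  · apply mul_nonneg (hr0 n)
    rw [one_div, Real.log_inv]
    have := Real.log_nonpos (hr0 n) (hr1 n)
    linarith
  · rcases (hr0 n).eq_or_lt with h | h
    · rw [← h]; simp [q_nonneg hp0]
    · have hq := hqpos n h
      have h1 : Real.log (q p (n + 1) / r n) ≤ q p (n + 1) / r n - 1 :=
        Real.log_le_sub_one_of_pos (by positivity)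
      rw [Real.log_div hq.ne' h.ne'] at h1
      have h2 := mul_le_mul_of_nonneg_left h1 h.le
      have h3 : r n * (q p (n + 1) / r n - 1) = q p (n + 1) - r n := by field_simp
      rw [h3] at h2
      simp only [one_div, Real.log_inv]
      linarith

lemma returnTime_preimage {X : Type*} (T : X → X) (A : Set X) (n : ℕ) (x : X) :
    returnTime T (T^[n] ⁻¹' A) x = returnTime T A (T^[n] x) := by
  unfold returnTime
  congr 1
  ext k
  simp only [Set.mem_ofPred_eq, Set.mem_preimage, ← Function.iterate_add_apply, add_comm]

lemma preimage_qf {X : Type*} [MeasurableSpace X] {m : Measure X} {T : X → X}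
    (hT : MeasurePreserving T m m) {Q : Set X} (hQ : MeasurableSet Q)
    (hqf : QuasiFiniteSet T m Q) (n : ℕ) : QuasiFiniteSet T m (T^[n] ⁻¹' Q) := by
  have h1 : m (T^[n] ⁻¹' Q) = m Q := (hT.iterate n).measure_preimage hQ.nullMeasurableSet
  have h2 : ∀ k, m (T^[n] ⁻¹' Q ∩ {x | returnTime T (T^[n] ⁻¹' Q) x = k + 1}) =
      m (Q ∩ {x | returnTime T Q x = k + 1}) := by
    intro k
    have h3 := (hT.iterate n).measure_preimage (measurable_R hT.measurable hQ k).nullMeasurableSet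
    simp only [returnTime_preimage]
    exact h3
  unfold QuasiFiniteSet at hqf ⊢
  simpa only [h1, h2] using hqf

lemma exists_hit {X : Type*} [MeasurableSpace X] {m : Measure X} {T : X → X}
    (hc : Conservative T m) (he : Ergodic T m) {Q F : Set X} (hQ : MeasurableSet Q)
    (hQ0 : 0 < m Q) (hF0 : 0 < m F) : ∃ n, 0 < m (F ∩ T^[n] ⁻¹' Q) := by
  by_contra hcon
  push Not at hcon
  set W : Set X := {x | ∃ᶠ n in Filter.atTop, T^[n] x ∈ Q} with hW
  have hWm : MeasurableSet W := measurableSet_setOfPred.2 (by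
    have : W = Filter.limsup (fun n => T^[n] ⁻¹' Q) Filter.atTop := by
      ext x; rw [Filter.mem_limsup_iff_frequently_mem]; rfl
    have h2 : MeasurableSet W := by
      rw [this]
      exact MeasurableSet.measurableSet_limsup fun n => (he.measurable.iterate n) hQ
    exact measurableSet_setOfPred.1 h2)
  have hinv : T ⁻¹' W = W := by
    ext x
    simp only [hW, Set.mem_preimage, Set.mem_ofPred_eq, ← Function.iterate_succ_apply]
    simp only [Filter.frequently_atTop]
    constructor
    · intro h a
      obtain ⟨b, hb, hb'⟩ := h a
      exact ⟨b + 1, by omega, hb'⟩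
    · intro h a
      obtain ⟨b, hb, hb'⟩ := h (a + 1)
      refine ⟨b - 1, by omega, ?_⟩
      rwa [show (b - 1).succ = b by omega]
  have hFW : m (F ∩ W) = 0 := by
    refine measure_mono_null (t := ⋃ n, F ∩ T^[n] ⁻¹' Q) ?_
      (measure_iUnion_null fun n => le_antisymm (hcon n) (zero_le))
    rintro x ⟨hx, hxW⟩
    obtain ⟨n, hn⟩ := hxW.exists
    exact Set.mem_iUnion.2 ⟨n, hx, hn⟩
  rcases he.measure_self_or_compl_eq_zero hWm hinv with h | h
  · have hae := hc.ae_mem_imp_frequently_image_mem hQ.nullMeasurableSet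
    have : m Q = 0 := by
      rw [measure_eq_zero_iff_ae_notMem]
      filter_upwards [hae, measure_eq_zero_iff_ae_notMem.1 h] with x h1 h2 h3
      exact h2 (h1 h3)
    exact hQ0.ne' this
  · apply hF0.ne'
    refine measure_mono_null (t := (F ∩ W) ∪ Wᶜ) ?_ (measure_union_null hFW h)
    intro x hx
    by_cases hxW : x ∈ W
    · exact Or.inl ⟨hx, hxW⟩
    · exact Or.inr hxW

end QF


/-- Proposition 2.0: if `T` is a conservative, ergodic, quasi finite,
measure preserving transformation of a σ-finite measure space, then every `F` of finite
positive measure contains a measurable set `A` of positive measure all of whose measurable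
subsets of positive measure are quasi finite. -/
theorem stmt_3 {X : Type*} [MeasurableSpace X] (m : Measure X) [SigmaFinite m]
    (T : X → X) (hc : Conservative T m) (he : Ergodic T m)
    (hqfT : ∃ Q : Set X, MeasurableSet Q ∧ 0 < m Q ∧ m Q < ⊤ ∧ QuasiFiniteSet T m Q) :
    ∀ F : Set X, MeasurableSet F → 0 < m F → m F < ⊤ →
      ∃ A : Set X, MeasurableSet A ∧ A ⊆ F ∧ 0 < m A ∧
        ∀ B : Set X, MeasurableSet B → B ⊆ A → 0 < m B → QuasiFiniteSet T m B := by
  obtain ⟨Q, hQ, hQ0, hQf, hqf⟩ := hqfT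
  intro F hF hF0 _
  have hT := he.toMeasurePreserving
  obtain ⟨n, hn⟩ := QF.exists_hit hc he hQ hQ0 hF0
  have hQ' : MeasurableSet (T^[n] ⁻¹' Q) := (hT.measurable.iterate n) hQ
  have hmQ' : m (T^[n] ⁻¹' Q) = m Q := (hT.iterate n).measure_preimage hQ.nullMeasurableSet
  refine ⟨F ∩ T^[n] ⁻¹' Q, hF.inter hQ', Set.inter_subset_left, hn, ?_⟩
  intro B hB hBA hB0
  exact QF.subset_qf hT hQ' (hmQ' ▸ hQ0) (hmQ' ▸ hQf) (QF.preimage_qf hT hQ hqf n) hB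
    (hBA.trans Set.inter_subset_right) hB0
end

section
/- Let (X,𝓑,m,T) be a conservative, ergodic, measure-preserving transformation of a σ-finite measure space. If A, B ∈ 𝓕_{log,T}, then A ∪ B ∈ 𝓕_{log,T}; in fact ∫_{A∪B} log φ_{A∪B} dm ≤ ∫_A log φ_A dm + ∫_B log φ_B dm < ∞. -/
open MeasureTheory
open scoped ENNReal

lemma aux_le {X : Type*} [MeasurableSpace X] (m : Measure X) (T : X → X) (hc : Conservative T m)
    (A C : Set X) (hA : MeasurableSet A) (hAC : A ⊆ C) :
    ∫⁻ x in A, ENNReal.ofReal (Real.log (returnTime T C x)) ∂m ≤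
      ∫⁻ x in A, ENNReal.ofReal (Real.log (returnTime T A x)) ∂m := by
  apply lintegral_mono_ae
  rw [ae_restrict_iff' hA]
  filter_upwards [hc.ae_mem_imp_frequently_image_mem hA.nullMeasurableSet] with x hx hxA
  obtain ⟨n, hn, hnA⟩ := (Filter.frequently_atTop.1 (hx hxA)) 1
  have hmem := Nat.sInf_mem (s := {n : ℕ | 1 ≤ n ∧ T^[n] x ∈ A}) ⟨n, hn, hnA⟩
  have hmemC := Nat.sInf_mem (s := {n : ℕ | 1 ≤ n ∧ T^[n] x ∈ C}) ⟨n, hn, hAC hnA⟩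
  have hle : returnTime T C x ≤ returnTime T A x := Nat.sInf_le ⟨hmem.1, hAC hmem.2⟩
  have hpos : 1 ≤ returnTime T C x := hmemC.1
  apply ENNReal.ofReal_le_ofReal
  apply Real.log_le_log
  · exact_mod_cast hpos
  · exact_mod_cast hle

/-- part of Proposition 2.2(iv): if `A, B ∈ 𝓕_{log,T}` then
`A ∪ B ∈ 𝓕_{log,T}`; in fact
`∫_{A∪B} log φ_{A∪B} dm ≤ ∫_A log φ_A dm + ∫_B log φ_B dm < ∞`. -/
theorem stmt_8 {X : Type*} [MeasurableSpace X] (m : Measure X) [SigmaFinite m]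
    (T : X → X) (hc : Conservative T m) (he : Ergodic T m)
    (A : Set X) (hA : MeasurableSet A) (hA0 : 0 < m A) (hA1 : m A < ⊤)
    (hAlog : ∫⁻ x in A, ENNReal.ofReal (Real.log (returnTime T A x)) ∂m < ⊤)
    (B : Set X) (hB : MeasurableSet B) (hB0 : 0 < m B) (hB1 : m B < ⊤)
    (hBlog : ∫⁻ x in B, ENNReal.ofReal (Real.log (returnTime T B x)) ∂m < ⊤) :
    (∫⁻ x in A ∪ B, ENNReal.ofReal (Real.log (returnTime T (A ∪ B) x)) ∂m ≤
      (∫⁻ x in A, ENNReal.ofReal (Real.log (returnTime T A x)) ∂m) +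
        ∫⁻ x in B, ENNReal.ofReal (Real.log (returnTime T B x)) ∂m) ∧
    ∫⁻ x in A ∪ B, ENNReal.ofReal (Real.log (returnTime T (A ∪ B) x)) ∂m < ⊤ := by
  have h := (lintegral_union_le (μ := m)
    (fun x => ENNReal.ofReal (Real.log (returnTime T (A ∪ B) x))) A B).trans
    (add_le_add (aux_le m T hc A (A ∪ B) hA Set.subset_union_left)
      (aux_le m T hc B (A ∪ B) hB Set.subset_union_right))
  exact ⟨h, h.trans_lt (ENNReal.add_lt_top.2 ⟨hAlog, hBlog⟩)⟩
end

section
/- Let (X,𝓑,m,T) be a log-lower bounded, conservative, ergodic, measure-preserving transformation of a σ-finite measure space and let A, B ∈ 𝓕_Π. Then A ∪ B ∈ 𝓕_Π, and each of the sets A ∩ B, A ∖ B, B ∖ A that has positive measure belongs to 𝓕_Π; that is, 𝓕_Π is a ring of sets (up to sets of measure zero). -/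
open MeasureTheory
open scoped ENNReal symmDiff

/-- `A ∈ 𝓕_{log,T}`: `A` is measurable, `0 < m A < ∞` and `∫_A log φ_A dm < ∞`. -/
def MemFlog {X : Type*} [MeasurableSpace X] (T : X → X) (m : Measure X) (A : Set X) : Prop :=
  MeasurableSet A ∧ 0 < m A ∧ m A < ⊤ ∧
    ∫⁻ x in A, ENNReal.ofReal (Real.log (returnTime T A x)) ∂m < ⊤

/-- `A` is `T`-predictable mod `m`: some set in the σ-algebra generated by
`{T^{-n} A : n ≥ 1}` coincides with `A` up to an `m`-null set. -/
def Predictable {X : Type*} [MeasurableSpace X] (T : X → X) (m : Measure X) (A : Set X) :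
    Prop :=
  ∃ B : Set X,
    MeasurableSet[MeasurableSpace.generateFrom
      {s : Set X | ∃ n : ℕ, 1 ≤ n ∧ s = T^[n] ⁻¹' A}] B ∧
    m (A ∆ B) = 0

/-- `A ∈ 𝓕_Π := {A ∈ 𝓕_{log,T} : A is T-predictable mod m}`. -/
def MemFPi {X : Type*} [MeasurableSpace X] (T : X → X) (m : Measure X) (A : Set X) : Prop :=
  MemFlog T m A ∧ Predictable T m A

section Helpers
open ProbabilityTheory Filter
open scoped Topology

-- Part 1
/-- The itinerary of `x` with respect to the set `C`. -/
def itin {X : Type*} (T : X → X) (C : Set X) (x : X) : ℕ → Prop := fun n => T^[n] x ∈ C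

/-- first return on itineraries -/
noncomputable def retO (w : ℕ → Prop) : ℕ := sInf {n : ℕ | 1 ≤ n ∧ w n}

/-- induced shift on itineraries -/
noncomputable def indO (w : ℕ → Prop) : ℕ → Prop := fun i => w (i + retO w)

/-- induced transformation -/
noncomputable def indT {X : Type*} (T : X → X) (C : Set X) (x : X) : X := T^[returnTime T C x] x

/-- infinitely many visits to `C` -/
def Recur {X : Type*} (T : X → X) (C : Set X) (x : X) : Prop := ∃ᶠ n in atTop, T^[n] x ∈ C

lemma retO_itin {X : Type*} (T : X → X) (C : Set X) (x : X) :
    retO (itin T C x) = returnTime T C x := rfl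

lemma itin_indT {X : Type*} (T : X → X) (C : Set X) (x : X) :
    itin T C (indT T C x) = indO (itin T C x) := by
  funext i
  simp only [itin, indT, indO, retO_itin, Function.iterate_add_apply]

lemma Recur.set_nonempty {X : Type*} {T : X → X} {C : Set X} {x : X} (h : Recur T C x) :
    {n : ℕ | 1 ≤ n ∧ T^[n] x ∈ C}.Nonempty := by
  obtain ⟨n, hn, h1⟩ := (frequently_atTop.1 h) 1
  exact ⟨n, hn, h1⟩

lemma Recur.one_le {X : Type*} {T : X → X} {C : Set X} {x : X} (h : Recur T C x) :
    1 ≤ returnTime T C x := (Nat.sInf_mem h.set_nonempty).1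

lemma Recur.indT_mem {X : Type*} {T : X → X} {C : Set X} {x : X} (h : Recur T C x) :
    indT T C x ∈ C := (Nat.sInf_mem h.set_nonempty).2

lemma not_mem_of_lt_returnTime {X : Type*} {T : X → X} {C : Set X} {x : X} {n : ℕ} (h1 : 1 ≤ n)
    (h : n < returnTime T C x) : T^[n] x ∉ C := fun hc => Nat.notMem_of_lt_sInf h ⟨h1, hc⟩

lemma returnTime_le {X : Type*} {T : X → X} {C : Set X} {x : X} {n : ℕ} (h1 : 1 ≤ n)
    (h : T^[n] x ∈ C) : returnTime T C x ≤ n := Nat.sInf_le ⟨h1, h⟩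

lemma Recur.step {X : Type*} {T : X → X} {C : Set X} {x : X} :
    Recur T C (T x) ↔ Recur T C x := by
  unfold Recur
  simp only [← Function.iterate_succ_apply]
  rw [frequently_atTop, frequently_atTop]
  constructor
  · intro h a
    obtain ⟨b, hb, h1⟩ := h a
    exact ⟨b + 1, by omega, h1⟩
  · intro h a
    obtain ⟨b, hb, h1⟩ := h (a + 1)
    obtain ⟨c, rfl⟩ : ∃ c, b = c + 1 := ⟨b - 1, by omega⟩
    exact ⟨c, by omega, h1⟩

lemma Recur.iter {X : Type*} {T : X → X} {C : Set X} {x : X} (n : ℕ) :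
    Recur T C (T^[n] x) ↔ Recur T C x := by
  induction n generalizing x with
  | zero => rfl
  | succ n ih => rw [Function.iterate_succ_apply, ih, Recur.step]

lemma measurable_retO : Measurable retO := by
  refine measurable_to_countable' fun n => ?_
  rcases Nat.eq_zero_or_pos n with rfl | hn
  · have : retO ⁻¹' {0} = ⋂ n : ℕ, ⋂ (_ : 1 ≤ n), {w : ℕ → Prop | w n}ᶜ := by
      ext w
      simp only [Set.mem_preimage, Set.mem_singleton_iff, retO, Nat.sInf_eq_zero, Set.mem_iInter,
        Set.mem_compl_iff, Set.mem_ofPred_eq]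
      constructor
      · rintro (h | h) n hn hw
        · omega
        · exact (Set.eq_empty_iff_forall_notMem.1 h n) ⟨hn, hw⟩
      · intro h
        right
        ext n
        simp only [Set.mem_ofPred_eq, Set.mem_empty_iff_false, iff_false, not_and]
        exact h n
    rw [this]
    refine MeasurableSet.iInter fun n => MeasurableSet.iInter fun _ => MeasurableSet.compl ?_
    exact measurableSet_setOfPred.2 (measurable_pi_apply n)
  · have : retO ⁻¹' {n} = {w : ℕ → Prop | w n} ∩ ⋂ k : ℕ, ⋂ (_ : 1 ≤ k ∧ k < n), {w : ℕ → Prop | w k}ᶜ := by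
      ext w
      simp only [Set.mem_preimage, Set.mem_singleton_iff, Set.mem_iInter,
        Set.mem_compl_iff, Set.mem_ofPred_eq, Set.mem_inter_iff]
      constructor
      · rintro rfl
        have hne : {n : ℕ | 1 ≤ n ∧ w n}.Nonempty := Nat.nonempty_of_pos_sInf hn
        refine ⟨(Nat.sInf_mem hne).2, fun k hk hw => Nat.notMem_of_lt_sInf hk.2 ⟨hk.1, hw⟩⟩
      · rintro ⟨h1, h2⟩
        have hne : {n : ℕ | 1 ≤ n ∧ w n}.Nonempty := ⟨n, hn, h1⟩
        have h3 : retO w ≤ n := Nat.sInf_le ⟨hn, h1⟩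
        have h4 := Nat.sInf_mem hne
        by_contra h5
        exact h2 (retO w) ⟨h4.1, lt_of_le_of_ne h3 h5⟩ h4.2
    rw [this]
    refine MeasurableSet.inter (measurableSet_setOfPred.2 (measurable_pi_apply n)) ?_
    refine MeasurableSet.iInter fun n => MeasurableSet.iInter fun _ => MeasurableSet.compl ?_
    exact measurableSet_setOfPred.2 (measurable_pi_apply n)

lemma measurable_indO : Measurable indO := by
  refine measurable_pi_lambda _ fun i => ?_
  have h : Measurable (fun p : (ℕ → Prop) × ℕ => p.1 (i + p.2)) :=
    measurable_from_prod_countable_left fun y => measurable_pi_apply (i + y)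
  exact h.comp (measurable_id.prodMk measurable_retO)

section
variable {X : Type*} [MeasurableSpace X] {T : X → X} {C : Set X} {m : Measure X}

lemma measurable_itin (hT : Measurable T) (hC : MeasurableSet C) : Measurable (itin T C) := by
  refine measurable_pi_lambda _ fun i => ?_
  exact measurableSet_setOfPred.1 ((hT.iterate i) hC)

lemma measurable_returnTime_s14 (hT : Measurable T) (hC : MeasurableSet C) :
    Measurable (returnTime T C) := measurable_retO.comp (measurable_itin hT hC)

lemma measurable_indT (hT : Measurable T) (hC : MeasurableSet C) : Measurable (indT T C) := by
  have h : Measurable (fun p : X × ℕ => T^[p.2] p.1) :=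
    measurable_from_prod_countable_left fun y => hT.iterate y
  exact h.comp (measurable_id.prodMk (measurable_returnTime_s14 hT hC))

lemma ae_recur (hc : Conservative T m) (he : Ergodic T m) (hC : MeasurableSet C) (h0 : 0 < m C) :
    ∀ᵐ x ∂m, Recur T C x := by
  have hm : MeasurableSet {x | Recur T C x} := by
    have : {x | Recur T C x} = ⋂ a : ℕ, ⋃ b : ℕ, ⋃ (_ : a ≤ b), T^[b] ⁻¹' C := by
      ext x
      simp [Recur, frequently_atTop]
    rw [this]
    exact MeasurableSet.iInter fun a => MeasurableSet.iUnion fun b => MeasurableSet.iUnion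
      fun _ => (he.measurable.iterate b) hC
  have hinv : T ⁻¹' {x | Recur T C x} = {x | Recur T C x} := by
    ext x; exact Recur.step
  have h1 := he.toPreErgodic.aeconst_set hm hinv
  have h2 := hc.ae_mem_imp_frequently_image_mem hC.nullMeasurableSet
  rw [eventuallyConst_set'] at h1
  rcases h1 with h | h
  · exfalso
    rw [ae_eq_empty] at h
    have h3 : ∀ᵐ x ∂m, x ∉ C := by
      have h4 : ∀ᵐ x ∂m, ¬ Recur T C x := by
        rw [ae_iff]; simpa using h
      filter_upwards [h2, h4] with x hx hx2 hxC using hx2 (hx hxC)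
    rw [ae_iff] at h3
    simp at h3
    exact h0.ne' h3
  · exact eventuallyEq_univ.1 h

/-- exact decomposition according to the last visit to `C` -/
lemma kac_decomp (hT : MeasurePreserving T m m) (hC : MeasurableSet C) {f : X → ℝ≥0∞}
    (hf : Measurable f) (N : ℕ) :
    ∫⁻ x, f x ∂m = ∑ t ∈ Finset.range (N + 1),
      ∫⁻ x in {x | x ∈ C ∧ ∀ s, 1 ≤ s → s ≤ t → T^[s] x ∉ C}, f (T^[t] x) ∂m
      + ∫⁻ x in {x | ∀ s, s ≤ N → T^[s] x ∉ C}, f (T^[N] x) ∂m := by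
  have hTm := hT.measurable
  have hZ : ∀ N, MeasurableSet {x | ∀ s, s ≤ N → T^[s] x ∉ C} := by
    intro N
    have : {x | ∀ s, s ≤ N → T^[s] x ∉ C} = ⋂ s : ℕ, ⋂ (_ : s ≤ N), (T^[s] ⁻¹' C)ᶜ := by
      ext x; simp
    rw [this]
    exact MeasurableSet.iInter fun s => MeasurableSet.iInter fun _ => ((hTm.iterate s) hC).compl
  induction N with
  | zero =>
    simp only [zero_add, Finset.range_one, Finset.sum_singleton, Function.iterate_zero, id]
    rw [← lintegral_add_compl f hC]
    congr 2
    · congr 1; ext x; simp; intro _ s h1 h2; omega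
    · congr 1; ext x; simp
  | succ N ih =>
    rw [ih, Finset.sum_range_succ _ (N + 1), add_assoc]
    congr 1
    have e1 : ∫⁻ x in {x | ∀ s, s ≤ N → T^[s] x ∉ C}, f (T^[N] x) ∂m
        = ∫⁻ x in T ⁻¹' {x | ∀ s, s ≤ N → T^[s] x ∉ C}, f (T^[N] (T x)) ∂m := by
      rw [← lintegral_indicator (hZ N), ← lintegral_indicator (hTm (hZ N))]
      exact (hT.lintegral_comp ((hf.comp (hTm.iterate N)).indicator (hZ N))).symm
    rw [e1, ← lintegral_inter_add_sdiff _ _ hC]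
    have key : ∀ x, T x ∈ {x | ∀ s, s ≤ N → T^[s] x ∉ C} ↔
        ∀ s, 1 ≤ s → s ≤ N + 1 → T^[s] x ∉ C := by
      intro x
      simp only [Set.mem_ofPred_eq, ← Function.iterate_succ_apply]
      constructor
      · intro h s h1 h2
        obtain ⟨c, rfl⟩ : ∃ c, s = c + 1 := ⟨s - 1, by omega⟩
        exact h c (by omega)
      · intro h s h1
        exact h (s + 1) (by omega) (by omega)
    congr 2
    · congr 1
      ext x
      rw [Set.mem_inter_iff, Set.mem_preimage, key, and_comm]; rfl
    · congr 1
      ext x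
      rw [Set.mem_sdiff, Set.mem_preimage, key]
      constructor
      · rintro ⟨h1, h2⟩ s hs
        rcases Nat.eq_zero_or_pos s with rfl | h
        · exact h2
        · exact h1 s h hs
      · intro h
        exact ⟨fun s _ h2 => h s h2, h 0 (by omega)⟩

lemma kac_le_s14 (hT : MeasurePreserving T m m) (hC : MeasurableSet C) {f : X → ℝ≥0∞}
    (hf : Measurable f) :
    ∫⁻ x in C, ∑ t ∈ Finset.range (returnTime T C x), f (T^[t] x) ∂m ≤ ∫⁻ x, f x ∂m := by
  have hTm := hT.measurable
  set G : ℕ → Set X := fun t => {x | x ∈ C ∧ ∀ s, 1 ≤ s → s ≤ t → T^[s] x ∉ C} with hG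
  have hGm : ∀ t, MeasurableSet (G t) := by
    intro t
    have : G t = C ∩ ⋂ s : ℕ, ⋂ (_ : 1 ≤ s), ⋂ (_ : s ≤ t), (T^[s] ⁻¹' C)ᶜ := by
      ext x; simp [hG]
    rw [this]
    exact hC.inter (MeasurableSet.iInter fun s => MeasurableSet.iInter fun _ =>
      MeasurableSet.iInter fun _ => ((hTm.iterate s) hC).compl)
  calc ∫⁻ x in C, ∑ t ∈ Finset.range (returnTime T C x), f (T^[t] x) ∂m
      ≤ ∫⁻ x in C, ∑' t, (G t).indicator (fun x => f (T^[t] x)) x ∂m := by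
        refine setLIntegral_mono' hC fun x hx => ?_
        refine le_trans (Finset.sum_le_sum (g := fun t => (G t).indicator (fun x => f (T^[t] x)) x) ?_) (ENNReal.sum_le_tsum _)
        intro t ht
        rw [Finset.mem_range] at ht
        rw [Set.indicator_of_mem]
        exact ⟨hx, fun s h1 h2 => not_mem_of_lt_returnTime h1 (by omega)⟩
    _ ≤ ∫⁻ x, ∑' t, (G t).indicator (fun x => f (T^[t] x)) x ∂m := setLIntegral_le_lintegral _ _
    _ = ∑' t, ∫⁻ x in G t, f (T^[t] x) ∂m := by
        rw [lintegral_tsum]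
        · congr 1; funext t; rw [lintegral_indicator (hGm t)]
        · intro t; exact ((hf.comp (hTm.iterate t)).indicator (hGm t)).aemeasurable
    _ ≤ ∫⁻ x, f x ∂m := by
        refine ENNReal.tsum_le_of_sum_range_le fun n => ?_
        rw [kac_decomp hT hC hf n]
        refine le_trans ?_ le_self_add
        exact Finset.sum_le_sum_of_subset (Finset.range_mono (by omega))

lemma mp_indT (hT : MeasurePreserving T m m) (hC : MeasurableSet C) (hfin : m C < ⊤)
    (hrec : ∀ᵐ x ∂m, Recur T C x) :
    MeasurePreserving (indT T C) (m.restrict C) (m.restrict C) := by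
  have hTm := hT.measurable
  have hS := measurable_indT hTm hC
  have : IsFiniteMeasure (m.restrict C) := ⟨by simpa using hfin⟩
  refine ⟨hS, ?_⟩
  have : IsFiniteMeasure ((m.restrict C).map (indT T C)) := inferInstance
  refine Measure.eq_of_le_of_measure_univ_eq ?_ ?_
  · refine Measure.le_iff.2 fun E hE => ?_
    rw [Measure.map_apply hS hE, Measure.restrict_apply hE]
    have hf : Measurable ((E ∩ C).indicator (1 : X → ℝ≥0∞)) :=
      measurable_one.indicator (hE.inter hC)
    have h1 := kac_le_s14 hT hC (hf.comp hTm)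
    simp only [Function.comp] at h1
    rw [hT.lintegral_comp hf, lintegral_indicator_one (hE.inter hC)] at h1
    refine le_trans ?_ h1
    rw [← lintegral_indicator_one (hS hE)]
    refine lintegral_mono_ae ?_
    filter_upwards [ae_restrict_of_ae hrec] with x hx
    by_cases hxE : x ∈ indT T C ⁻¹' E
    · have hpos := hx.one_le
      refine le_trans ?_ (Finset.single_le_sum (f := fun t => (E ∩ C).indicator (1 : X → ℝ≥0∞) (T (T^[t] x))) (fun _ _ => zero_le)
        (Finset.mem_range.2 (Nat.sub_lt hpos one_pos)))
      have : T (T^[returnTime T C x - 1] x) = indT T C x := by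
        rw [← Function.iterate_succ_apply' T, indT]
        congr 2; omega
      simp only [this]
      rw [Set.indicator_of_mem hxE, Set.indicator_of_mem (show indT T C x ∈ E ∩ C from ⟨hxE, hx.indT_mem⟩)]
      rfl
    · rw [Set.indicator_of_notMem hxE]; exact zero_le
  · rw [Measure.map_apply hS MeasurableSet.univ, Set.preimage_univ]

end

-- Part 2
lemma log_succ_le_sum {X : Type*} (T : X → X) (A : Set X) (g : X → ℝ) (hg : ∀ x, 0 ≤ g x)
    (hgA : ∀ x ∈ A, Real.log (1 + returnTime T A x) ≤ g x) (n : ℕ) (hn : 1 ≤ n) (x : X)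
    (hx : x ∈ A) (hxn : T^[n] x ∈ A) :
    Real.log (1 + n) ≤ ∑ t ∈ Finset.range n, g (T^[t] x) := by
  induction n using Nat.strong_induction_on generalizing x with
  | _ n ih =>
    have hne : {k : ℕ | 1 ≤ k ∧ T^[k] x ∈ A}.Nonempty := ⟨n, hn, hxn⟩
    have hr : 1 ≤ returnTime T A x ∧ T^[returnTime T A x] x ∈ A := Nat.sInf_mem hne
    have hle : returnTime T A x ≤ n := returnTime_le hn hxn
    have h0 := hgA x hx
    set r := returnTime T A x with hrdef
    have hone : g x ≤ ∑ t ∈ Finset.range r, g (T^[t] x) :=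
      Finset.single_le_sum (f := fun t => g (T^[t] x)) (fun _ _ => hg _)
        (Finset.mem_range.2 (show 0 < r by omega))
    rcases hle.eq_or_lt with h | h
    · rw [← h]
      exact h0.trans hone
    · obtain ⟨k, rfl⟩ : ∃ k, n = r + k := ⟨n - r, by omega⟩
      have h1 := ih k (by omega) (by omega) (T^[r] x) hr.2 (by
        rw [← Function.iterate_add_apply, add_comm]; exact hxn)
      rw [Finset.sum_range_add]
      have h2 : ∀ t, T^[t] (T^[r] x) = T^[r + t] x := by
        intro t; rw [← Function.iterate_add_apply, add_comm]
      simp only [h2] at h1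
      have h3 : Real.log (1 + ((r + k : ℕ) : ℝ)) ≤ Real.log (1 + r) + Real.log (1 + k) := by
        rw [← Real.log_mul (by positivity) (by positivity)]
        refine Real.log_le_log (by positivity) ?_
        push_cast
        have : (0:ℝ) ≤ r * k := by positivity
        nlinarith
      linarith

lemma log_one_add_le (n : ℕ) : Real.log (1 + n) ≤ Real.log n + Real.log 2 := by
  rcases Nat.eq_zero_or_pos n with rfl | h
  · simp [Real.log_nonneg]
  · have : (1:ℝ) ≤ n := by exact_mod_cast h
    rw [← Real.log_mul (by positivity) (by positivity)]
    exact Real.log_le_log (by positivity) (by linarith)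

section
variable {X : Type*} [MeasurableSpace X] {T : X → X} {m : Measure X}

lemma lint_log_one_add {A : Set X} (hA : MemFlog T m A) :
    ∫⁻ x in A, ENNReal.ofReal (Real.log (1 + returnTime T A x)) ∂m < ⊤ := by
  obtain ⟨h1, h2, h3, h4⟩ := hA
  calc _ ≤ ∫⁻ x in A, (ENNReal.ofReal (Real.log (returnTime T A x))
            + ENNReal.ofReal (Real.log 2)) ∂m := by
        refine lintegral_mono fun x => ?_
        exact (ENNReal.ofReal_le_ofReal (log_one_add_le _)).trans ENNReal.ofReal_add_le
    _ < ⊤ := by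
        rw [lintegral_add_right _ measurable_const]
        refine ENNReal.add_lt_top.2 ⟨h4, ?_⟩
        simp only [lintegral_const, Measure.restrict_apply_univ]
        exact ENNReal.mul_lt_top ENNReal.ofReal_lt_top h3

lemma flog_subset (hT : MeasurePreserving T m m) {A D : Set X} (hA : MemFlog T m A)
    (hD : MeasurableSet D) (hDA : D ⊆ A) (h0 : 0 < m D) (hrec : ∀ᵐ x ∂m, Recur T D x) :
    MemFlog T m D := by
  have hlog := lint_log_one_add hA
  obtain ⟨h1, h2, h3, h4⟩ := hA
  refine ⟨hD, h0, (measure_mono hDA).trans_lt h3, ?_⟩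
  set g : X → ℝ := A.indicator (fun x => Real.log (1 + returnTime T A x)) with hg
  have hgnn : ∀ x, 0 ≤ g x := fun x => Set.indicator_nonneg (fun x _ => Real.log_nonneg (by simp)) x
  have hm1 : Measurable fun x => Real.log (1 + (returnTime T A x : ℝ)) :=
    Real.measurable_log.comp (measurable_const.add
      (measurable_from_nat.comp (measurable_returnTime_s14 hT.measurable h1)))
  have hgm : Measurable g := hm1.indicator h1
  refine lt_of_le_of_lt ?_ hlog
  calc _ ≤ ∫⁻ x in D, ∑ t ∈ Finset.range (returnTime T D x), ENNReal.ofReal (g (T^[t] x)) ∂m := by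
        refine lintegral_mono_ae ?_
        filter_upwards [ae_restrict_of_ae hrec, ae_restrict_mem hD] with x hx hxD
        rw [← ENNReal.ofReal_sum_of_nonneg (fun _ _ => hgnn _)]
        refine ENNReal.ofReal_le_ofReal (le_trans ?_ (log_succ_le_sum T A g hgnn ?_ _ hx.one_le x
          (hDA hxD) (hDA hx.indT_mem)))
        · refine Real.log_le_log ?_ (by linarith)
          exact_mod_cast hx.one_le
        · intro y hy
          rw [hg, Set.indicator_of_mem hy]
    _ ≤ ∫⁻ x, ENNReal.ofReal (g x) ∂m := kac_le_s14 hT hD hgm.ennreal_ofReal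
    _ = _ := by
        rw [← lintegral_indicator h1]
        congr 1
        funext x
        by_cases hx : x ∈ A <;> simp [hg, hx]

lemma flog_union {A B : Set X} (hT : MeasurePreserving T m m)
    (hA : MemFlog T m A) (hB : MemFlog T m B)
    (hrA : ∀ᵐ x ∂m, Recur T A x) (hrB : ∀ᵐ x ∂m, Recur T B x) : MemFlog T m (A ∪ B) := by
  have aux : ∀ {D E : Set X}, D ⊆ E → MemFlog T m D → (∀ᵐ x ∂m, Recur T D x) →
      ∫⁻ x in D, ENNReal.ofReal (Real.log (returnTime T E x)) ∂m < ⊤ := by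
    intro D E hDE hD hr
    refine lt_of_le_of_lt (lintegral_mono_ae ?_) hD.2.2.2
    filter_upwards [ae_restrict_of_ae hr] with x hx
    have hrE : Recur T E x := hx.mono fun n h => hDE h
    refine ENNReal.ofReal_le_ofReal (Real.log_le_log (by exact_mod_cast hrE.one_le) ?_)
    exact_mod_cast returnTime_le hx.one_le (hDE hx.indT_mem)
  refine ⟨hA.1.union hB.1, hA.2.1.trans_le (measure_mono Set.subset_union_left),
    (measure_union_le _ _).trans_lt (ENNReal.add_lt_top.2 ⟨hA.2.2.1, hB.2.2.1⟩), ?_⟩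
  refine (lintegral_union_le _ _ _).trans_lt (ENNReal.add_lt_top.2 ⟨?_, ?_⟩)
  · exact aux Set.subset_union_left hA hrA
  · exact aux Set.subset_union_right hB hrB

end

-- Part 3
/-- forget the zeroth coordinate -/
def eraseO (w : ℕ → Prop) : ℕ → Prop := fun n => 1 ≤ n ∧ w n

/-- prepend `i` zeros -/
def padO (i : ℕ) (w : ℕ → Prop) : ℕ → Prop := fun s => i ≤ s ∧ w (s - i)

lemma measurable_padO (i : ℕ) : Measurable (padO i) := by
  refine measurable_pi_lambda _ fun s => ?_
  by_cases h : i ≤ s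
  · simpa [padO, h] using measurable_pi_apply (s - i)
  · simp [padO, h]

lemma eraseO_itin_eq {X : Type*} {T : X → X} {A : Set X} {x : X} {i : ℕ}
    (h1 : 1 ≤ i) (h2 : i ≤ returnTime T A x) :
    eraseO (itin T A (T^[returnTime T A x - i] x)) = padO i (itin T A (indT T A x)) := by
  funext s
  simp only [eraseO, itin, padO, indT, ← Function.iterate_add_apply, eq_iff_iff]
  constructor
  · rintro ⟨h3, h4⟩
    have h5 : i ≤ s := by
      by_contra h
      exact not_mem_of_lt_returnTime (by omega) (by omega) h4
    refine ⟨h5, ?_⟩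
    have e : s - i + returnTime T A x = s + (returnTime T A x - i) := by omega
    rwa [e]
  · rintro ⟨h3, h4⟩
    refine ⟨by omega, ?_⟩
    have e : s - i + returnTime T A x = s + (returnTime T A x - i) := by omega
    rwa [← e]

lemma retO_eraseO (w : ℕ → Prop) : retO (eraseO w) = retO w := by
  unfold retO eraseO
  congr 1
  ext n
  simp only [Set.mem_ofPred_eq]
  tauto

lemma indO_eraseO (w : ℕ → Prop) (h : 1 ≤ retO w) : indO (eraseO w) = indO w := by
  funext i
  unfold indO
  rw [retO_eraseO]
  unfold eraseO
  simp only [eq_iff_iff, and_iff_right_iff_imp]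
  intro _
  omega

section
variable {X : Type*} [MeasurableSpace X] {T : X → X} {m : Measure X}

lemma ae_orbit (hT : MeasurePreserving T m m) {P : X → Prop} (h : ∀ᵐ x ∂m, P x) :
    ∀ᵐ x ∂m, ∀ t : ℕ, P (T^[t] x) :=
  ae_all_iff.2 fun t => (hT.iterate t).quasiMeasurePreserving.ae h

lemma predictable_future (hT : MeasurePreserving T m m) {A : Set X}
    (hrec : ∀ᵐ x ∂m, Recur T A x) (hAm : MeasurableSet A) (hP : Predictable T m A) (j : ℕ) :
    ∃ D : Set (ℕ → Prop), MeasurableSet D ∧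
      ∀ᵐ x ∂(m.restrict A), (returnTime T A x = j ↔ itin T A (indT T A x) ∈ D) := by
  obtain ⟨B, hB, hAB⟩ := hP
  have hgen : MeasurableSpace.generateFrom {s : Set X | ∃ n : ℕ, 1 ≤ n ∧ s = T^[n] ⁻¹' A} ≤
      MeasurableSpace.comap (fun x => eraseO (itin T A x)) inferInstance := by
    refine MeasurableSpace.generateFrom_le ?_
    rintro s ⟨n, hn, rfl⟩
    refine ⟨{w | w n}, measurableSet_setOfPred.2 (measurable_pi_apply n), ?_⟩
    ext x
    simp [eraseO, itin, hn]
  obtain ⟨E, hE, rfl⟩ := hgen B hB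
  have hae : ∀ᵐ x ∂m, (x ∈ A ↔ eraseO (itin T A x) ∈ E) := by
    have := measure_symmDiff_eq_zero_iff.1 hAB
    filter_upwards [this.mem_iff] with x hx
    exact hx
  have hae2 := ae_orbit hT hae
  refine ⟨{w | 1 ≤ j ∧ padO j w ∈ E} ∩ ⋂ i : ℕ, ⋂ (_ : 1 ≤ i ∧ i < j), (padO i ⁻¹' E)ᶜ, ?_, ?_⟩
  · refine MeasurableSet.inter ?_ (MeasurableSet.iInter fun i => MeasurableSet.iInter fun _ =>
      ((measurable_padO i) hE).compl)
    by_cases h : 1 ≤ j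
    · simp only [h, true_and]; exact (measurable_padO j) hE
    · simp [h]
  · have hAae : ∀ᵐ x ∂(m.restrict A), x ∈ A := ae_restrict_mem hAm
    filter_upwards [ae_restrict_of_ae hrec, ae_restrict_of_ae hae2, hAae] with x hr hx hxA
    have key : ∀ i, 1 ≤ i → i ≤ returnTime T A x →
        (T^[returnTime T A x - i] x ∈ A ↔ padO i (itin T A (indT T A x)) ∈ E) := by
      intro i h1 h2
      rw [hx, eraseO_itin_eq h1 h2]
    have hr1 := hr.one_le
    have hD : padO (returnTime T A x) (itin T A (indT T A x)) ∈ E := by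
      rw [← key _ hr1 le_rfl]; simpa using hxA
    have hD2 : ∀ i, 1 ≤ i → i < returnTime T A x → padO i (itin T A (indT T A x)) ∉ E := by
      intro i h1 h2
      rw [← key _ h1 h2.le]
      exact not_mem_of_lt_returnTime (by omega) (by omega)
    simp only [Set.mem_inter_iff, Set.mem_ofPred_eq, Set.mem_iInter, Set.mem_compl_iff,
      Set.mem_preimage]
    constructor
    · rintro rfl
      exact ⟨⟨hr1, hD⟩, fun i hi => hD2 i hi.1 hi.2⟩
    · rintro ⟨⟨h1, h2⟩, h3⟩
      rcases lt_trichotomy (returnTime T A x) j with h | h | h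
      · exact absurd hD (h3 _ ⟨hr1, h⟩)
      · exact h
      · exact absurd h2 (hD2 j h1 h)

lemma measure_first_hit (hT : MeasurePreserving T m m) {C : Set X} (hC : MeasurableSet C)
    (hfin : m C < ⊤) (hrec : ∀ᵐ x ∂m, Recur T C x) (k : ℕ) :
    m {x | (∀ s < k, T^[s] x ∉ C) ∧ T^[k] x ∈ C} = m (C ∩ {x | k < returnTime T C x}) := by
  have hTm := hT.measurable
  have hφ := measurable_returnTime_s14 hTm hC
  have hE : ∀ k, MeasurableSet {x | (∀ s < k, T^[s] x ∉ C) ∧ T^[k] x ∈ C} := by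
    intro k
    have : {x | (∀ s < k, T^[s] x ∉ C) ∧ T^[k] x ∈ C}
        = (⋂ s : ℕ, ⋂ (_ : s < k), (T^[s] ⁻¹' C)ᶜ) ∩ T^[k] ⁻¹' C := by
      ext x; simp
    rw [this]
    exact (MeasurableSet.iInter fun s => MeasurableSet.iInter fun _ =>
      ((hTm.iterate s) hC).compl).inter ((hTm.iterate k) hC)
  induction k with
  | zero =>
    refine measure_congr ?_
    filter_upwards [hrec] with x hx
    have := hx.one_le
    apply propext
    change ((∀ s < 0, T^[s] x ∉ C) ∧ T^[0] x ∈ C) ↔ (x ∈ C ∧ 0 < returnTime T C x)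
    simp; intro _; omega
  | succ k ih =>
    rw [← hT.measure_preimage (hE k).nullMeasurableSet] at ih
    have hn : MeasurableSet {x | returnTime T C x = k + 1} := hφ (measurableSet_singleton (k + 1))
    have h1 : m (C ∩ {x | k < returnTime T C x}) =
        m (C ∩ {x | k + 1 < returnTime T C x}) + m (C ∩ {x | returnTime T C x = k + 1}) := by
      rw [← measure_union _ (hC.inter hn)]
      · congr 1; ext x
        simp only [Set.mem_inter_iff, Set.mem_ofPred_eq, Set.mem_union]
        constructor
        · rintro ⟨a, b⟩
          by_cases h : returnTime T C x = k + 1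
          · exact Or.inr ⟨a, h⟩
          · exact Or.inl ⟨a, by omega⟩
        · rintro (⟨a, b⟩ | ⟨a, b⟩) <;> exact ⟨a, by omega⟩
      · rw [Set.disjoint_left]
        rintro x ⟨_, h⟩ ⟨_, h'⟩
        simp only [Set.mem_ofPred_eq] at h h'
        omega
    have h2 : m (T ⁻¹' {x | (∀ s < k, T^[s] x ∉ C) ∧ T^[k] x ∈ C}) =
        m {x | (∀ s < k + 1, T^[s] x ∉ C) ∧ T^[k + 1] x ∈ C}
          + m (C ∩ {x | returnTime T C x = k + 1}) := by
      rw [← measure_union _ (hC.inter hn)]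
      · refine measure_congr ?_
        filter_upwards [hrec] with x hx
        have hx1 := hx.one_le
        apply propext
        change ((∀ s < k, T^[s] (T x) ∉ C) ∧ T^[k] (T x) ∈ C) ↔
          ((∀ s < k + 1, T^[s] x ∉ C) ∧ T^[k + 1] x ∈ C) ∨ (x ∈ C ∧ returnTime T C x = k + 1)
        simp only [← Function.iterate_succ_apply]
        constructor
        · rintro ⟨a, b⟩
          by_cases hxC : x ∈ C
          · right
            refine ⟨hxC, le_antisymm (returnTime_le (by omega) b) ?_⟩
            by_contra hlt
            obtain ⟨c, hc⟩ : ∃ c, returnTime T C x = c + 1 := ⟨returnTime T C x - 1, by omega⟩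
            have := hx.indT_mem
            rw [indT, hc] at this
            exact a c (by omega) this
          · left
            refine ⟨fun s hs => ?_, b⟩
            rcases s with _ | s
            · exact hxC
            · exact a s (by omega)
        · rintro (⟨a, b⟩ | ⟨a, b⟩)
          · exact ⟨fun s hs => a (s + 1) (by omega), b⟩
          · refine ⟨fun s hs => not_mem_of_lt_returnTime (by omega) (by omega), ?_⟩
            have := hx.indT_mem
            rwa [indT, b] at this
      · rw [Set.disjoint_left]
        rintro x ⟨h, _⟩ ⟨h', _⟩
        exact h 0 (by omega) h'
    rw [h1, h2] at ih
    refine (ENNReal.add_left_inj ?_).1 ih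
    exact ((measure_mono Set.inter_subset_left).trans_lt hfin).ne

lemma tendsto_tail {C : Set X} (hT : Measurable T) (hC : MeasurableSet C) (hfin : m C < ⊤) :
    Tendsto (fun k => m (C ∩ {x | k < returnTime T C x})) atTop (𝓝 0) := by
  have hφ := measurable_returnTime_s14 hT hC
  have h := tendsto_measure_iInter_atTop (μ := m) (s := fun k => C ∩ {x | k < returnTime T C x})
    (fun k => (hC.inter (hφ (measurableSet_Ioi (a := k)))).nullMeasurableSet) ?_ ⟨0, ?_⟩
  · have : ⋂ k, (C ∩ {x | k < returnTime T C x}) = ∅ := by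
      ext x
      simp only [Set.mem_iInter, Set.mem_empty_iff_false, iff_false, not_forall]
      exact ⟨returnTime T C x, fun h => lt_irrefl (returnTime T C x) h.2⟩
    rw [this, measure_empty] at h
    exact h
  · intro a b hab x hx
    exact ⟨hx.1, lt_of_le_of_lt hab hx.2⟩
  · exact ((measure_mono Set.inter_subset_left).trans_lt hfin).ne

lemma predictable_of_det (hT : MeasurePreserving T m m) {C : Set X} (hC : MeasurableSet C)
    (hfin : m C < ⊤) (hrec : ∀ᵐ x ∂m, Recur T C x) (g : (ℕ → Prop) → ℕ) (hg : Measurable g)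
    (hdet : ∀ᵐ x ∂(m.restrict C), returnTime T C x = g (itin T C (indT T C x))) :
    Predictable T m C := by
  have hTm := hT.measurable
  have hφ := measurable_returnTime_s14 hTm hC
  refine ⟨{x | retO (eraseO (itin T C x)) = g (indO (eraseO (itin T C x)))}, ?_, ?_⟩
  · have h1 : Measurable[MeasurableSpace.generateFrom
      {s : Set X | ∃ n : ℕ, 1 ≤ n ∧ s = T^[n] ⁻¹' C}] (fun x => eraseO (itin T C x)) := by
      refine @measurable_pi_lambda _ _ _ (_) _ _ fun n => ?_
      by_cases hn : 1 ≤ n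
      · simp only [eraseO, itin, hn, true_and]
        refine (@measurableSet_setOfPred _ (_) _).1 ?_
        exact MeasurableSpace.measurableSet_generateFrom ⟨n, hn, rfl⟩
      · simp only [eraseO, hn, false_and]
        exact @measurable_const _ _ _ (_) _
    have h2 : MeasurableSet {w | retO w = g (indO w)} :=
      measurableSet_eq_fun measurable_retO (hg.comp measurable_indO)
    exact h1 h2
  · set Q : Set X := {x | returnTime T C x = g (itin T C (indT T C x))} with hQ
    have hQm : MeasurableSet Q := measurableSet_eq_fun hφ
      (hg.comp ((measurable_itin hTm hC).comp (measurable_indT hTm hC)))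
    have hdet' := (ae_restrict_iff' hC).1 hdet
    -- the bad set is null
    have hD : ∀ n, m ((Q \ C) ∩ {x | returnTime T C x = n}) = 0 := by
      intro n
      set D := (Q \ C) ∩ {x | returnTime T C x = n} with hDdef
      have hDm : MeasurableSet D := (hQm.diff hC).inter (hφ (measurableSet_singleton n))
      have hle : ∀ N : ℕ, m D ≤ m {x | (∀ s < N + n, T^[s] x ∉ C) ∧ T^[N + n] x ∈ C} := by
        intro N
        rw [← lintegral_indicator_one hDm,
          kac_decomp hT hC (f := D.indicator 1) (measurable_one.indicator hDm) N]
        have hz : ∑ t ∈ Finset.range (N + 1),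
          ∫⁻ x in {x | x ∈ C ∧ ∀ s, 1 ≤ s → s ≤ t → T^[s] x ∉ C}, D.indicator 1 (T^[t] x) ∂m
            = 0 := by
          refine Finset.sum_eq_zero fun t _ => ?_
          refine (lintegral_congr_ae ?_).trans lintegral_zero
          have hGm : MeasurableSet {x | x ∈ C ∧ ∀ s, 1 ≤ s → s ≤ t → T^[s] x ∉ C} := by
            have : {x | x ∈ C ∧ ∀ s, 1 ≤ s → s ≤ t → T^[s] x ∉ C}
                = C ∩ ⋂ s : ℕ, ⋂ (_ : 1 ≤ s), ⋂ (_ : s ≤ t), (T^[s] ⁻¹' C)ᶜ := by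
              ext x; simp
            rw [this]
            exact hC.inter (MeasurableSet.iInter fun s => MeasurableSet.iInter fun _ =>
              MeasurableSet.iInter fun _ => ((hTm.iterate s) hC).compl)
          filter_upwards [ae_restrict_of_ae hdet', ae_restrict_of_ae hrec,
            ae_restrict_mem hGm] with x hx hr hxG
          refine Set.indicator_of_notMem ?_ _
          rintro ⟨⟨h1, h2⟩, h3⟩
          simp only [hQ, Set.mem_ofPred_eq] at h1 h3
          rcases Nat.eq_zero_or_pos t with rfl | ht
          · exact h2 hxG.1
          · have hrt : Recur T C (T^[t] x) := (Recur.iter t).2 hr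
            have hφx : returnTime T C x = n + t := by
              refine le_antisymm (returnTime_le (by omega) ?_) ?_
              · have := hrt.indT_mem
                rwa [indT, h3, ← Function.iterate_add_apply] at this
              · by_contra hlt
                push Not at hlt
                have h5 := hr.indT_mem
                have h6 := hr.one_le
                by_cases h7 : returnTime T C x ≤ t
                · exact hxG.2 _ h6 h7 h5
                · refine not_mem_of_lt_returnTime (T := T) (C := C) (x := T^[t] x)
                    (n := returnTime T C x - t) (by omega) (by omega) ?_
                  rw [← Function.iterate_add_apply]
                  rw [indT] at h5
                  rwa [Nat.sub_add_cancel (by omega)]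
            have hS : indT T C (T^[t] x) = indT T C x := by
              rw [indT, indT, h3, hφx, Function.iterate_add_apply]
            have h8 := hx hxG.1
            rw [hS] at h1
            omega
        rw [hz, zero_add]
        have hZm : MeasurableSet {x | ∀ s, s ≤ N → T^[s] x ∉ C} := by
          have : {x | ∀ s, s ≤ N → T^[s] x ∉ C} = ⋂ s : ℕ, ⋂ (_ : s ≤ N), (T^[s] ⁻¹' C)ᶜ := by
            ext x; simp
          rw [this]
          exact MeasurableSet.iInter fun s => MeasurableSet.iInter fun _ =>
            ((hTm.iterate s) hC).compl
        have e1 : ∀ x, D.indicator (1 : X → ℝ≥0∞) (T^[N] x) = (T^[N] ⁻¹' D).indicator 1 x :=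
          fun x => rfl
        simp only [e1]
        rw [lintegral_indicator_one ((hTm.iterate N) hDm),
          Measure.restrict_apply ((hTm.iterate N) hDm)]
        refine measure_mono_ae ?_
        filter_upwards [hrec] with x hr hx
        obtain ⟨⟨⟨h1, h2⟩, h3⟩, h4⟩ := hx
        simp only [Set.mem_ofPred_eq] at h3 h4
        have hrt : Recur T C (T^[N] x) := (Recur.iter N).2 hr
        refine ⟨fun s hs => ?_, ?_⟩
        · by_cases h : s ≤ N
          · exact h4 s h
          · have := not_mem_of_lt_returnTime (T := T) (C := C) (x := T^[N] x)
              (n := s - N) (by omega) (by omega)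
            rwa [← Function.iterate_add_apply, Nat.sub_add_cancel (by omega)] at this
        · have := hrt.indT_mem
          rwa [indT, h3, ← Function.iterate_add_apply, add_comm] at this
      have hlim := (tendsto_tail (m := m) hTm hC hfin).comp (tendsto_add_atTop_nat n)
      refine le_antisymm (ge_of_tendsto' hlim fun N => ?_) (zero_le)
      rw [Function.comp, ← measure_first_hit hT hC hfin hrec]
      exact hle N
    have hQC : m (Q \ C) = 0 := by
      have : Q \ C = ⋃ n, (Q \ C) ∩ {x | returnTime T C x = n} := by
        ext x; simp
      rw [this]
      exact measure_iUnion_null hD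
    rw [measure_symmDiff_eq_zero_iff]
    have h9 : ∀ᵐ x ∂m, x ∉ Q \ C := by
      rw [ae_iff]; simp only [not_not]; exact hQC
    filter_upwards [hrec, hdet', h9] with x hr hx hx2
    apply propext
    change x ∈ C ↔ retO (eraseO (itin T C x)) = g (indO (eraseO (itin T C x)))
    rw [retO_eraseO, indO_eraseO (itin T C x) hr.one_le, ← itin_indT, retO_itin]
    constructor
    · exact hx
    · intro h
      by_contra hc
      exact hx2 ⟨h, hc⟩

end

-- Part 4
section chain
variable {U L : Type} (next : U → L → U) (k : U → L → ℝ≥0∞) (H : U → ℝ≥0∞)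

open Classical in
/-- one (backward) step of the chain, with the label restricted to `e`. -/
noncomputable def stepC (e : L → Prop) (a : U → ℝ≥0∞) : U → ℝ≥0∞ := fun v' =>
  ∑' v, ∑' l, if e l ∧ next v l = v' then a v * k v l else 0

/-- total mass with respect to the potential. -/
noncomputable def totC (a : U → ℝ≥0∞) : ℝ≥0∞ := ∑' v, a v * H v

/-- one excursion of length `r`. -/
noncomputable def excC (bit : L → Prop) : ℕ → (U → ℝ≥0∞) → (U → ℝ≥0∞)
  | 0, _ => fun _ => 0
  | (r + 1), a => stepC next k bit ((stepC next k (fun l => ¬ bit l))^[r] a)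

open Classical in
lemma totC_stepC (e : L → Prop) (a : U → ℝ≥0∞) :
    totC H (stepC next k e a) = ∑' v, ∑' l, if e l then a v * k v l * H (next v l) else 0 := by
  unfold totC stepC
  simp only [← ENNReal.tsum_mul_right]
  rw [ENNReal.tsum_comm]
  congr 1; funext v
  rw [ENNReal.tsum_comm]
  congr 1; funext l
  rw [tsum_eq_single (next v l)]
  · by_cases h : e l <;> simp [h]
  · intro b hb
    simp [hb.symm]

lemma totC_split (hs : ∀ v, ∑' l, k v l * H (next v l) ≤ H v) (bit : L → Prop) (a : U → ℝ≥0∞) :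
    totC H (stepC next k bit a) + totC H (stepC next k (fun l => ¬ bit l) a) ≤ totC H a := by
  classical
  rw [totC_stepC, totC_stepC, ← ENNReal.tsum_add, totC]
  refine ENNReal.tsum_le_tsum fun v => ?_
  rw [← ENNReal.tsum_add]
  calc _ = ∑' l, a v * (k v l * H (next v l)) := by
        congr 1; funext l
        by_cases h : bit l <;> simp [h, mul_assoc]
    _ = a v * ∑' l, k v l * H (next v l) := ENNReal.tsum_mul_left
    _ ≤ _ := by gcongr; exact hs v

lemma totC_exc (hs : ∀ v, ∑' l, k v l * H (next v l) ≤ H v) (bit : L → Prop) (a : U → ℝ≥0∞) :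
    ∑' r, totC H (excC next k bit r a) ≤ totC H a := by
  have h0 : totC H (excC next k bit 0 a) = 0 := by simp [excC, totC]
  rw [tsum_eq_zero_add' ENNReal.summable, h0, zero_add]
  refine ENNReal.tsum_le_of_sum_range_le fun n => ?_
  suffices h : ∑ r ∈ Finset.range n, totC H (excC next k bit (r + 1) a)
      + totC H ((stepC next k (fun l => ¬ bit l))^[n] a) ≤ totC H a from le_self_add.trans h
  induction n with
  | zero => simp
  | succ n ih =>
    refine le_trans ?_ ih
    rw [Finset.sum_range_succ, add_assoc]
    gcongr
    rw [Function.iterate_succ_apply']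
    exact totC_split next k H hs bit _

lemma measurable_stepC [Countable U] [Countable L] (e : L → Prop) :
    Measurable (stepC next k e) := by
  classical
  refine measurable_pi_lambda _ fun v' => ?_
  unfold stepC
  refine Measurable.tsum fun v => Measurable.tsum fun l => ?_
  by_cases h : e l ∧ next v l = v'
  · simp only [h, if_true, and_self]
    exact (measurable_pi_apply v).mul_const _
  · simp only [h, if_false]
    exact measurable_const

lemma measurable_excC [Countable U] [Countable L] (bit : L → Prop) (r : ℕ) :
    Measurable (excC next k bit r) := by
  cases r with
  | zero => exact measurable_const
  | succ r =>
    exact (measurable_stepC next k bit).comp ((measurable_stepC next k _).iterate r)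

lemma stepC_ge (e : L → Prop) (a : U → ℝ≥0∞) (v : U) (l : L) (h : e l) :
    a v * k v l ≤ stepC next k e a (next v l) := by
  classical
  unfold stepC
  refine le_trans ?_ (ENNReal.le_tsum v)
  refine le_trans ?_ (ENNReal.le_tsum l)
  simp [h]

/-- weights after `n` excursions, as a function of the itinerary -/
noncomputable def vecC (bit : L → Prop) (nu : U → ℝ≥0∞) : ℕ → (ℕ → Prop) → U → ℝ≥0∞
  | 0, _ => nu
  | (n + 1), w => excC next k bit (retO w) (vecC bit nu n (indO w))

lemma measurable_vecC [Countable U] [Countable L] (bit : L → Prop) (nu : U → ℝ≥0∞) (n : ℕ) :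
    Measurable (vecC next k bit nu n) := by
  induction n with
  | zero => exact measurable_const
  | succ n ih =>
    have h : Measurable (fun p : ℕ × (U → ℝ≥0∞) => excC next k bit p.1 p.2) :=
      measurable_from_prod_countable_right fun r => measurable_excC next k bit r
    exact h.comp (measurable_retO.prodMk (ih.comp measurable_indO))

/-- inverse likelihoods -/
noncomputable def invL (κ : Kernel (ℕ → Prop) ℕ) : ℕ → (ℕ → Prop) → ℝ≥0∞
  | 0, _ => 1
  | (n + 1), w => (κ (indO w) {retO w})⁻¹ * invL κ n (indO w)

lemma measurable_kernel_singleton (κ : Kernel (ℕ → Prop) ℕ) :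
    Measurable (fun p : (ℕ → Prop) × ℕ => κ p.1 {p.2}) :=
  measurable_from_prod_countable_left fun r => κ.measurable_coe (measurableSet_singleton r)

lemma measurable_invL (κ : Kernel (ℕ → Prop) ℕ) (n : ℕ) : Measurable (invL κ n) := by
  induction n with
  | zero => exact measurable_const
  | succ n ih =>
    exact (((measurable_kernel_singleton κ).comp (measurable_indO.prodMk measurable_retO)).inv).mul
      (ih.comp measurable_indO)

lemma measurable_totC [Countable U] : Measurable (totC H) :=
  Measurable.tsum fun v => (measurable_pi_apply v).mul_const _

end chain

lemma lintegral_condDistrib {X : Type*} [MeasurableSpace X] {m : Measure X} [IsFiniteMeasure m]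
    {β : Type*} [MeasurableSpace β] {Y : X → ℕ} {F : X → β} (hY : Measurable Y)
    (hF : Measurable F) {g : β × ℕ → ℝ≥0∞} (hg : Measurable g) :
    ∫⁻ x, g (F x, Y x) ∂m
      = ∫⁻ x, ∑' r, g (F x, r) * condDistrib Y F m (F x) {r} ∂m := by
  have h1 : ∫⁻ x, g (F x, Y x) ∂m = ∫⁻ p, g p ∂(m.map (fun a => (F a, Y a))) := by
    rw [lintegral_map hg (hF.prodMk hY)]
  rw [h1, ← compProd_map_condDistrib hY.aemeasurable, Measure.lintegral_compProd hg,
    lintegral_map (hg.lintegral_kernel_prod_right') hF]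
  congr 1; funext x
  rw [lintegral_countable']

section
variable {X : Type*} [MeasurableSpace X] {T : X → X} {m : Measure X}

lemma lintegral_ratio_le {U L : Type} [Countable U] [Countable L]
    (next : U → L → U) (k : U → L → ℝ≥0∞) (H : U → ℝ≥0∞)
    (hs : ∀ v, ∑' l, k v l * H (next v l) ≤ H v) (bit : L → Prop) (nu : U → ℝ≥0∞)
    (hT : MeasurePreserving T m m) {C : Set X} (hC : MeasurableSet C) [IsFiniteMeasure (m.restrict C)]
    (hrec : ∀ᵐ x ∂m, Recur T C x) (n : ℕ) :
    ∫⁻ x in C, totC H (vecC next k bit nu n (itin T C x)) *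
      invL (condDistrib (returnTime T C) (fun x => itin T C (indT T C x)) (m.restrict C)) n
        (itin T C x) ∂m ≤ totC H nu * m C := by
  have hTm := hT.measurable
  have hfin : m C < ⊤ := by simpa using measure_lt_top (m.restrict C) Set.univ
  have hφ := measurable_returnTime_s14 hTm hC
  have hS := mp_indT hT hC hfin hrec
  have hF : Measurable (fun x => itin T C (indT T C x)) :=
    (measurable_itin hTm hC).comp hS.measurable
  set κ := condDistrib (returnTime T C) (fun x => itin T C (indT T C x)) (m.restrict C) with hκ
  induction n with
  | zero => simp [vecC, invL]
  | succ n ih =>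
    set f : (ℕ → Prop) → ℝ≥0∞ := fun w => totC H (vecC next k bit nu n w) * invL κ n w with hf
    have hfm : Measurable f :=
      ((measurable_totC H).comp (measurable_vecC next k bit nu n)).mul (measurable_invL κ n)
    set g : (ℕ → Prop) × ℕ → ℝ≥0∞ := fun p =>
      totC H (excC next k bit p.2 (vecC next k bit nu n p.1)) * ((κ p.1 {p.2})⁻¹ * invL κ n p.1)
      with hg
    have hgm : Measurable g := by
      refine measurable_from_prod_countable_left fun r => ?_
      refine ((measurable_totC H).comp ((measurable_excC next k bit r).comp
        (measurable_vecC next k bit nu n))).mul (Measurable.mul ?_ (measurable_invL κ n))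
      exact (κ.measurable_coe (measurableSet_singleton r)).inv
    calc _ = ∫⁻ x in C, g (itin T C (indT T C x), returnTime T C x) ∂m := by
          congr 1; funext x
          simp only [hg, vecC, invL, itin_indT, retO_itin]
      _ = ∫⁻ x in C, ∑' r, g (itin T C (indT T C x), r) * κ (itin T C (indT T C x)) {r} ∂m :=
          lintegral_condDistrib hφ hF hgm
      _ ≤ ∫⁻ x in C, f (itin T C (indT T C x)) ∂m := by
          refine lintegral_mono fun x => ?_
          simp only [hg, hf]
          set w := itin T C (indT T C x)
          calc _ ≤ ∑' r, totC H (excC next k bit r (vecC next k bit nu n w)) * invL κ n w := by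
                refine ENNReal.tsum_le_tsum fun r => ?_
                have : (κ w {r})⁻¹ * κ w {r} ≤ 1 := ENNReal.inv_mul_le_one _
                calc _ = totC H (excC next k bit r (vecC next k bit nu n w)) * invL κ n w
                          * ((κ w {r})⁻¹ * κ w {r}) := by ring
                  _ ≤ totC H (excC next k bit r (vecC next k bit nu n w)) * invL κ n w * 1 := by
                      gcongr
                  _ = _ := mul_one _
            _ = (∑' r, totC H (excC next k bit r (vecC next k bit nu n w))) * invL κ n w :=
                ENNReal.tsum_mul_right
            _ ≤ _ := by
                gcongr
                exact totC_exc next k H hs bit _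
      _ = ∫⁻ x in C, f (itin T C x) ∂m :=
          hS.lintegral_comp (hfm.comp (measurable_itin hTm hC))
      _ ≤ _ := ih

end

-- Part 5
/-- A backward coding model for the label process `ℓ` with total cost at most `ε`. -/
structure CodeModel {X : Type*} [MeasurableSpace X] (T : X → X) (m : Measure X) {L : Type}
    (ℓ : X → L) (ε : ℝ≥0∞) where
  U : Type
  countableU : Countable U
  u : X → U
  u_meas : ∀ v, MeasurableSet (u ⁻¹' {v})
  next : U → L → U
  k : U → L → ℝ≥0∞
  H : U → ℝ≥0∞
  H_le : ∀ v, H v ≤ 1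
  super : ∀ v, ∑' l, k v l * H (next v l) ≤ H v
  u_step : ∀ᵐ x ∂m, u x = next (u (T x)) (ℓ x)
  H_pos : ∀ᵐ x ∂m, 0 < H (u x)
  c : X → ℝ
  c_nonneg : ∀ x, 0 ≤ c x
  c_meas : Measurable c
  c_k : ∀ᵐ x ∂m, ENNReal.ofReal (Real.exp (-(c x))) ≤ k (u (T x)) (ℓ x)
  c_int : ∫⁻ x, ENNReal.ofReal (c x) ∂m ≤ ε

namespace CodeModel
variable {X : Type*} [MeasurableSpace X] {T : X → X} {m : Measure X} {L : Type}
    {ℓ : X → L} {ε : ℝ≥0∞}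

/-- good points -/
def Good (M : CodeModel T m ℓ ε) (x : X) : Prop :=
  ∀ t : ℕ, M.u (T^[t] x) = M.next (M.u (T (T^[t] x))) (ℓ (T^[t] x)) ∧
    ENNReal.ofReal (Real.exp (-(M.c (T^[t] x)))) ≤ M.k (M.u (T (T^[t] x))) (ℓ (T^[t] x))

lemma Good.iter {M : CodeModel T m ℓ ε} {x : X} (h : M.Good x) (n : ℕ) : M.Good (T^[n] x) := by
  intro t
  have := h (t + n)
  rwa [Function.iterate_add_apply] at this

lemma ae_good (M : CodeModel T m ℓ ε) (hT : MeasurePreserving T m m) : ∀ᵐ x ∂m, M.Good x :=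
  ae_orbit hT (M.u_step.and M.c_k)

lemma step_bound {M : CodeModel T m ℓ ε} {e : L → Prop} {x : X} (h : M.Good x) (he : e (ℓ x))
    (a : M.U → ℝ≥0∞) :
    a (M.u (T x)) * ENNReal.ofReal (Real.exp (-(M.c x))) ≤ stepC M.next M.k e a (M.u x) := by
  have h0 := h 0
  simp only [Function.iterate_zero, id] at h0
  rw [h0.1]
  refine le_trans ?_ (stepC_ge M.next M.k e a (M.u (T x)) (ℓ x) he)
  gcongr
  exact h0.2

lemma zeros_bound {M : CodeModel T m ℓ ε} {bit : L → Prop} (a : M.U → ℝ≥0∞) (j : ℕ) {x : X}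
    (h : M.Good x) (hb : ∀ i < j, ¬ bit (ℓ (T^[i] x))) :
    a (M.u (T^[j] x)) * ENNReal.ofReal (Real.exp (-(∑ t ∈ Finset.range j, M.c (T^[t] x))))
      ≤ (stepC M.next M.k (fun l => ¬ bit l))^[j] a (M.u x) := by
  induction j generalizing x with
  | zero => simp
  | succ j ih =>
    have h1 := ih (x := T x) (h.iter 1) (fun i hi => hb (i + 1) (by omega))
    simp only [← Function.iterate_succ_apply] at h1
    rw [Function.iterate_succ_apply' (stepC _ _ _)]
    refine le_trans ?_ (step_bound (e := fun l => ¬ bit l) h (hb 0 (by omega)) _)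
    rw [Finset.sum_range_succ', neg_add, Real.exp_add, ENNReal.ofReal_mul (Real.exp_pos _).le,
      ← mul_assoc]
    exact mul_le_mul_left h1 _

/-- cost of a whole excursion -/
noncomputable def cost (M : CodeModel T m ℓ ε) (C : Set X) (x : X) : ℝ :=
  ∑ t ∈ Finset.range (returnTime T C x), M.c (T^[t] x)

lemma exc_bound {M : CodeModel T m ℓ ε} {bit : L → Prop} {C : Set X}
    (hbit : ∀ x, x ∈ C ↔ bit (ℓ x)) (a : M.U → ℝ≥0∞) {x : X}
    (h : M.Good x) (hx : x ∈ C) (hr : Recur T C x) :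
    a (M.u (indT T C x)) * ENNReal.ofReal (Real.exp (-(M.cost C x)))
      ≤ excC M.next M.k bit (returnTime T C x) a (M.u x) := by
  obtain ⟨r, hr'⟩ : ∃ r, returnTime T C x = r + 1 := ⟨returnTime T C x - 1, by
    have := hr.one_le; omega⟩
  rw [cost, indT, hr', excC]
  have h1 := zeros_bound (bit := bit) a r (x := T x) (h.iter 1) (fun i hi => by
    rw [← hbit, ← Function.iterate_succ_apply]
    exact not_mem_of_lt_returnTime (by omega) (by omega))
  simp only [← Function.iterate_succ_apply] at h1
  refine le_trans ?_ (step_bound (e := bit) h ((hbit x).1 hx) _)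
  rw [Finset.sum_range_succ', neg_add, Real.exp_add, ENNReal.ofReal_mul (Real.exp_pos _).le,
    ← mul_assoc]
  exact mul_le_mul_left h1 _

lemma vec_bound {M : CodeModel T m ℓ ε} {bit : L → Prop} {C : Set X}
    (hbit : ∀ x, x ∈ C ↔ bit (ℓ x)) (nu : M.U → ℝ≥0∞) (n : ℕ) {x : X}
    (h : M.Good x) (hx : x ∈ C) (hr : Recur T C x) :
    nu (M.u ((indT T C)^[n] x)) *
        ENNReal.ofReal (Real.exp (-(∑ i ∈ Finset.range n, M.cost C ((indT T C)^[i] x))))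
      ≤ vecC M.next M.k bit nu n (itin T C x) (M.u x) := by
  induction n generalizing x with
  | zero => simp [vecC]
  | succ n ih =>
    have h1 := ih (x := indT T C x) (h.iter _) hr.indT_mem ((Recur.iter _).2 hr)
    rw [itin_indT] at h1
    rw [vecC, retO_itin]
    refine le_trans ?_ (exc_bound hbit _ h hx hr)
    rw [Finset.sum_range_succ', neg_add, Real.exp_add, ENNReal.ofReal_mul (Real.exp_pos _).le,
      ← mul_assoc]
    exact mul_le_mul_left h1 _

end CodeModel

lemma inv_ge_exp {p : ℝ≥0∞} (hp : p ≤ 1) :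
    ENNReal.ofReal (Real.exp (1 - p.toReal)) ≤ p⁻¹ := by
  have hpt : p ≠ ⊤ := ne_top_of_le_ne_top ENNReal.one_ne_top hp
  rw [ENNReal.le_inv_iff_mul_le]
  nth_rewrite 2 [← ENNReal.ofReal_toReal hpt]
  rw [← ENNReal.ofReal_mul (Real.exp_pos _).le, ← ENNReal.ofReal_one]
  refine ENNReal.ofReal_le_ofReal ?_
  have h1 : p.toReal ≤ Real.exp (p.toReal - 1) := by
    have := Real.add_one_le_exp (p.toReal - 1); linarith
  calc _ ≤ Real.exp (1 - p.toReal) * Real.exp (p.toReal - 1) := by gcongr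
    _ = 1 := by rw [← Real.exp_add]; simp

section
variable {X : Type*} [MeasurableSpace X] {T : X → X} {m : Measure X}

lemma invL_bound (κ : Kernel (ℕ → Prop) ℕ) [IsMarkovKernel κ] {C : Set X} (n : ℕ) (x : X) :
    ENNReal.ofReal (Real.exp (∑ i ∈ Finset.range n,
      (1 - (κ (itin T C (indT T C ((indT T C)^[i] x)))
        {returnTime T C ((indT T C)^[i] x)}).toReal)))
      ≤ invL κ n (itin T C x) := by
  induction n generalizing x with
  | zero => simp [invL]
  | succ n ih =>
    have h1 := ih (indT T C x)
    rw [itin_indT] at h1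
    rw [invL, retO_itin, Finset.sum_range_succ', add_comm, Real.exp_add,
      ENNReal.ofReal_mul (Real.exp_pos _).le]
    refine mul_le_mul' ?_ ?_
    · rw [← itin_indT]
      exact inv_ge_exp prob_le_one
    · exact h1

lemma delta_le {L : Type} [Countable L] {ℓ : X → L} {ε : ℝ≥0∞} (M : CodeModel T m ℓ ε)
    (hT : MeasurePreserving T m m) {C : Set X} (hC : MeasurableSet C)
    [IsFiniteMeasure (m.restrict C)] (hrec : ∀ᵐ x ∂m, Recur T C x)
    {bit : L → Prop} (hbit : ∀ x, x ∈ C ↔ bit (ℓ x)) :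
    ∫⁻ x in C, ENNReal.ofReal (1 - (condDistrib (returnTime T C)
      (fun x => itin T C (indT T C x)) (m.restrict C) (itin T C (indT T C x))
        {returnTime T C x}).toReal) ∂m ≤ ε := by
  have hTm := hT.measurable
  have hfin : m C < ⊤ := by simpa using measure_lt_top (m.restrict C) Set.univ
  have hφ := measurable_returnTime_s14 hTm hC
  have hS := mp_indT hT hC hfin hrec
  have hcountU := M.countableU
  have hratio := fun nu => lintegral_ratio_le M.next M.k M.H M.super bit nu hT hC hrec
  set κ := condDistrib (returnTime T C) (fun x => itin T C (indT T C x)) (m.restrict C) with hκ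
  set δ : X → ℝ := fun x => 1 - (κ (itin T C (indT T C x)) {returnTime T C x}).toReal with hδ
  have hδm : Measurable δ := by
    refine measurable_const.sub (Measurable.ennreal_toReal ?_)
    exact (measurable_kernel_singleton κ).comp
      (((measurable_itin hTm hC).comp hS.measurable).prodMk hφ)
  have hδ1 : ∀ x, δ x ≤ 1 := fun x => by simp [hδ]
  have hδ0 : ∀ x, 0 ≤ δ x := fun x => by
    simp only [hδ, sub_nonneg]
    exact ENNReal.toReal_le_of_le_ofReal zero_le_one (by simpa using prob_le_one)
  have hcm : Measurable (M.cost C) := by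
    have h : Measurable (fun p : X × ℕ => ∑ t ∈ Finset.range p.2, M.c (T^[t] p.1)) :=
      measurable_from_prod_countable_left fun y => by
        change Measurable fun x => ∑ t ∈ Finset.range y, M.c (T^[t] x)
        exact Finset.measurable_sum (Finset.range y) fun t _ => M.c_meas.comp (hTm.iterate t)
    exact h.comp (measurable_id.prodMk hφ)
  have hc0 : ∀ x, 0 ≤ M.cost C x := fun x => Finset.sum_nonneg fun _ _ => M.c_nonneg _
  have hcost : ∫⁻ x in C, ENNReal.ofReal (M.cost C x) ∂m ≤ ε := by
    refine le_trans ?_ M.c_int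
    refine le_trans (le_of_eq ?_) (kac_le_s14 hT hC M.c_meas.ennreal_ofReal)
    congr 1; funext x
    rw [CodeModel.cost, ENNReal.ofReal_sum_of_nonneg fun _ _ => M.c_nonneg _]
  obtain ⟨nu, hnu0, hnu1⟩ := ENNReal.exists_pos_sum_of_countable one_ne_zero M.U
  set nu' : M.U → ℝ≥0∞ := fun v => nu v with hnu'
  have htot : totC M.H nu' ≤ 1 := by
    refine le_trans ?_ hnu1.le
    refine ENNReal.tsum_le_tsum fun v => ?_
    calc _ ≤ nu' v * 1 := by gcongr; exact M.H_le v
      _ = _ := mul_one _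
  -- bad sets
  set bad : ℕ → Set X := fun j => {x | nu' (M.u x) < ((j : ℝ≥0∞) + 1)⁻¹} ∪
    {x | M.H (M.u x) < ((j : ℝ≥0∞) + 1)⁻¹} with hbad
  have hum : ∀ S : Set M.U, MeasurableSet (M.u ⁻¹' S) := by
    intro S
    have : M.u ⁻¹' S = ⋃ v ∈ S, M.u ⁻¹' {v} := by
      ext x; simp
    rw [this]
    exact MeasurableSet.biUnion (Set.to_countable S) fun v _ => M.u_meas v
  have hbadm : ∀ j, MeasurableSet (bad j) := fun j =>
    (hum {v | nu' v < ((j : ℝ≥0∞) + 1)⁻¹}).union (hum {v | M.H v < ((j : ℝ≥0∞) + 1)⁻¹})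
  have hbadlim : Tendsto (fun j => m.restrict C (bad j)) atTop (𝓝 0) := by
    have h := tendsto_measure_iInter_atTop (μ := m.restrict C) (s := bad)
      (fun j => (hbadm j).nullMeasurableSet) ?_ ⟨0, measure_ne_top _ _⟩
    · have h0 : m.restrict C (⋂ j, bad j) = 0 := by
        have hpos : ∀ᵐ x ∂(m.restrict C), x ∉ ⋂ j, bad j := by
          filter_upwards [ae_restrict_of_ae M.H_pos] with x hx
          have hmin : min (nu' (M.u x)) (M.H (M.u x)) ≠ 0 := by
            have : 0 < nu' (M.u x) := by simpa [hnu'] using hnu0 (M.u x)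
            exact (lt_min this hx).ne'
          obtain ⟨n, hn⟩ := ENNReal.exists_inv_nat_lt hmin
          simp only [Set.mem_iInter, not_forall]
          refine ⟨n, ?_⟩
          have hle : ((n : ℝ≥0∞) + 1)⁻¹ ≤ (n : ℝ≥0∞)⁻¹ :=
            ENNReal.inv_le_inv.2 le_self_add
          rintro (h | h)
          · exact absurd (h.trans_le (hle.trans (hn.le.trans (min_le_left _ _)))) (lt_irrefl _)
          · exact absurd (h.trans_le (hle.trans (hn.le.trans (min_le_right _ _)))) (lt_irrefl _)
        rw [ae_iff] at hpos
        simp only [not_not] at hpos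
        exact hpos
      rw [h0] at h
      exact h
    · intro a b hab
      have hle : ((b : ℝ≥0∞) + 1)⁻¹ ≤ ((a : ℝ≥0∞) + 1)⁻¹ := by
        apply ENNReal.inv_le_inv.2
        gcongr
      rintro x (h | h)
      · exact Or.inl (lt_of_lt_of_le h hle)
      · exact Or.inr (lt_of_lt_of_le h hle)
  -- main estimate
  set I := ∫⁻ x in C, ENNReal.ofReal (δ x) ∂m with hI
  have hmain : ∀ j n : ℕ, (n : ℝ≥0∞) * I ≤ n * (ε + 2 * m.restrict C (bad j))
      + ((j : ℝ≥0∞) + 1) * ((j : ℝ≥0∞) + 1) * m C := by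
    intro j n
    set η : ℝ≥0∞ := (j : ℝ≥0∞) + 1 with hη
    have hη0 : η ≠ 0 := by simp [hη]
    have hηt : η ≠ ⊤ := by simp [hη]
    set S := indT T C with hSdef
    set Fn : X → ℝ≥0∞ := fun x =>
      totC M.H (vecC M.next M.k bit nu' n (itin T C x)) * invL κ n (itin T C x) with hFn
    have hFm : Measurable Fn :=
      (((measurable_totC M.H).comp (measurable_vecC M.next M.k bit nu' n)).mul
        (measurable_invL κ n)).comp (measurable_itin hTm hC)
    have hpt : ∀ᵐ x ∂(m.restrict C), ∑ i ∈ Finset.range n, ENNReal.ofReal (δ (S^[i] x)) ≤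
        ∑ i ∈ Finset.range n, ENNReal.ofReal (M.cost C (S^[i] x)) + η * η * Fn x
          + (n * (bad j).indicator 1 x + n * (bad j).indicator 1 (S^[n] x)) := by
      filter_upwards [ae_restrict_of_ae hrec, ae_restrict_of_ae (M.ae_good hT),
        ae_restrict_mem hC] with x hr hg hx
      have htriv : ∑ i ∈ Finset.range n, ENNReal.ofReal (δ (S^[i] x)) ≤ n := by
        calc _ ≤ ∑ i ∈ Finset.range n, (1 : ℝ≥0∞) := Finset.sum_le_sum fun i _ => by
              simpa using ENNReal.ofReal_le_ofReal (hδ1 (S^[i] x))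
          _ = n := by simp
      by_cases hb1 : x ∈ bad j
      · refine htriv.trans ?_
        refine le_trans ?_ le_add_self
        refine le_trans ?_ le_self_add
        simp [hb1]
      by_cases hb2 : S^[n] x ∈ bad j
      · refine htriv.trans ?_
        refine le_trans ?_ le_add_self
        refine le_trans ?_ le_add_self
        simp [hb2]
      refine le_trans ?_ le_self_add
      rw [← ENNReal.ofReal_sum_of_nonneg fun _ _ => hδ0 _,
        ← ENNReal.ofReal_sum_of_nonneg fun _ _ => hc0 _]
      have v1 := CodeModel.vec_bound (M := M) hbit nu' n hg hx hr
      have v2 := invL_bound (T := T) (C := C) κ n x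
      change ENNReal.ofReal (Real.exp (∑ i ∈ Finset.range n, δ (S^[i] x))) ≤ _ at v2
      rw [← hSdef] at v1
      set D := ∑ i ∈ Finset.range n, δ (S^[i] x)
      set K := ∑ i ∈ Finset.range n, M.cost C (S^[i] x)
      have b1 : η⁻¹ ≤ M.H (M.u x) := by
        by_contra h; exact hb1 (Or.inr (not_le.1 h))
      have b2 : η⁻¹ ≤ nu' (M.u (S^[n] x)) := by
        by_contra h; exact hb2 (Or.inl (not_le.1 h))
      have v3 : η⁻¹ * ENNReal.ofReal (Real.exp (-K)) * η⁻¹ * ENNReal.ofReal (Real.exp D)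
          ≤ Fn x := by
        refine mul_le_mul' ?_ v2
        refine le_trans ?_ (ENNReal.le_tsum (M.u x))
        exact mul_le_mul' (le_trans (by gcongr) v1) b1
      have v4 : ENNReal.ofReal (Real.exp (D - K)) ≤ η * η * Fn x := by
        calc ENNReal.ofReal (Real.exp (D - K))
            = ENNReal.ofReal (Real.exp (-K)) * ENNReal.ofReal (Real.exp D) := by
              rw [← ENNReal.ofReal_mul (Real.exp_pos _).le, ← Real.exp_add]
              congr 2; ring
          _ = (η * η⁻¹) * (η * η⁻¹) *
                (ENNReal.ofReal (Real.exp (-K)) * ENNReal.ofReal (Real.exp D)) := by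
              rw [ENNReal.mul_inv_cancel hη0 hηt]; ring
          _ = η * η * (η⁻¹ * ENNReal.ofReal (Real.exp (-K)) * η⁻¹ *
                ENNReal.ofReal (Real.exp D)) := by ring
          _ ≤ _ := by gcongr
      calc ENNReal.ofReal D = ENNReal.ofReal (K + (D - K)) := by congr 1; ring
        _ ≤ ENNReal.ofReal K + ENNReal.ofReal (D - K) := ENNReal.ofReal_add_le
        _ ≤ ENNReal.ofReal K + ENNReal.ofReal (Real.exp (D - K)) := by
            gcongr
            have := Real.add_one_le_exp (D - K); linarith
        _ ≤ _ := by gcongr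
    have hSn : ∀ i, MeasurePreserving (S^[i]) (m.restrict C) (m.restrict C) := fun i => hS.iterate i
    have hind : Measurable ((bad j).indicator (1 : X → ℝ≥0∞)) := measurable_one.indicator (hbadm j)
    calc (n : ℝ≥0∞) * I = ∫⁻ x in C, ∑ i ∈ Finset.range n, ENNReal.ofReal (δ (S^[i] x)) ∂m := by
          rw [lintegral_finsetSum]
          · have : ∀ i ∈ Finset.range n, ∫⁻ x in C, ENNReal.ofReal (δ (S^[i] x)) ∂m = I :=
              fun i _ => (hSn i).lintegral_comp hδm.ennreal_ofReal
            rw [Finset.sum_congr rfl this]; simp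
          · intro i _
            exact (hδm.comp (hSn i).measurable).ennreal_ofReal
      _ ≤ _ := lintegral_mono_ae hpt
      _ = ∑ i ∈ Finset.range n, ∫⁻ x in C, ENNReal.ofReal (M.cost C (S^[i] x)) ∂m
            + η * η * ∫⁻ x in C, Fn x ∂m + (n * m.restrict C (bad j) + n * m.restrict C (bad j)) := by
          have m1 : ∀ i ∈ Finset.range n, Measurable fun x => ENNReal.ofReal (M.cost C (S^[i] x)) :=
            fun i _ => (hcm.comp (hSn i).measurable).ennreal_ofReal
          have m2 : Measurable fun x => (n : ℝ≥0∞) * (bad j).indicator (1 : X → ℝ≥0∞) x :=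
            hind.const_mul _
          have m3 : Measurable fun x => (n : ℝ≥0∞) * (bad j).indicator (1 : X → ℝ≥0∞) (S^[n] x) :=
            (hind.comp (hSn n).measurable).const_mul _
          have m23 : Measurable fun x => (n : ℝ≥0∞) * (bad j).indicator (1 : X → ℝ≥0∞) x +
            (n : ℝ≥0∞) * (bad j).indicator (1 : X → ℝ≥0∞) (S^[n] x) := m2.add m3
          have m4 : Measurable fun x => η * η * Fn x := hFm.const_mul _
          have m5 : Measurable fun x => (bad j).indicator (1 : X → ℝ≥0∞) (S^[n] x) :=
            hind.comp (hSn n).measurable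
          rw [lintegral_add_right _ m23, lintegral_add_right _ m4,
            lintegral_add_right _ m3, lintegral_finsetSum _ m1, lintegral_const_mul _ hFm,
            lintegral_const_mul _ hind, lintegral_const_mul _ m5,
            (hSn n).lintegral_comp hind, lintegral_indicator_one (hbadm j)]
      _ ≤ ∑ i ∈ Finset.range n, ε + η * η * (1 * m C)
            + (n * m.restrict C (bad j) + n * m.restrict C (bad j)) := by
          gcongr with i hi
          · rw [(hSn i).lintegral_comp hcm.ennreal_ofReal]
            exact hcost
          · exact (hratio nu' n).trans (by gcongr)
      _ = _ := by
          simp only [Finset.sum_const, Finset.card_range, nsmul_eq_mul]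
          ring
  have hj : ∀ j, I ≤ ε + 2 * m.restrict C (bad j) := by
    intro j
    set K := ((j : ℝ≥0∞) + 1) * ((j : ℝ≥0∞) + 1) * m C with hK
    have hKt : K ≠ ⊤ := by
      refine ENNReal.mul_ne_top (ENNReal.mul_ne_top ?_ ?_) hfin.ne <;> simp
    have hlim : Tendsto (fun n : ℕ => (ε + 2 * m.restrict C (bad j)) + K * ((n + 1 : ℕ) : ℝ≥0∞)⁻¹)
        atTop (𝓝 ((ε + 2 * m.restrict C (bad j)) + K * 0)) := by
      refine Tendsto.const_add _ (ENNReal.Tendsto.const_mul ?_ (Or.inr hKt))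
      exact ENNReal.tendsto_inv_nat_nhds_zero.comp (tendsto_add_atTop_nat 1)
    rw [mul_zero, add_zero] at hlim
    refine ge_of_tendsto' hlim fun n => ?_
    have h := hmain j (n + 1)
    have hn0 : ((n + 1 : ℕ) : ℝ≥0∞) ≠ 0 := by simp
    have hnt : ((n + 1 : ℕ) : ℝ≥0∞) ≠ ⊤ := ENNReal.natCast_ne_top _
    calc I = ((n + 1 : ℕ) : ℝ≥0∞) * I * ((n + 1 : ℕ) : ℝ≥0∞)⁻¹ := by
          rw [mul_right_comm, ENNReal.mul_inv_cancel hn0 hnt, one_mul]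
      _ ≤ (((n + 1 : ℕ) : ℝ≥0∞) * (ε + 2 * m.restrict C (bad j)) + K) * ((n + 1 : ℕ) : ℝ≥0∞)⁻¹ := by
          gcongr
      _ = _ := by
          rw [add_mul, mul_right_comm, ENNReal.mul_inv_cancel hn0 hnt, one_mul]
  have hlim2 : Tendsto (fun j => ε + 2 * m.restrict C (bad j)) atTop (𝓝 (ε + 2 * 0)) :=
    Tendsto.const_add _ (ENNReal.Tendsto.const_mul hbadlim (Or.inr (by simp)))
  rw [mul_zero, add_zero] at hlim2
  exact ge_of_tendsto' hlim2 hj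

lemma predictable_of_models {L : Type} [Countable L] {ℓ : X → L}
    (hM : ∀ ε : ℝ≥0∞, 0 < ε → Nonempty (CodeModel T m ℓ ε))
    (hT : MeasurePreserving T m m) {C : Set X} (hC : MeasurableSet C)
    (hfin : m C < ⊤) (hrec : ∀ᵐ x ∂m, Recur T C x)
    {bit : L → Prop} (hbit : ∀ x, x ∈ C ↔ bit (ℓ x)) : Predictable T m C := by
  classical
  have : IsFiniteMeasure (m.restrict C) := ⟨by simpa using hfin⟩
  have hTm := hT.measurable
  have hφ := measurable_returnTime_s14 hTm hC
  have hS := mp_indT hT hC hfin hrec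
  have h0 : ∫⁻ x in C, ENNReal.ofReal (1 - (condDistrib (returnTime T C)
      (fun x => itin T C (indT T C x)) (m.restrict C) (itin T C (indT T C x))
        {returnTime T C x}).toReal) ∂m = 0 := by
    refine le_antisymm (le_of_forall_pos_le_add fun ε hε => ?_) zero_le
    rw [zero_add]
    obtain ⟨M⟩ := hM ε hε
    exact delta_le M hT hC hrec hbit
  set κ := condDistrib (returnTime T C) (fun x => itin T C (indT T C x)) (m.restrict C) with hκ
  have hm : Measurable fun x => ENNReal.ofReal
      (1 - (κ (itin T C (indT T C x)) {returnTime T C x}).toReal) := by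
    refine (measurable_const.sub (Measurable.ennreal_toReal ?_)).ennreal_ofReal
    exact (measurable_kernel_singleton κ).comp
      (((measurable_itin hTm hC).comp hS.measurable).prodMk hφ)
  have h1 := (lintegral_eq_zero_iff hm).1 h0
  set p : (ℕ → Prop) → ℕ → Prop := fun w n => κ w {n} = 1 ∨ ∀ j, κ w {j} ≠ 1 with hp
  have hpe : ∀ w, ∃ n, p w n := by
    intro w
    by_cases h : ∃ n, κ w {n} = 1
    · obtain ⟨n, hn⟩ := h; exact ⟨n, Or.inl hn⟩
    · push Not at h; exact ⟨0, Or.inr h⟩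
  have hpm : ∀ n, MeasurableSet {w | p w n} := by
    intro n
    have hs : ∀ n, MeasurableSet {w | κ w {n} = 1} := fun n =>
      (κ.measurable_coe (measurableSet_singleton n)) (measurableSet_singleton 1)
    have : {w | p w n} = {w | κ w {n} = 1} ∪ ⋂ j, {w | κ w {j} = 1}ᶜ := by
      ext w; simp [hp]
    rw [this]
    exact (hs n).union (MeasurableSet.iInter fun j => (hs j).compl)
  refine predictable_of_det hT hC hfin hrec (fun w => Nat.find (hpe w))
    (measurable_find hpe hpm) ?_
  filter_upwards [h1] with x hx
  set w := itin T C (indT T C x)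
  have hle : κ w {returnTime T C x} ≤ 1 := prob_le_one
  have h2 : κ w {returnTime T C x} = 1 := by
    simp only [Pi.zero_apply, ENNReal.ofReal_eq_zero, sub_nonpos] at hx
    refine le_antisymm hle ?_
    have := ENNReal.ofReal_le_ofReal hx
    rwa [ENNReal.ofReal_one, ENNReal.ofReal_toReal (measure_ne_top _ _)] at this
  have h3 := Nat.find_spec (hpe w)
  have h4 : κ w {Nat.find (hpe w)} = 1 := by
    rcases h3 with h | h
    · exact h
    · exact absurd h2 (h _)
  by_contra hne
  have h5 : κ w ({returnTime T C x} ∪ {Nat.find (hpe w)}) = 2 := by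
    rw [measure_union (by simpa using hne) (measurableSet_singleton _), h2, h4]
    exact one_add_one_eq_two
  have h6 : κ w ({returnTime T C x} ∪ {Nat.find (hpe w)}) ≤ 1 := prob_le_one
  rw [h5] at h6
  exact absurd h6 (by norm_num)

end

-- Part 7
section
variable {X : Type*} [MeasurableSpace X] {T : X → X} {m : Measure X}

/-- product of two coding models -/
noncomputable def CodeModel.prod {L1 L2 : Type} {ℓ1 : X → L1} {ℓ2 : X → L2} {e1 e2 : ℝ≥0∞}
    (M : CodeModel T m ℓ1 e1) (N : CodeModel T m ℓ2 e2) :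
    CodeModel T m (fun x => (ℓ1 x, ℓ2 x)) (e1 + e2) where
  U := M.U × N.U
  countableU := by
    have := M.countableU
    have := N.countableU
    infer_instance
  u x := (M.u x, N.u x)
  u_meas v := by
    have : (fun x => (M.u x, N.u x)) ⁻¹' {v} = M.u ⁻¹' {v.1} ∩ N.u ⁻¹' {v.2} := by
      ext x; simp [Prod.ext_iff]
    rw [this]
    exact (M.u_meas _).inter (N.u_meas _)
  next v l := (M.next v.1 l.1, N.next v.2 l.2)
  k v l := M.k v.1 l.1 * N.k v.2 l.2
  H v := M.H v.1 * N.H v.2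
  H_le v := mul_le_one' (M.H_le _) (N.H_le _)
  super v := by
    calc ∑' l : L1 × L2, M.k v.1 l.1 * N.k v.2 l.2 * (M.H (M.next v.1 l.1) * N.H (N.next v.2 l.2))
        = ∑' a, ∑' b, (M.k v.1 a * M.H (M.next v.1 a)) * (N.k v.2 b * N.H (N.next v.2 b)) := by
          rw [ENNReal.tsum_prod']
          congr 1; funext a; congr 1; funext b; ring
      _ = (∑' a, M.k v.1 a * M.H (M.next v.1 a)) * ∑' b, N.k v.2 b * N.H (N.next v.2 b) := by
          simp_rw [ENNReal.tsum_mul_left, ENNReal.tsum_mul_right]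
      _ ≤ _ := mul_le_mul' (M.super _) (N.super _)
  u_step := by
    filter_upwards [M.u_step, N.u_step] with x h1 h2
    rw [← h1, ← h2]
  H_pos := by
    filter_upwards [M.H_pos, N.H_pos] with x h1 h2
    exact ENNReal.mul_pos h1.ne' h2.ne'
  c x := M.c x + N.c x
  c_nonneg x := add_nonneg (M.c_nonneg x) (N.c_nonneg x)
  c_meas := M.c_meas.add N.c_meas
  c_k := by
    filter_upwards [M.c_k, N.c_k] with x h1 h2
    rw [neg_add, Real.exp_add, ENNReal.ofReal_mul (Real.exp_pos _).le]
    exact mul_le_mul' h1 h2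
  c_int := by
    simp_rw [fun x => ENNReal.ofReal_add (M.c_nonneg x) (N.c_nonneg x)]
    rw [lintegral_add_left M.c_meas.ennreal_ofReal]
    exact add_le_add M.c_int N.c_int

lemma prod_models {L1 L2 : Type} {ℓ1 : X → L1} {ℓ2 : X → L2}
    (h1 : ∀ ε, 0 < ε → Nonempty (CodeModel T m ℓ1 ε))
    (h2 : ∀ ε, 0 < ε → Nonempty (CodeModel T m ℓ2 ε)) (ε : ℝ≥0∞) (hε : 0 < ε) :
    Nonempty (CodeModel T m (fun x => (ℓ1 x, ℓ2 x)) ε) := by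
  obtain ⟨M⟩ := h1 (ε / 2) (ENNReal.half_pos hε.ne')
  obtain ⟨N⟩ := h2 (ε / 2) (ENNReal.half_pos hε.ne')
  have := M.prod N
  rw [ENNReal.add_halves] at this
  exact ⟨this⟩

end

-- Part 6
lemma negMulLog_bound {p : ℝ} (hp : 0 ≤ p) (j : ℕ) :
    Real.negMulLog p ≤ 2 * Real.log (1 + j) * p + 1 / ((j : ℝ) + 1) ^ 2 := by
  rcases hp.eq_or_lt with rfl | hp
  · simp only [Real.negMulLog_zero, mul_zero, zero_add]; positivity
  have hN : (0 : ℝ) < (j : ℝ) + 1 := by positivity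
  have h := Real.log_le_sub_one_of_pos (x := 1 / (p * ((j : ℝ) + 1) ^ 2)) (by positivity)
  rw [one_div, Real.log_inv, Real.log_mul hp.ne' (by positivity), Real.log_pow] at h
  push_cast at h
  have h2 := mul_le_mul_of_nonneg_left h hp.le
  have h3 : p * ((p * ((j : ℝ) + 1) ^ 2)⁻¹ - 1) = 1 / ((j : ℝ) + 1) ^ 2 - p := by
    field_simp
  rw [h3] at h2
  rw [Real.negMulLog, add_comm (1 : ℝ)]
  nlinarith

section
variable {X : Type*} [mX : MeasurableSpace X] {μ : Measure X}

/-- finite window of an itinerary -/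
def win (k : ℕ) (w : ℕ → Prop) : Fin k → Prop := fun i => w i

lemma measurable_win (k : ℕ) : Measurable (win k) :=
  measurable_pi_iff.2 fun i => measurable_pi_apply (i : ℕ)

lemma ent_small [IsFiniteMeasure μ] {Y : X → ℕ} (hY : Measurable Y) {G : X → ℕ → Prop}
    (hG : Measurable G)
    (hdet : ∀ j, ∃ D : Set (ℕ → Prop), MeasurableSet D ∧ ∀ᵐ x ∂μ, (Y x = j ↔ G x ∈ D))
    (hlogint : ∫⁻ x, ENNReal.ofReal (Real.log (1 + Y x)) ∂μ < ⊤) (ε : ℝ≥0∞) (hε : 0 < ε) :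
    ∃ (k : ℕ) (κ : Kernel (Fin k → Prop) ℕ), IsMarkovKernel κ ∧
      (∀ᵐ x ∂μ, κ (win k (G x)) {Y x} ≠ 0) ∧
      ∫⁻ x, ENNReal.ofReal (-Real.log (κ (win k (G x)) {Y x}).toReal) ∂μ ≤ ε := by
  have hF : ∀ k, Measurable (fun x => win k (G x)) := fun k => (measurable_win k).comp hG
  set κ : (k : ℕ) → Kernel (Fin k → Prop) ℕ :=
    fun k => condDistrib Y (fun x => win k (G x)) μ with hκ
  have hmar : ∀ k, IsMarkovKernel (κ k) := fun k => by rw [hκ]; infer_instance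
  have hκm : ∀ k, Measurable (fun p : (Fin k → Prop) × ℕ => κ k p.1 {p.2}) := fun k =>
    measurable_from_prod_countable_left fun r => (κ k).measurable_coe (measurableSet_singleton r)
  have hκj : ∀ k j, Measurable (fun x => κ k (win k (G x)) {j}) := fun k j =>
    ((κ k).measurable_coe (measurableSet_singleton j)).comp (hF k)
  have hp1 : ∀ k w j, κ k w {j} ≤ 1 := fun k w j => prob_le_one
  have hpt : ∀ k w j, κ k w {j} ≠ ⊤ := fun k w j => measure_ne_top _ _
  -- positivity
  have hpos : ∀ k, ∀ᵐ x ∂μ, κ k (win k (G x)) {Y x} ≠ 0 := by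
    intro k
    set g : (Fin k → Prop) × ℕ → ℝ≥0∞ :=
      {p : (Fin k → Prop) × ℕ | κ k p.1 {p.2} = 0}.indicator 1 with hg
    have hgs : MeasurableSet {p : (Fin k → Prop) × ℕ | κ k p.1 {p.2} = 0} :=
      hκm k (measurableSet_singleton 0)
    have hgm : Measurable g := measurable_one.indicator hgs
    have h := lintegral_condDistrib (m := μ) hY (hF k) hgm
    have h0 : ∀ x, ∑' r, g (win k (G x), r) * κ k (win k (G x)) {r} = 0 := by
      intro x
      rw [ENNReal.tsum_eq_zero]
      intro r
      by_cases hr : κ k (win k (G x)) {r} = 0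
      · rw [hr, mul_zero]
      · rw [hg, Set.indicator_of_notMem, zero_mul]; exact hr
    have h1 : ∫⁻ x, g (win k (G x), Y x) ∂μ = 0 := by
      rw [h]
      simp only [hκ] at h0
      simp [h0]
    have h2 := (lintegral_eq_zero_iff (hgm.comp ((hF k).prodMk hY))).1 h1
    filter_upwards [h2] with x hx hx0
    have : g (win k (G x), Y x) = 1 := by
      rw [hg, Set.indicator_of_mem]
      · rfl
      · exact hx0
    simp [this] at hx
  -- entropy as a sum
  set E : ℕ → ℕ → ℝ≥0∞ := fun k j =>
    ∫⁻ x, ENNReal.ofReal (Real.negMulLog (κ k (win k (G x)) {j}).toReal) ∂μ with hE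
  have hsum : ∀ k, ∫⁻ x, ENNReal.ofReal (-Real.log (κ k (win k (G x)) {Y x}).toReal) ∂μ
      = ∑' j, E k j := by
    intro k
    have hgm : Measurable (fun p : (Fin k → Prop) × ℕ =>
        ENNReal.ofReal (-Real.log (κ k p.1 {p.2}).toReal)) :=
      ((Real.measurable_log.comp (hκm k).ennreal_toReal).neg).ennreal_ofReal
    have h := lintegral_condDistrib (m := μ) hY (hF k) hgm
    rw [h]
    change ∫⁻ x, ∑' r, ENNReal.ofReal (-Real.log (κ k (win k (G x)) {r}).toReal)
      * κ k (win k (G x)) {r} ∂μ = _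
    have h2 : ∀ x r, ENNReal.ofReal (-Real.log (κ k (win k (G x)) {r}).toReal)
      * κ k (win k (G x)) {r}
        = ENNReal.ofReal (Real.negMulLog (κ k (win k (G x)) {r}).toReal) := by
      intro x r
      nth_rewrite 2 [← ENNReal.ofReal_toReal (hpt k (win k (G x)) r)]
      rw [← ENNReal.ofReal_mul']
      · congr 1; rw [Real.negMulLog]; ring
      · exact ENNReal.toReal_nonneg
    simp_rw [h2]
    rw [lintegral_tsum]
    intro j
    exact (Real.continuous_negMulLog.measurable.comp
      (hκj k j).ennreal_toReal).ennreal_ofReal.aemeasurable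
  -- domination
  have hmass : ∀ k j, ∫⁻ x, κ k (win k (G x)) {j} ∂μ = μ (Y ⁻¹' {j}) := by
    intro k j
    have hgm : Measurable (fun p : (Fin k → Prop) × ℕ => ({j} : Set ℕ).indicator (1 : ℕ → ℝ≥0∞) p.2) :=
      (measurable_one.indicator (measurableSet_singleton j)).comp measurable_snd
    have h := lintegral_condDistrib (m := μ) hY (hF k) hgm
    have h1 : ∫⁻ x, ({j} : Set ℕ).indicator (1 : ℕ → ℝ≥0∞) (Y x) ∂μ = μ (Y ⁻¹' {j}) := by
      rw [← lintegral_indicator_one (hY (measurableSet_singleton j))]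
      rfl
    rw [← h1]
    refine Eq.trans ?_ h.symm
    refine lintegral_congr fun x => ?_
    rw [tsum_eq_single j]
    · simp [hκ]
    · intro r hr; simp [hr]
  set b : ℕ → ℝ≥0∞ := fun j => ENNReal.ofReal (2 * Real.log (1 + j)) * μ (Y ⁻¹' {j}) +
    ENNReal.ofReal (1 / ((j : ℝ) + 1) ^ 2) * μ Set.univ with hb
  have hEb : ∀ k j, E k j ≤ b j := by
    intro k j
    calc E k j ≤ ∫⁻ x, (ENNReal.ofReal (2 * Real.log (1 + j)) * κ k (win k (G x)) {j}
          + ENNReal.ofReal (1 / ((j : ℝ) + 1) ^ 2)) ∂μ := by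
          refine lintegral_mono fun x => ?_
          refine (ENNReal.ofReal_le_ofReal (negMulLog_bound ENNReal.toReal_nonneg j)).trans ?_
          refine ENNReal.ofReal_add_le.trans ?_
          rw [ENNReal.ofReal_mul', ENNReal.ofReal_toReal (hpt k _ j)]
          exact ENNReal.toReal_nonneg
      _ = b j := by
          rw [lintegral_add_right _ measurable_const, lintegral_const_mul _ (hκj k j), hmass,
            lintegral_const]
  have hbsum : ∑' j, b j ≠ ⊤ := by
    rw [hb, ENNReal.tsum_add, ENNReal.tsum_mul_right]
    refine ENNReal.add_ne_top.2 ⟨?_, ENNReal.mul_ne_top ?_ (measure_ne_top _ _)⟩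
    · have h1 : ∫⁻ x, ENNReal.ofReal (2 * Real.log (1 + Y x)) ∂μ
          = ∑' j : ℕ, ENNReal.ofReal (2 * Real.log (1 + j)) * μ (Y ⁻¹' {j}) := by
        rw [← lintegral_map (μ := μ) (g := Y)
          (f := fun j : ℕ => ENNReal.ofReal (2 * Real.log (1 + j))) (by fun_prop) hY,
          lintegral_countable']
        congr 1; funext j
        rw [Measure.map_apply hY (measurableSet_singleton j)]
      rw [← h1]
      simp_rw [ENNReal.ofReal_mul (zero_le_two (α := ℝ))]
      rw [lintegral_const_mul' _ _ ENNReal.ofReal_ne_top]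
      exact ENNReal.mul_ne_top ENNReal.ofReal_ne_top hlogint.ne
    · have hs : Summable fun j : ℕ => 1 / ((j : ℝ) + 1) ^ 2 := by
        have := (summable_nat_add_iff 1).2 (Real.summable_one_div_nat_pow.2 one_lt_two)
        simpa using this
      exact hs.tsum_ofReal_ne_top
  -- Levy
  have hElim : ∀ j, Tendsto (fun k => E k j) atTop (𝓝 0) := by
    intro j
    obtain ⟨D, hD, hDae⟩ := hdet j
    let ℱ : Filtration ℕ mX :=
      { seq := fun k => MeasurableSpace.comap (fun x => win k (G x)) inferInstance
        mono' := by
          intro a c hac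
          refine measurable_iff_comap_le.1 ?_
          have hr : Measurable (fun (w : Fin c → Prop) (i : Fin a) => w ⟨i, i.2.trans_le hac⟩) :=
            measurable_pi_iff.2 fun i => measurable_pi_apply _
          exact hr.comp (comap_measurable _)
        le' := fun k => (hF k).comap_le }
    have hGF : Measurable[⨆ k, ℱ k] G := by
      refine (@measurable_pi_iff _ _ _ (⨆ k, ℱ k) _ G).2 fun i => ?_
      have h1 : Measurable[ℱ (i + 1)] (fun x => G x i) :=
        (measurable_pi_apply (⟨i, Nat.lt_succ_self i⟩ : Fin (i + 1))).comp
          (comap_measurable (fun x => win (i + 1) (G x)))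
      exact h1.mono (le_iSup (fun k => ℱ k) (i + 1)) le_rfl
    have hind : (Y ⁻¹' {j}).indicator (fun _ => (1 : ℝ)) =ᵐ[μ]
        (G ⁻¹' D).indicator (fun _ => (1 : ℝ)) := by
      filter_upwards [hDae] with x hx
      by_cases h : Y x = j
      · rw [Set.indicator_of_mem (by exact h), Set.indicator_of_mem (by exact hx.1 h)]
      · rw [Set.indicator_of_notMem (by exact h),
          Set.indicator_of_notMem (by exact fun h' => h (hx.2 h'))]
    have hle : (⨆ k, ℱ k) ≤ mX := iSup_le fun k => ℱ.le k
    have hlimc : μ[(Y ⁻¹' {j}).indicator (fun _ => (1 : ℝ)) | ⨆ k, ℱ k] =ᵐ[μ]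
        (Y ⁻¹' {j}).indicator (fun _ => (1 : ℝ)) := by
      refine condExp_of_aestronglyMeasurable' hle ?_ ?_
      · refine ⟨_, ?_, hind⟩
        exact (stronglyMeasurable_const).indicator (hGF hD)
      · exact (integrable_const _).indicator (hY (measurableSet_singleton j))
    have hlev := tendsto_ae_condExp (μ := μ) (ℱ := ℱ) ((Y ⁻¹' {j}).indicator (fun _ => (1 : ℝ)))
    have hall : ∀ᵐ x ∂μ, ∀ k, (κ k (win k (G x))).real {j} =
        (μ[(Y ⁻¹' {j}).indicator (fun _ => (1 : ℝ)) | ℱ k]) x := by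
      rw [ae_all_iff]
      intro k
      exact condDistrib_ae_eq_condExp (hF k) hY (measurableSet_singleton j)
    have hptw : ∀ᵐ x ∂μ, Tendsto
        (fun k => ENNReal.ofReal (Real.negMulLog (κ k (win k (G x)) {j}).toReal)) atTop (𝓝 0) := by
      filter_upwards [hlev, hall, hlimc] with x h1 h2 h3
      rw [h3] at h1
      have h4 : Tendsto (fun k => (κ k (win k (G x)) {j}).toReal) atTop
          (𝓝 ((Y ⁻¹' {j}).indicator (fun _ => (1 : ℝ)) x)) := by
        refine h1.congr fun k => ?_
        rw [← h2 k]; rfl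
      have h5 := ENNReal.tendsto_ofReal ((Real.continuous_negMulLog.tendsto _).comp h4)
      have h6 : Real.negMulLog ((Y ⁻¹' {j}).indicator (fun _ => (1 : ℝ)) x) = 0 := by
        by_cases h : x ∈ Y ⁻¹' {j}
        · rw [Set.indicator_of_mem h, Real.negMulLog_one]
        · rw [Set.indicator_of_notMem h, Real.negMulLog_zero]
      rw [h6, ENNReal.ofReal_zero] at h5
      exact h5
    have := tendsto_lintegral_of_dominated_convergence (μ := μ) (f := fun _ => 0)
      (fun _ => ENNReal.ofReal (2 * Real.log (1 + j) * 1 + 1 / ((j : ℝ) + 1) ^ 2))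
      (F := fun k x => ENNReal.ofReal (Real.negMulLog (κ k (win k (G x)) {j}).toReal))
      (fun k => (Real.continuous_negMulLog.measurable.comp
        (hκj k j).ennreal_toReal).ennreal_ofReal)
      (fun k => Eventually.of_forall fun x => ?_) ?_ hptw
    · simpa using this
    · refine ENNReal.ofReal_le_ofReal ((negMulLog_bound ENNReal.toReal_nonneg j).trans ?_)
      have hl : 0 ≤ Real.log (1 + j) := Real.log_nonneg (by simp)
      have : (κ k (win k (G x)) {j}).toReal ≤ 1 :=
        ENNReal.toReal_le_of_le_ofReal zero_le_one (by simpa using hp1 k _ j)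
      gcongr
    · rw [lintegral_const]
      exact ENNReal.mul_ne_top ENNReal.ofReal_ne_top (measure_ne_top _ _)
  have hlim : Tendsto (fun k => ∑' j, E k j) atTop (𝓝 0) := by
    have := tendsto_lintegral_of_dominated_convergence (μ := (Measure.count : Measure ℕ))
      (f := fun _ => 0) b (F := E) (fun k => measurable_from_top)
      (fun k => Eventually.of_forall fun j => hEb k j)
      (by rw [lintegral_count]; exact hbsum) (Eventually.of_forall hElim)
    simpa [lintegral_count] using this
  obtain ⟨k, hk⟩ := (hlim.eventually_le_const hε).exists
  exact ⟨k, κ k, hmar k, hpos k, (hsum k).trans_le hk⟩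

end

-- Part 8
section
variable {X : Type*} [mX : MeasurableSpace X] {T : X → X} {m : Measure X}

open Classical in
/-- first hitting time (including time zero) -/
noncomputable def hit (T : X → X) (A : Set X) (y : X) : ℕ := if y ∈ A then 0 else returnTime T A y

lemma hit_succ {A : Set X} {x : X} (hr : Recur T A x) : hit T A (T x) + 1 = returnTime T A x := by
  have hr1 : Recur T A (T x) := Recur.step.2 hr
  unfold hit
  split_ifs with h
  · have h1 := hr.one_le
    have h2 := returnTime_le (T := T) (C := A) (x := x) (n := 1) le_rfl (by simpa using h)
    omega
  · have h1 := hr.one_le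
    have h2 := returnTime_le (T := T) (C := A) (x := x) (n := returnTime T A (T x) + 1) (by omega)
      (by rw [Function.iterate_succ_apply]; exact hr1.indT_mem)
    have h3 : returnTime T A x ≠ 1 := by
      intro h3
      have := hr.indT_mem
      rw [indT, h3] at this
      exact h (by simpa using this)
    have h4 := returnTime_le (T := T) (C := A) (x := T x) (n := returnTime T A x - 1) (by omega)
      (by
        rw [← Function.iterate_succ_apply, Nat.succ_eq_add_one, Nat.sub_add_cancel h1]
        exact hr.indT_mem)
    omega

lemma measurable_hit (hT : Measurable T) {A : Set X} (hA : MeasurableSet A) :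
    Measurable (hit T A) := by
  classical
  exact Measurable.ite hA measurable_const (measurable_returnTime_s14 hT hA)

/-- mixture weights -/
noncomputable def mixw (s : ℝ) (q : ℕ → ℝ≥0∞) (r : ℕ) : ℝ≥0∞ :=
  ENNReal.ofReal (Real.exp (-s)) * q r + ENNReal.ofReal (1 - Real.exp (-s)) * 2⁻¹ ^ (r + 1)

lemma mixw_sum {s : ℝ} (hs : 0 < s) {q : ℕ → ℝ≥0∞} (hq : ∑' r, q r ≤ 1) :
    ∑' r, mixw s q r ≤ 1 := by
  have he : Real.exp (-s) ≤ 1 := Real.exp_le_one_iff.2 (by linarith)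
  unfold mixw
  rw [ENNReal.tsum_add, ENNReal.tsum_mul_left, ENNReal.tsum_mul_left]
  have h2 : ∑' r : ℕ, (2⁻¹ : ℝ≥0∞) ^ (r + 1) = 1 := by
    rw [ENNReal.tsum_geometric_add_one, ENNReal.one_sub_inv_two, inv_inv,
      ENNReal.inv_mul_cancel two_ne_zero ENNReal.ofNat_ne_top]
  rw [h2]
  calc _ ≤ ENNReal.ofReal (Real.exp (-s)) * 1 + ENNReal.ofReal (1 - Real.exp (-s)) * 1 := by gcongr
    _ = 1 := by
      rw [mul_one, mul_one, ← ENNReal.ofReal_add (Real.exp_pos _).le (by linarith)]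
      simp

lemma mixw_pos {s : ℝ} (hs : 0 < s) (q : ℕ → ℝ≥0∞) (r : ℕ) : 0 < mixw s q r := by
  have he : Real.exp (-s) < 1 := by
    have := Real.exp_lt_exp.2 (neg_lt_zero.2 hs)
    rwa [Real.exp_zero] at this
  refine lt_of_lt_of_le ?_ le_add_self
  refine ENNReal.mul_pos ?_ ?_
  · simpa using he
  · simp

open Classical in
lemma models_of_FPi {A : Set X} (hA : MemFPi T m A) (hT : MeasurePreserving T m m)
    (hrec : ∀ᵐ x ∂m, Recur T A x) (ε : ℝ≥0∞) (hε : 0 < ε) :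
    Nonempty (CodeModel T m (fun x => decide (x ∈ A)) ε) := by
  obtain ⟨hF, hP⟩ := hA
  have hlog := lint_log_one_add hF
  obtain ⟨hAm, hA0, hAfin, -⟩ := hF
  have : IsFiniteMeasure (m.restrict A) := ⟨by simpa using hAfin⟩
  have hTm := hT.measurable
  have hφ := measurable_returnTime_s14 hTm hAm
  have hG : Measurable (fun x => itin T A (indT T A x)) :=
    (measurable_itin hTm hAm).comp (measurable_indT hTm hAm)
  obtain ⟨k, κ, hκ, hpos, hent⟩ := ent_small (μ := m.restrict A) hφ hG
    (fun j => predictable_future hT hrec hAm hP j) hlog (ε / 2) (ENNReal.half_pos hε.ne')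
  obtain ⟨s, hs, hsA⟩ := ENNReal.exists_nnreal_pos_mul_lt hAfin.ne (ENNReal.half_pos hε.ne').ne'
  have hs' : (0 : ℝ) < s := hs
  set c0 : X → ℝ := fun x =>
    s + -Real.log (κ (win k (itin T A (indT T A x))) {returnTime T A x}).toReal with hc0
  have hκm : Measurable (fun p : (Fin k → Prop) × ℕ => κ p.1 {p.2}) :=
    measurable_from_prod_countable_left fun r => κ.measurable_coe (measurableSet_singleton r)
  have hlm : Measurable fun x =>
      -Real.log (κ (win k (itin T A (indT T A x))) {returnTime T A x}).toReal :=
    (Real.measurable_log.comp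
      (hκm.comp (((measurable_win k).comp hG).prodMk hφ)).ennreal_toReal).neg
  have hc0m : Measurable c0 := measurable_const.add hlm
  have hc00 : ∀ x, 0 ≤ -Real.log (κ (win k (itin T A (indT T A x))) {returnTime T A x}).toReal := by
    intro x
    rw [neg_nonneg]
    exact Real.log_nonpos ENNReal.toReal_nonneg
      (ENNReal.toReal_le_of_le_ofReal zero_le_one (by simpa using prob_le_one))
  set a : (Fin k → Prop) → ℕ → ℝ≥0∞ := fun w => mixw s (fun r => κ w {r}) with ha
  have hasum : ∀ w, ∑' r, a w r ≤ 1 := by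
    intro w
    refine mixw_sum hs' ?_
    have := (measure_iUnion (μ := κ w) (f := fun r : ℕ => {r})
      (fun i j hij => by simpa using hij) (fun r => measurableSet_singleton r)).symm
    rw [this]
    exact prob_le_one
  have hH1 : ∀ (w : Fin k → Prop) (j : ℕ), ∑' r, a w (r + j + 1) ≤ 1 := by
    intro w j
    refine le_trans ?_ (hasum w)
    exact ENNReal.tsum_comp_le_tsum_of_injective
      (f := fun r : ℕ => r + j + 1) (fun x y h => by simpa using h) (a w)
  have hu2 : Measurable fun y => win k (itin T A (T^[hit T A y] y)) := by
    have h : Measurable (fun p : X × ℕ => T^[p.2] p.1) :=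
      measurable_from_prod_countable_left fun n => hTm.iterate n
    exact (measurable_win k).comp ((measurable_itin hTm hAm).comp
      (h.comp (measurable_id.prodMk (measurable_hit hTm hAm))))
  have huT : ∀ x, Recur T A x → T^[hit T A (T x)] (T x) = indT T A x := by
    intro x hr
    rw [indT, ← hit_succ hr, Function.iterate_succ_apply]
  refine ⟨{
    U := ℕ × (Fin k → Prop)
    countableU := by
      have : Countable (Fin k → Prop) := inferInstance
      infer_instance
    u := fun y => (hit T A y, win k (itin T A (T^[hit T A y] y)))
    u_meas := fun v => ((measurable_hit hTm hAm).prodMk hu2) (measurableSet_singleton v)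
    next := fun v l => if l = true then
        (0, fun i => (i : ℕ) = 0 ∨ ∃ hle : v.1 + 1 ≤ (i : ℕ), v.2 ⟨i - (v.1 + 1), by omega⟩)
      else (v.1 + 1, v.2)
    k := fun v l => if l = true then a v.2 (v.1 + 1) else 1
    H := fun v => ∑' r, a v.2 (r + v.1 + 1)
    H_le := fun v => hH1 v.2 v.1
    super := ?_
    u_step := ?_
    H_pos := ?_
    c := A.indicator c0
    c_nonneg := ?_
    c_meas := hc0m.indicator hAm
    c_k := ?_
    c_int := ?_ }⟩
  · rintro ⟨j, w⟩
    rw [tsum_bool]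
    simp only [Bool.false_eq_true, if_false, if_true, one_mul]
    rw [tsum_eq_zero_add' (f := fun r => a w (r + j + 1)) ENNReal.summable, add_comm, zero_add]
    refine add_le_add ?_ (le_of_eq ?_)
    · calc _ ≤ a w (j + 1) * 1 := by gcongr; exact hH1 _ 0
        _ = _ := mul_one _
    · congr 1; funext r; congr 1; omega
  · filter_upwards [hrec] with x hr
    have hs1 := hit_succ hr
    by_cases hx : x ∈ A
    · have h0 : hit T A x = 0 := by simp [hit, hx]
      simp only [h0, hx, decide_true, if_true]
      refine Prod.ext rfl ?_
      funext i
      simp only [huT x hr, hs1, win, itin, Function.iterate_zero, id]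
      refine propext ⟨fun h => ?_, ?_⟩
      · by_cases hi : (i : ℕ) = 0
        · exact Or.inl hi
        · have hle := returnTime_le (by omega) h
          refine Or.inr ⟨hle, ?_⟩
          rw [indT, ← Function.iterate_add_apply, Nat.sub_add_cancel hle]
          exact h
      · rintro (h | ⟨hle, h⟩)
        · rw [h]; exact hx
        · rwa [indT, ← Function.iterate_add_apply, Nat.sub_add_cancel hle] at h
    · have h0 : hit T A x = returnTime T A x := by simp [hit, hx]
      simp only [h0, hx, decide_false, Bool.false_eq_true, if_false]
      rw [huT x hr, hs1]
      rfl
  · refine Eventually.of_forall fun x => ?_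
    exact lt_of_lt_of_le (mixw_pos hs' _ _) (ENNReal.le_tsum 0)
  · intro x
    exact Set.indicator_nonneg (fun y _ => add_nonneg hs'.le (hc00 y)) x
  · rw [ae_restrict_iff' hAm] at hpos
    filter_upwards [hrec, hpos] with x hr hp
    by_cases hx : x ∈ A
    · simp only [hx, decide_true, if_true, Set.indicator_of_mem]
      rw [huT x hr, hit_succ hr]
      simp only [ha, mixw, hc0]
      refine le_trans (le_of_eq ?_) le_self_add
      have hp0 := hp hx
      have hpt : κ (win k (itin T A (indT T A x))) {returnTime T A x} ≠ ⊤ := measure_ne_top _ _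
      rw [neg_add, neg_neg, Real.exp_add, ENNReal.ofReal_mul (Real.exp_pos _).le,
        Real.exp_log (ENNReal.toReal_pos hp0 hpt), ENNReal.ofReal_toReal hpt]
    · simp [hx]
  · have h1 : ∀ x, ENNReal.ofReal (A.indicator c0 x)
        = A.indicator (fun x => ENNReal.ofReal (c0 x)) x := by
      intro x
      by_cases hx : x ∈ A <;> simp [hx]
    simp_rw [h1]
    rw [lintegral_indicator hAm]
    calc ∫⁻ x in A, ENNReal.ofReal (c0 x) ∂m = ∫⁻ x in A, ((s : ℝ≥0∞) + ENNReal.ofReal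
          (-Real.log (κ (win k (itin T A (indT T A x))) {returnTime T A x}).toReal)) ∂m := by
          refine lintegral_congr fun x => ?_
          rw [hc0, ENNReal.ofReal_add hs'.le (hc00 x), ENNReal.ofReal_coe_nnreal]
      _ ≤ ε / 2 + ε / 2 := by
          rw [lintegral_add_left measurable_const]
          refine add_le_add ?_ hent
          simpa using hsA.le
      _ = ε := ENNReal.add_halves ε

end

end Helpers

/-- part of Theorem 5.1(i): for an LLB, conservative, ergodic, measure
preserving transformation, `𝓕_Π` is a ring of sets: for `A, B ∈ 𝓕_Π` the union `A ∪ B`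
is in `𝓕_Π`, and each of `A ∩ B`, `A \ B`, `B \ A` of positive measure is in `𝓕_Π`. -/
theorem stmt_14 {X : Type*} [MeasurableSpace X] (m : Measure X) [SigmaFinite m]
    (T : X → X) (hc : Conservative T m) (he : Ergodic T m)
    (hLLB : ∃ A : Set X, MemFlog T m A)
    (A B : Set X) (hA : MemFPi T m A) (hB : MemFPi T m B) :
    MemFPi T m (A ∪ B) ∧
    (0 < m (A ∩ B) → MemFPi T m (A ∩ B)) ∧
    (0 < m (A \ B) → MemFPi T m (A \ B)) ∧
    (0 < m (B \ A) → MemFPi T m (B \ A)) := by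
  classical
  have hT := he.toMeasurePreserving
  have hAm : MeasurableSet A := hA.1.1
  have hBm : MeasurableSet B := hB.1.1
  have hrA := ae_recur hc he hAm hA.1.2.1
  have hrB := ae_recur hc he hBm hB.1.2.1
  have hM := prod_models (models_of_FPi hA hT hrA) (models_of_FPi hB hT hrB)
  have key : ∀ C : Set X, MemFlog T m C → ∀ bit : Bool × Bool → Prop,
      (∀ x, x ∈ C ↔ bit (decide (x ∈ A), decide (x ∈ B))) → MemFPi T m C := by
    intro C hC bit hbit
    exact ⟨hC, predictable_of_models hM hT hC.1 hC.2.2.1 (ae_recur hc he hC.1 hC.2.1) hbit⟩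
  refine ⟨?_, fun h => ?_, fun h => ?_, fun h => ?_⟩
  · refine key _ (flog_union hT hA.1 hB.1 hrA hrB) (fun l => l.1 = true ∨ l.2 = true) fun x => ?_
    simp
  · refine key _ (flog_subset hT hA.1 (hAm.inter hBm) Set.inter_subset_left h
      (ae_recur hc he (hAm.inter hBm) h)) (fun l => l.1 = true ∧ l.2 = true) fun x => ?_
    simp
  · refine key _ (flog_subset hT hA.1 (hAm.diff hBm) Set.sdiff_subset h
      (ae_recur hc he (hAm.diff hBm) h)) (fun l => l.1 = true ∧ ¬ l.2 = true) fun x => ?_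
    simp
  · refine key _ (flog_subset hT hB.1 (hBm.diff hAm) Set.sdiff_subset h
      (ae_recur hc he (hBm.diff hAm) h)) (fun l => l.2 = true ∧ ¬ l.1 = true) fun x => ?_
    simp
end

section
/- Let R : 𝕋 → 𝕋 be a rotation of the circle 𝕋 = ℝ/ℤ and let P be a finite partition of 𝕋 into d arcs (intervals). Then for every n ≥ 1, the join ⋁_{k=0}^{n-1} R^{-k}P has at most d·n nonempty atoms; that is, the number of n-tuples (a_0, ..., a_{n-1}) ∈ P^n with ⋂_{k=0}^{n-1} R^{-k}a_k ≠ ∅ is at most d·n. -/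
/-- let `R` be a rotation of the circle `𝕋 = ℝ/ℤ` and let `P` be a finite
partition of `𝕋` into `d` arcs (images of half-open real intervals). Then for every
`n ≥ 1` the join `⋁_{k=0}^{n-1} R^{-k} P` has at most `d·n` nonempty atoms: the number of
tuples `(a₀, …, a_{n-1}) ∈ Pⁿ` with `⋂_{k<n} R^{-k} a_k ≠ ∅` is at most `d·n`. -/
theorem stmt_18 (α : AddCircle (1 : ℝ)) (d : ℕ)
    (P : Fin d → Set (AddCircle (1 : ℝ)))
    (hdisj : ∀ i j : Fin d, i ≠ j → Disjoint (P i) (P j))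
    (hcover : (⋃ i, P i) = Set.univ)
    (harc : ∀ i : Fin d, ∃ a b : ℝ,
      P i = (fun r : ℝ => (r : AddCircle (1 : ℝ))) '' Set.Ico a b)
    (n : ℕ) (hn : 1 ≤ n) :
    Set.ncard {c : Fin n → Fin d |
        (⋂ k : Fin n, (fun x : AddCircle (1 : ℝ) => x + α)^[(k : ℕ)] ⁻¹' P (c k)).Nonempty}
      ≤ d * n := by
  classical
  have hc : ∀ x : AddCircle (1 : ℝ), ∃ i, x ∈ P i := by
    intro x
    have : x ∈ ⋃ i, P i := by rw [hcover]; trivial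
    simpa using this
  choose f hf using hc
  have huniq : ∀ x i, x ∈ P i → f x = i := by
    intro x i hx
    by_contra hne
    exact Set.disjoint_left.mp (hdisj _ _ hne) (hf x) hx
  choose a b hab using harc
  have hit : ∀ (k : ℕ) (x : AddCircle (1 : ℝ)),
      (fun x : AddCircle (1 : ℝ) => x + α)^[k] x = x + k • α := by
    intro k x
    simp
  let g : Fin d × Fin n → (Fin n → Fin d) := fun p j =>
    f (((a p.1 : ℝ) : AddCircle (1 : ℝ)) - (p.2 : ℕ) • α + (j : ℕ) • α)
  have hsub : {c : Fin n → Fin d |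
        (⋂ k : Fin n, (fun x : AddCircle (1 : ℝ) => x + α)^[(k : ℕ)] ⁻¹' P (c k)).Nonempty}
      ⊆ Set.range g := by
    rintro c ⟨x, hx⟩
    have hx' : ∀ k : Fin n, ∃ r : ℝ, r ∈ Set.Ico (a (c k)) (b (c k)) ∧
        (r : AddCircle (1 : ℝ)) = x + (k : ℕ) • α := by
      intro k
      have h := Set.mem_iInter.mp hx k
      rw [Set.mem_preimage, hit, hab] at h
      exact h
    choose r hr hrx using hx'
    haveI : Nonempty (Fin n) := ⟨⟨0, hn⟩⟩
    obtain ⟨k, hk⟩ := Finite.exists_min (fun k => r k - a (c k))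
    refine ⟨(c k, k), ?_⟩
    funext j
    apply huniq
    rw [hab]
    refine ⟨r j - (r k - a (c k)), ⟨?_, ?_⟩, ?_⟩
    · have := hk j
      linarith
    · have h1 := (hr k).1
      have h2 := (hr j).2
      linarith
    · simp only [AddCircle.coe_sub, hrx]
      abel
  calc _ ≤ (Set.range g).ncard := Set.ncard_le_ncard hsub (Set.toFinite _)
    _ ≤ Nat.card (Fin d × Fin n) := by
      rw [← Set.image_univ, ← Set.ncard_univ]
      exact Set.ncard_image_le (Set.toFinite _)
    _ = d * n := by simp
end

section
/- Boole's transformation T : ℝ → ℝ, Tx = x − 1/x (defined arbitrarily at 0), preserves Lebesgue measure: the pushforward of Lebesgue measure on ℝ under T equals Lebesgue measure on ℝ. -/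
open MeasureTheory

lemma boole_roots (a : ℝ) : ∃ p n : ℝ, 0 < p ∧ n < 0 ∧ p + n = a ∧ p * n = -1 := by
  have h0 : (0 : ℝ) ≤ a ^ 2 + 4 := by positivity
  have h := Real.sq_sqrt h0
  have hs := Real.sqrt_nonneg (a ^ 2 + 4)
  refine ⟨(a + √(a ^ 2 + 4)) / 2, (a - √(a ^ 2 + 4)) / 2, ?_, ?_, by ring, by nlinarith⟩
  · have : -a < √(a ^ 2 + 4) := Real.lt_sqrt_of_sq_lt (by nlinarith)
    linarith
  · have : a < √(a ^ 2 + 4) := Real.lt_sqrt_of_sq_lt (by nlinarith)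
    linarith

lemma boole_factor {p n x : ℝ} (hx : x ≠ 0) (h : p * n = -1) :
    x - 1 / x - (p + n) = (x - p) * (x - n) / x := by
  field_simp
  linear_combination -h

lemma boole_pos {p n x : ℝ} (hx : 0 < x) (hn : n < 0) (h : p * n = -1) :
    (p + n < x - 1 / x ↔ p < x) ∧ (x - 1 / x < p + n ↔ x < p) := by
  have e := boole_factor hx.ne' h
  have e2 : x - 1 / x - (p + n) = (x - p) * ((x - n) / x) := by rw [e]; ring
  have hc : 0 < (x - n) / x := div_pos (by linarith) hx
  constructor
  · rw [← sub_pos, e2, mul_pos_iff_of_pos_right hc, sub_pos]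
  · have e3 : p + n - (x - 1 / x) = (p - x) * ((x - n) / x) := by
      linear_combination -e2
    rw [← sub_pos, e3, mul_pos_iff_of_pos_right hc, sub_pos]

lemma boole_neg {p n x : ℝ} (hx : x < 0) (hp : 0 < p) (h : p * n = -1) :
    (p + n < x - 1 / x ↔ n < x) ∧ (x - 1 / x < p + n ↔ x < n) := by
  have e := boole_factor hx.ne h
  have e2 : x - 1 / x - (p + n) = (x - n) * ((x - p) / x) := by rw [e]; ring
  have hc : 0 < (x - p) / x := div_pos_of_neg_of_neg (by linarith) hx
  constructor
  · rw [← sub_pos, e2, mul_pos_iff_of_pos_right hc, sub_pos]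
  · have e3 : p + n - (x - 1 / x) = (n - x) * ((x - p) / x) := by
      linear_combination -e2
    rw [← sub_pos, e3, mul_pos_iff_of_pos_right hc, sub_pos]

/-- Boole's transformation `T x = x - 1/x` (with `T 0 = 0` by the Lean
convention `1/0 = 0`; the value at the single point `0` is irrelevant) preserves Lebesgue
measure: the pushforward of Lebesgue measure under `T` is Lebesgue measure. -/
theorem stmt_19 :
    Measure.map (fun x : ℝ => x - 1 / x) volume = volume := by
  symm
  apply Real.measure_ext_Ioo_rat
  intro a' b'
  generalize (a' : ℝ) = a
  generalize (b' : ℝ) = b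
  have hm : Measurable (fun x : ℝ => x - 1 / x) := by fun_prop
  rw [Measure.map_apply hm measurableSet_Ioo]
  rcases le_or_gt b a with hab | hab
  · simp [Set.Ioo_eq_empty_of_le hab]
  obtain ⟨p, n, hp, hn, rfl, hpn⟩ := boole_roots a
  obtain ⟨q, m, hq, hm', rfl, hqm⟩ := boole_roots b
  have key : ((fun x : ℝ => x - 1 / x) ⁻¹' Set.Ioo (p + n) (q + m) : Set ℝ)
      =ᵐ[volume] (Set.Ioo p q ∪ Set.Ioo n m : Set ℝ) := by
    have h0 : ∀ᵐ x : ℝ ∂volume, x ≠ 0 := by simp [ae_iff]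
    filter_upwards [h0] with x hx
    apply propext
    change (p + n < x - 1 / x ∧ x - 1 / x < q + m) ↔ ((p < x ∧ x < q) ∨ (n < x ∧ x < m))
    rcases lt_or_gt_of_ne hx with h | h
    · rw [(boole_neg h hp hpn).1, (boole_neg h hq hqm).2]
      constructor
      · exact Or.inr
      · rintro (⟨h1, _⟩ | h1)
        · linarith
        · exact h1
    · rw [(boole_pos h hn hpn).1, (boole_pos h hm' hqm).2]
      constructor
      · exact Or.inl
      · rintro (h1 | ⟨_, h1⟩)
        · exact h1
        · linarith
  have hpq : p ≤ q := by
    by_contra hc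
    push Not at hc
    have : m ≤ n := by nlinarith
    linarith
  have hnm : n ≤ m := by
    by_contra hc
    push Not at hc
    have : q ≤ p := by nlinarith
    linarith
  have hd : Disjoint (Set.Ioo p q) (Set.Ioo n m) := by
    rw [Set.disjoint_left]
    rintro x ⟨h1, _⟩ ⟨_, h2⟩
    linarith
  rw [measure_congr key, measure_union hd measurableSet_Ioo, Real.volume_Ioo, Real.volume_Ioo,
    Real.volume_Ioo, ← ENNReal.ofReal_add (by linarith) (by linarith)]
  congr 1
  ring
end
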